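/- For every integer d ≥ 1 there exists a constant C_d > 0, depending only on d, such that for every integer n ≥ 1, every degree-d polynomial threshold function f : {-1,1}^n → {-1,1}, and every δ ∈ (0,1/2), setting t = −log(1−2δ), one has NS_δ[f] ≤ C_d · t^{1/2} · (log(e·n))^{C_d}. -/

import Mathlib

open Finset
open scoped Classical

/-- The embedding of `Bool` into `{-1, 1} ⊆ ℝ`. -/
noncomputable def chi (b : Bool) : ℝ := if b then 1 else -1

/-- Flip the `i`-th coordinate of a point of the Boolean cube. -/
def flipAt {n : ℕ} (x : Fin n → Bool) (i : Fin n) : Fin n → Bool :=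
  Function.update x i (!x i)

/-- The sensitivity of `f` at `x`: the number of coordinates whose flip changes `f`. -/
noncomputable def sens {n : ℕ} (f : (Fin n → Bool) → ℝ) (x : Fin n → Bool) : ℕ :=
  (Finset.univ.filter (fun i => f (flipAt x i) ≠ f x)).card

/-- The Boolean surface area `BSA[f] = E_x √(s_f(x))`, `x` uniform on the cube. -/
noncomputable def BSA {n : ℕ} (f : (Fin n → Bool) → ℝ) : ℝ :=
  (∑ x : Fin n → Bool, Real.sqrt (sens f x)) / 2 ^ n

/-- Evaluation of a polynomial at a point of the cube `{-1,1}^n`. -/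
noncomputable def pev {n : ℕ} (p : MvPolynomial (Fin n) ℝ) (x : Fin n → Bool) : ℝ :=
  MvPolynomial.eval (fun i => chi (x i)) p

/-- `f` is a degree-`d` polynomial threshold function: `f = sgn p` for some multilinear
polynomial `p` of total degree at most `d` that is nonvanishing on the cube. -/
def IsPTF (d : ℕ) {n : ℕ} (f : (Fin n → Bool) → ℝ) : Prop :=
  ∃ p : MvPolynomial (Fin n) ℝ,
    (∀ m ∈ p.support, ∀ i, m i ≤ 1) ∧ p.totalDegree ≤ d ∧
    ∀ x, pev p x ≠ 0 ∧ f x = Real.sign (pev p x)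

/-- The noise sensitivity of `f` with noise rate `δ`:
`NS_δ[f] = P[f(x) ≠ f(y)]` where `x` is uniform and `y` is obtained from `x` by flipping
each coordinate independently with probability `δ`. -/
noncomputable def NS {n : ℕ} (δ : ℝ) (f : (Fin n → Bool) → ℝ) : ℝ :=
  (∑ x : Fin n → Bool, ∑ z : Fin n → Bool,
    (∏ i, if z i then δ else 1 - δ) *
      (if f (fun i => (x i != z i)) ≠ f x then 1 else 0)) / 2 ^ n

section

open Finset
open scoped Classical BigOperators

set_option linter.all false

namespace PT

variable {ι : Type} [Fintype ι] [DecidableEq ι]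

noncomputable def ev (c : Finset ι → ℝ) (z : ι → ℝ) : ℝ := ∑ T, c T * ∏ i ∈ T, z i

def Deg (d : ℕ) (c : Finset ι → ℝ) : Prop := ∀ T, d < #T → c T = 0

def Supp (B : Finset ι) (c : Finset ι → ℝ) : Prop := ∀ T, ¬ T ⊆ B → c T = 0

noncomputable def nrm (c : Finset ι → ℝ) : ℝ := ∑ T, c T ^ 2

noncomputable def vr (c : Finset ι → ℝ) : ℝ := ∑ T, if T = ∅ then 0 else c T ^ 2

noncomputable def infl (i : ι) (c : Finset ι → ℝ) : ℝ := ∑ T, if i ∈ T then c T ^ 2 else 0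

def D (i : ι) (c : Finset ι → ℝ) : Finset ι → ℝ := fun T => if i ∈ T then 0 else c (insert i T)

def lo (i : ι) (c : Finset ι → ℝ) : Finset ι → ℝ := fun T => if i ∈ T then 0 else c T

noncomputable def res (B : Finset ι) (x : ι → ℝ) (c : Finset ι → ℝ) : Finset ι → ℝ :=
  fun S => ∑ T, if T ∩ B = S then c T * ∏ i ∈ T \ B, x i else 0

lemma sum_split {M : Type} [AddCommMonoid M] (i : ι) (g : Finset ι → M) :
    ∑ T, g T = ∑ T, (if i ∈ T then 0 else g T) + ∑ T, (if i ∈ T then 0 else g (insert i T)) := by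
  have hu : (univ : Finset (Finset ι)) = (insert i (univ.erase i)).powerset := by
    rw [insert_erase (mem_univ i), powerset_univ]
  have h2 : ((univ : Finset ι).erase i).powerset = univ.filter (fun T : Finset ι => i ∉ T) := by
    ext T; simp [mem_powerset, subset_erase]
  conv_lhs => rw [hu]
  rw [sum_powerset_insert (notMem_erase i univ), h2, sum_filter, sum_filter]
  congr 1 <;> · apply sum_congr rfl; intro T _; by_cases h : i ∈ T <;> simp [h]



lemma ev_update (i : ι) (c : Finset ι → ℝ) (z : ι → ℝ) (t : ℝ) :
    ev c (Function.update z i t) = ev (lo i c) z + t * ev (D i c) z := by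
  unfold ev
  rw [sum_split i, mul_sum]
  congr 1
  · apply sum_congr rfl
    intro T _
    by_cases h : i ∈ T
    · simp [h, lo]
    · simp only [h, lo, if_false]
      congr 1
      apply prod_congr rfl
      intro j hj
      rw [Function.update_of_ne]
      rintro rfl; exact h hj
  · apply sum_congr rfl
    intro T _
    by_cases h : i ∈ T
    · simp [h, D]
    · simp only [h, D, if_false]
      rw [prod_insert h, Function.update_self]
      have : ∏ j ∈ T, Function.update z i t j = ∏ j ∈ T, z j := by
        apply prod_congr rfl
        intro j hj
        rw [Function.update_of_ne]
        rintro rfl; exact h hj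
      rw [this]; ring

lemma ev_split (i : ι) (c : Finset ι → ℝ) (z : ι → ℝ) :
    ev c z = ev (lo i c) z + z i * ev (D i c) z := by
  have := ev_update i c z (z i)
  rwa [Function.update_eq_self] at this

lemma ev_D_eq (i : ι) (c : Finset ι → ℝ) (z : ι → ℝ) :
    ev (D i c) z = ev c (Function.update z i 1) - ev c (Function.update z i 0) := by
  rw [ev_update, ev_update]; ring

lemma ev_lo_update (i : ι) (c : Finset ι → ℝ) (z : ι → ℝ) (t : ℝ) :
    ev (lo i c) (Function.update z i t) = ev (lo i c) z := by
  rw [ev_update]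
  have h1 : lo i (lo i c) = lo i c := by
    ext T; simp only [lo]; split_ifs <;> rfl
  have h2 : D i (lo i c) = fun _ => 0 := by
    ext T; simp only [lo, D]; simp
  rw [h1, h2]; simp [ev]

lemma ev_D_update (i : ι) (c : Finset ι → ℝ) (z : ι → ℝ) (t : ℝ) :
    ev (D i c) (Function.update z i t) = ev (D i c) z := by
  rw [ev_update]
  have h1 : lo i (D i c) = D i c := by
    ext T; simp only [lo, D]; split_ifs <;> rfl
  have h2 : D i (D i c) = fun _ => 0 := by
    ext T; simp only [D]; simp
  rw [h1, h2]; simp [ev]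

lemma ev_res (B : Finset ι) (x : ι → ℝ) (c : Finset ι → ℝ) (z : ι → ℝ) :
    ev (res B x c) z = ev c (B.piecewise z x) := by
  unfold ev res
  simp_rw [sum_mul]
  rw [sum_comm]
  apply sum_congr rfl
  intro T _
  simp_rw [ite_mul, zero_mul]
  rw [sum_ite_eq, if_pos (mem_univ _)]
  have : ∏ i ∈ T, B.piecewise z x i = (∏ i ∈ T ∩ B, z i) * ∏ i ∈ T \ B, x i := by
    rw [← prod_inter_mul_prod_sdiff (s := T) (t := B)]
    congr 1
    · apply prod_congr rfl; intro j hj; simp [(mem_inter.1 hj).2]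
    · apply prod_congr rfl; intro j hj; simp [(mem_sdiff.1 hj).2]
  rw [this]; ring

lemma nrm_nonneg (c : Finset ι → ℝ) : 0 ≤ nrm c := sum_nonneg fun _ _ => sq_nonneg _
lemma vr_nonneg (c : Finset ι → ℝ) : 0 ≤ vr c :=
  sum_nonneg fun T _ => by split_ifs <;> positivity
lemma infl_nonneg (i : ι) (c : Finset ι → ℝ) : 0 ≤ infl i c :=
  sum_nonneg fun T _ => by split_ifs <;> positivity

lemma nrm_eq (c : Finset ι → ℝ) : nrm c = c ∅ ^ 2 + vr c := by
  have : c ∅ ^ 2 = ∑ T, if T = ∅ then c T ^ 2 else 0 := by simp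
  rw [this, nrm, vr, ← sum_add_distrib]
  apply sum_congr rfl; intro T _; split_ifs <;> simp

lemma vr_le_nrm (c : Finset ι → ℝ) : vr c ≤ nrm c := by rw [nrm_eq]; nlinarith [sq_nonneg (c ∅)]

lemma nrm_D (i : ι) (c : Finset ι → ℝ) : nrm (D i c) = infl i c := by
  unfold nrm infl
  rw [sum_split i (fun T => if i ∈ T then c T ^ 2 else 0)]
  have : ∑ T, (if i ∈ T then (0:ℝ) else if i ∈ T then c T ^ 2 else 0) = 0 := by
    apply sum_eq_zero; intro T _; split_ifs <;> rfl
  rw [this, zero_add]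
  apply sum_congr rfl; intro T _; simp only [D]; split_ifs <;> simp_all

lemma nrm_lo (i : ι) (c : Finset ι → ℝ) : nrm (lo i c) + infl i c = nrm c := by
  unfold nrm infl
  rw [← sum_add_distrib]
  apply sum_congr rfl; intro T _; simp only [lo]; split_ifs <;> simp

lemma sum_infl_eq (c : Finset ι → ℝ) : ∑ i, infl i c = ∑ T, (#T : ℝ) * c T ^ 2 := by
  unfold infl
  rw [sum_comm]
  apply sum_congr rfl; intro T _
  rw [← sum_filter]; simp

lemma vr_le_sum_infl (c : Finset ι → ℝ) : vr c ≤ ∑ i, infl i c := by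
  rw [sum_infl_eq]
  apply sum_le_sum; intro T _
  split_ifs with h
  · positivity
  · have : 1 ≤ #T := card_pos.2 (nonempty_iff_ne_empty.2 h)
    have : (1:ℝ) ≤ #T := by exact_mod_cast this
    nlinarith [sq_nonneg (c T)]

lemma sum_infl_le {d : ℕ} {c : Finset ι → ℝ} (h : Deg d c) : ∑ i, infl i c ≤ d * vr c := by
  rw [sum_infl_eq, vr, mul_sum]
  apply sum_le_sum; intro T _
  split_ifs with h1
  · simp [h1]
  · by_cases h2 : d < #T
    · simp [h T h2]
    · have : (#T : ℝ) ≤ d := by exact_mod_cast not_lt.1 h2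
      nlinarith [sq_nonneg (c T)]

lemma infl_le_vr (i : ι) (c : Finset ι → ℝ) : infl i c ≤ vr c := by
  apply sum_le_sum; intro T _
  by_cases h : i ∈ T
  · have : T ≠ ∅ := by rintro rfl; simp at h
    simp [h, this]
  · simp only [h, if_false]; split_ifs <;> positivity

lemma Deg.lo {d : ℕ} {c : Finset ι → ℝ} (h : Deg d c) (i : ι) : Deg d (lo i c) := by
  intro T hT; simp [PT.lo, h T hT]

lemma Deg.D {d : ℕ} {c : Finset ι → ℝ} (h : Deg (d+1) c) (i : ι) : Deg d (D i c) := by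
  intro T hT; simp only [PT.D]; split_ifs with h1
  · rfl
  · apply h; rw [card_insert_of_notMem h1]; omega

lemma Deg.D' {d : ℕ} {c : Finset ι → ℝ} (h : Deg d c) (i : ι) : Deg d (PT.D i c) := by
  intro T hT; simp only [PT.D]; split_ifs with h1
  · rfl
  · apply h; rw [card_insert_of_notMem h1]; omega

lemma D_zero {c : Finset ι → ℝ} (h : Deg 0 c) (i : ι) : D i c = fun _ => 0 := by
  ext T; simp only [D]; split_ifs with h1
  · rfl
  · apply h; rw [card_insert_of_notMem h1]; omega

lemma Supp.lo {B : Finset ι} {i : ι} {c : Finset ι → ℝ} (h : Supp (insert i B) c) :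
    Supp B (lo i c) := by
  intro T hT; simp only [PT.lo]; split_ifs with h1
  · rfl
  · apply h; intro h2; apply hT; rwa [subset_insert_iff_of_notMem h1] at h2

lemma Supp.D {B : Finset ι} {i : ι} {c : Finset ι → ℝ} (h : Supp (insert i B) c) :
    Supp B (D i c) := by
  intro T hT; simp only [PT.D]; split_ifs with h1
  · rfl
  · apply h; intro h2; apply hT
    intro j hj
    have := h2 (mem_insert_of_mem hj)
    rcases mem_insert.1 this with rfl | h3
    · exact absurd hj h1
    · exact h3

lemma infl_eq_zero {B : Finset ι} {i : ι} {c : Finset ι → ℝ} (h : Supp B c) (hi : i ∉ B) :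
    infl i c = 0 := by
  apply sum_eq_zero; intro T _; split_ifs with h1
  · rw [h T (fun h2 => hi (h2 h1))]; simp
  · rfl

lemma Deg.res {d : ℕ} {c : Finset ι → ℝ} (h : Deg d c) (B : Finset ι) (x : ι → ℝ) :
    Deg d (res B x c) := by
  intro S hS
  apply sum_eq_zero; intro T _; split_ifs with h1
  · rw [h T, zero_mul]
    exact lt_of_lt_of_le hS (h1 ▸ card_le_card inter_subset_left)
  · rfl

lemma Supp.res (B : Finset ι) (x : ι → ℝ) (c : Finset ι → ℝ) :
    Supp B (res B x c) := by
  intro S hS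
  apply sum_eq_zero; intro T _; split_ifs with h1
  · exact absurd (h1 ▸ inter_subset_right) hS
  · rfl

lemma Supp.res' {B : Finset ι} {c : Finset ι → ℝ} (h : Supp B c) (A : Finset ι) (x : ι → ℝ) :
    Supp B (PT.res A x c) := by
  intro S hS
  apply sum_eq_zero; intro T _; split_ifs with h1
  · rw [h T, zero_mul]
    intro h2; exact hS (h1 ▸ inter_subset_left.trans h2)
  · rfl

/-! ### Laws -/

structure Good {Ω : Type} [Fintype Ω] (u : Ω → ℝ) : Prop where
  m1 : 𝔼 a, u a = 0
  m2 : 𝔼 a, u a ^ 2 = 1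
  m3 : 𝔼 a, u a ^ 3 = 0
  bd : ∀ a, u a ^ 2 ≤ 2

def pt {Ω : Type} (u : ι → Ω → ℝ) (ω : ι → Ω) : ι → ℝ := fun i => u i (ω i)

noncomputable def ch (x : ι → Bool) : ι → ℝ := fun i => chi (x i)

lemma pt_chi (x : ι → Bool) : pt (fun _ => chi) x = ch x := rfl

lemma good_chi : Good chi := by
  constructor
  · rw [Fintype.expect_eq_sum_div_card]; simp [chi]
  · rw [Fintype.expect_eq_sum_div_card]; simp [chi]
  · rw [Fintype.expect_eq_sum_div_card]; simp only [Fintype.sum_bool, chi]; norm_num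
  · intro a; cases a <;> simp [chi]

section Fubini
variable {Ω : Type} [Fintype Ω] [Nonempty Ω]

lemma fub_update (i : ι) (f : (ι → Ω) → ℝ) :
    𝔼 ω, f ω = 𝔼 ω, 𝔼 a, f (Function.update ω i a) := by
  rw [← expect_product' univ univ (fun (ω : ι → Ω) (a : Ω) => f (Function.update ω i a))]
  rw [univ_product_univ]
  let e : (ι → Ω) × Ω ≃ (ι → Ω) × Ω :=
    { toFun := fun p => (Function.update p.1 i p.2, p.1 i)
      invFun := fun p => (Function.update p.1 i p.2, p.1 i)
      left_inv := by rintro ⟨ω, a⟩; simp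
      right_inv := by rintro ⟨ω, a⟩; simp }
  have : 𝔼 p : (ι → Ω) × Ω, f (Function.update p.1 i p.2) = 𝔼 p : (ι → Ω) × Ω, f p.1 :=
    Fintype.expect_equiv e _ _ (fun p => rfl)
  rw [this, ← univ_product_univ, expect_product' univ univ (fun (ω : ι → Ω) (a : Ω) => f ω)]
  simp

lemma fub_piecewise (B : Finset ι) (f : (ι → Ω) → ℝ) :
    𝔼 ω, f ω = 𝔼 ω, 𝔼 ω', f (B.piecewise ω' ω) := by
  rw [← expect_product' univ univ (fun (ω ω' : ι → Ω) => f (B.piecewise ω' ω))]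
  rw [univ_product_univ]
  let e : (ι → Ω) × (ι → Ω) ≃ (ι → Ω) × (ι → Ω) :=
    { toFun := fun p => (B.piecewise p.2 p.1, B.piecewise p.1 p.2)
      invFun := fun p => (B.piecewise p.2 p.1, B.piecewise p.1 p.2)
      left_inv := by
        rintro ⟨ω, a⟩; ext j <;> by_cases h : j ∈ B <;> simp [h]
      right_inv := by
        rintro ⟨ω, a⟩; ext j <;> by_cases h : j ∈ B <;> simp [h] }
  have : 𝔼 p : (ι → Ω) × (ι → Ω), f (B.piecewise p.2 p.1) = 𝔼 p : (ι → Ω) × (ι → Ω), f p.1 :=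
    Fintype.expect_equiv e _ _ (fun p => rfl)
  rw [this, ← univ_product_univ, expect_product' univ univ (fun (ω ω' : ι → Ω) => f ω)]
  simp

lemma pt_update (u : ι → Ω → ℝ) (ω : ι → Ω) (i : ι) (a : Ω) :
    pt u (Function.update ω i a) = Function.update (pt u ω) i (u i a) := by
  ext j; by_cases h : j = i
  · subst h; simp [pt]
  · simp [pt, h]

lemma pt_piecewise (u : ι → Ω → ℝ) (ω ω' : ι → Ω) (B : Finset ι) :
    pt u (B.piecewise ω' ω) = B.piecewise (pt u ω') (pt u ω) := by
  ext j; by_cases h : j ∈ B <;> simp [pt, h]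

lemma expect_prod (f : ι → Ω → ℝ) : 𝔼 ω : ι → Ω, ∏ i, f i (ω i) = ∏ i, 𝔼 a, f i a := by
  simp_rw [Fintype.expect_eq_sum_div_card]
  rw [prod_div_distrib, prod_univ_sum]
  simp [Fintype.piFinset_univ]

lemma parseval {u : ι → Ω → ℝ} (hu : ∀ i, Good (u i)) (c c' : Finset ι → ℝ) :
    𝔼 ω, ev c (pt u ω) * ev c' (pt u ω) = ∑ T, c T * c' T := by
  have key : ∀ T T' : Finset ι, 𝔼 ω, (∏ i ∈ T, pt u ω i) * (∏ i ∈ T', pt u ω i)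
      = if T = T' then 1 else 0 := by
    intro T T'
    have h1 : ∀ ω : ι → Ω, (∏ i ∈ T, pt u ω i) * (∏ i ∈ T', pt u ω i)
        = ∏ i, (fun i a => (if i ∈ T then u i a else 1) * (if i ∈ T' then u i a else 1)) i (ω i) := by
      intro ω
      simp only [prod_mul_distrib, pt]
      congr 1 <;> simp [prod_ite_mem]
    rw [expect_congr rfl (fun ω _ => h1 ω)]
    refine (expect_prod
      (fun i a => (if i ∈ T then u i a else 1) * (if i ∈ T' then u i a else 1))).trans ?_
    have h2 : ∀ i, 𝔼 a, ((if i ∈ T then u i a else 1) * (if i ∈ T' then u i a else 1))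
        = if (i ∈ T ↔ i ∈ T') then 1 else 0 := by
      intro i
      by_cases h : i ∈ T <;> by_cases h' : i ∈ T' <;> simp [h, h', (hu i).m1]
      have := (hu i).m2
      simpa [sq] using this
    simp_rw [h2]
    split_ifs with h
    · subst h; simp
    · have : ∃ i, ¬ (i ∈ T ↔ i ∈ T') := by
        by_contra hc; push Not at hc; exact h (Finset.ext hc)
      obtain ⟨i, hi⟩ := this
      exact prod_eq_zero (mem_univ i) (by simp [hi])
  have h3 : ∀ ω, ev c (pt u ω) * ev c' (pt u ω) =
      ∑ T, ∑ T', (c T * c' T') * ((∏ i ∈ T, pt u ω i) * (∏ i ∈ T', pt u ω i)) := by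
    intro ω; unfold ev; rw [sum_mul_sum]
    apply sum_congr rfl; intro T _; apply sum_congr rfl; intro T' _; ring
  simp_rw [h3]
  rw [expect_sum_comm]
  apply sum_congr rfl; intro T _
  rw [expect_sum_comm]
  simp_rw [← mul_expect, key]
  simp

lemma parseval_sq {u : ι → Ω → ℝ} (hu : ∀ i, Good (u i)) (c : Finset ι → ℝ) :
    𝔼 ω, ev c (pt u ω) ^ 2 = nrm c := by
  have := parseval hu c c
  simpa [sq, nrm] using this

lemma good_m4 {v : Ω → ℝ} (hv : Good v) : 𝔼 a, v a ^ 4 ≤ 2 := by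
  have : 𝔼 a, v a ^ 4 ≤ 𝔼 a, 2 * v a ^ 2 := by
    apply expect_le_expect; intro a _
    nlinarith [hv.bd a, sq_nonneg (v a)]
  rw [← mul_expect, hv.m2] at this; linarith

lemma bonami {u : ι → Ω → ℝ} (hu : ∀ i, Good (u i)) (B : Finset ι) :
    ∀ (d : ℕ) (c : Finset ι → ℝ), Deg d c → Supp B c →
    𝔼 ω, ev c (pt u ω) ^ 4 ≤ 9 ^ d * nrm c ^ 2 := by
  induction B using Finset.induction_on with
  | empty =>
    intro d c _ hs
    have h0 : ∀ T, T ≠ ∅ → c T = 0 := fun T hT => hs T (by simpa [subset_empty] using hT)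
    have h1 : ∀ z, ev c z = c ∅ := by
      intro z; unfold ev; rw [sum_eq_single ∅] <;> simp +contextual [h0]
    have h2 : nrm c = c ∅ ^ 2 := by
      unfold nrm; rw [sum_eq_single ∅] <;> simp +contextual [h0]
    simp only [h1, h2, expect_const univ_nonempty]
    have : (1:ℝ) ≤ 9 ^ d := one_le_pow₀ (by norm_num)
    nlinarith [sq_nonneg (c ∅ ^ 2)]
  | insert i B hi ih =>
    intro d c hd hs
    have hA := ih d (lo i c) (hd.lo i) hs.lo
    have hBd : 𝔼 ω, ev (D i c) (pt u ω) ^ 4 ≤ 9 ^ d / 9 * infl i c ^ 2 := by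
      cases d with
      | zero =>
        rw [D_zero hd i]; simp [ev]; positivity
      | succ d =>
        have := ih d (D i c) (hd.D i) hs.D
        rw [nrm_D] at this
        rw [pow_succ]; linarith
    rw [fub_update i]
    have hin : ∀ ω, 𝔼 a, ev c (pt u (Function.update ω i a)) ^ 4
        ≤ ev (lo i c) (pt u ω) ^ 4 + 6 * (ev (lo i c) (pt u ω) ^ 2 * ev (D i c) (pt u ω) ^ 2)
          + 2 * ev (D i c) (pt u ω) ^ 4 := by
      intro ω
      simp_rw [pt_update, ev_update]
      set A := ev (lo i c) (pt u ω)
      set E := ev (D i c) (pt u ω)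
      have : ∀ a, (A + u i a * E) ^ 4 = A ^ 4 + (4 * A ^ 3 * E) * u i a
          + (6 * (A ^ 2 * E ^ 2)) * u i a ^ 2 + (4 * A * E ^ 3) * u i a ^ 3 + E ^ 4 * u i a ^ 4 := by
        intro a; ring
      simp_rw [this, expect_add_distrib, ← mul_expect, (hu i).m1, (hu i).m2, (hu i).m3,
        expect_const univ_nonempty]
      have := good_m4 (hu i)
      nlinarith [mul_le_mul_of_nonneg_left this (by positivity : 0 ≤ E ^ 4)]
    refine (expect_le_expect fun ω _ => hin ω).trans ?_
    simp_rw [expect_add_distrib, ← mul_expect]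
    set a4 := 𝔼 ω, ev (lo i c) (pt u ω) ^ 4
    set b4 := 𝔼 ω, ev (D i c) (pt u ω) ^ 4
    set x := 𝔼 ω, ev (lo i c) (pt u ω) ^ 2 * ev (D i c) (pt u ω) ^ 2
    have hcs : x ^ 2 ≤ a4 * b4 := by
      have := expect_mul_sq_le_sq_mul_sq univ (fun ω => ev (lo i c) (pt u ω) ^ 2)
        (fun ω => ev (D i c) (pt u ω) ^ 2)
      simpa only [← pow_mul] using this
    have ha : 0 ≤ nrm (lo i c) := nrm_nonneg _
    have hb : 0 ≤ infl i c := infl_nonneg _ _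
    rw [← nrm_lo i c]
    set α := nrm (lo i c)
    set β := infl i c
    have hP : (0:ℝ) < 9 ^ d := by positivity
    set P : ℝ := 9 ^ d
    have ha4 : 0 ≤ a4 := expect_nonneg fun _ _ => by positivity
    have hb4 : 0 ≤ b4 := expect_nonneg fun _ _ => by positivity
    have hx : x ≤ P / 3 * (α * β) := by
      apply abs_le_of_sq_le_sq' _ (by positivity) |>.2
      calc x ^ 2 ≤ a4 * b4 := hcs
        _ ≤ (P * α ^ 2) * (P / 9 * β ^ 2) := by gcongr
        _ = _ := by ring
    nlinarith [mul_nonneg hP.le (sq_nonneg β)]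

lemma bonami' {u : ι → Ω → ℝ} (hu : ∀ i, Good (u i)) {d : ℕ} {c : Finset ι → ℝ} (h : Deg d c) :
    𝔼 ω, ev c (pt u ω) ^ 4 ≤ 9 ^ d * nrm c ^ 2 :=
  bonami hu univ d c h (fun T hT => absurd (subset_univ T) hT)

end Fubini

end PT

end

section

open Finset
open scoped Classical BigOperators

set_option linter.all false

namespace PT

lemma quad_facts {c0 c1 c2 : ℝ} (h : ∀ z : ℝ, 0 ≤ c0 + c1 * z + c2 * z ^ 2) :
    0 ≤ c0 ∧ 0 ≤ c2 ∧ c1 ^ 2 ≤ 4 * c0 * c2 := by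
  have h0 : 0 ≤ c0 := by simpa using h 0
  have hd : c1 ^ 2 ≤ 4 * c0 * c2 := by
    have : discrim c2 c1 c0 ≤ 0 := discrim_le_zero (fun x => by have := h x; nlinarith)
    unfold discrim at this; nlinarith
  refine ⟨h0, ?_, hd⟩
  by_contra hc
  push Not at hc
  have h1 := h 1
  have hm := h (-1)
  rcases h0.lt_or_eq with h2 | h2
  · nlinarith [sq_nonneg c1]
  · nlinarith

set_option maxHeartbeats 800000 in
lemma ps {m0 m1 m2 a b κ : ℝ} (hκ : 0 ≤ κ) (hb : κ ^ 2 = b)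
    (hN : ∀ z : ℝ, 0 ≤ m0 + m1 * z + m2 * z ^ 2)
    (hQ : ∀ z : ℝ, m0 + m1 * z + m2 * z ^ 2 ≤ 1 + a * z + b * z ^ 2)
    (hpos : ∀ z : ℝ, 0 < 1 + a * z + b * z ^ 2) :
    ∃ c0 c1 c2 c3 : ℝ, ∀ z : ℝ, z ^ 2 ≤ 2 →
      |(m0 + m1 * z + m2 * z ^ 2) / (1 + a * z + b * z ^ 2)
        - (c0 + c1 * z + c2 * z ^ 2 + c3 * z ^ 3)| ≤ 4096 * κ ^ 4 := by
  by_cases hk : 1 / 8 ≤ κ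
  · refine ⟨0, 0, 0, 0, fun z _ => ?_⟩
    have h1 : (1:ℝ) ≤ 4096 * κ ^ 4 := by
      have : (1/8:ℝ) ^ 4 ≤ κ ^ 4 := by gcongr
      norm_num at this ⊢; linarith
    have h2 : 0 ≤ (m0 + m1 * z + m2 * z ^ 2) / (1 + a * z + b * z ^ 2) :=
      div_nonneg (hN z) (hpos z).le
    have h3 : (m0 + m1 * z + m2 * z ^ 2) / (1 + a * z + b * z ^ 2) ≤ 1 := by
      rw [div_le_one (hpos z)]; exact hQ z
    rw [abs_of_nonneg] <;> simp <;> linarith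
  push Not at hk
  obtain ⟨hm0, hm2, hd1⟩ := quad_facts hN
  obtain ⟨_, _, hd2⟩ := quad_facts (fun z => (hpos z).le)
  obtain ⟨hm0', hm2', _⟩ := quad_facts (c0 := 1 - m0) (c1 := a - m1) (c2 := b - m2)
    (fun z => by have := hQ z; nlinarith)
  have ha : |a| ≤ 2 * κ := abs_le_of_sq_le_sq (by nlinarith) (by positivity)
  have hm1 : |m1| ≤ 2 * κ := by
    apply abs_le_of_sq_le_sq _ (by positivity)
    have : m0 * m2 ≤ 1 * b := by gcongr <;> linarith
    nlinarith
  have hb0 : |b| ≤ κ ^ 2 := by rw [abs_of_nonneg] <;> nlinarith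
  obtain ⟨c1, hc1⟩ : ∃ c1, c1 = m1 - a * m0 := ⟨_, rfl⟩
  obtain ⟨c2, hc2⟩ : ∃ c2, c2 = m2 - a * c1 - b * m0 := ⟨_, rfl⟩
  obtain ⟨c3, hc3⟩ : ∃ c3, c3 = - a * c2 - b * c1 := ⟨_, rfl⟩
  have hA0 : |m0| ≤ 1 := by rw [abs_of_nonneg hm0]; linarith
  have hA2 : |m2| ≤ κ ^ 2 := by rw [abs_of_nonneg hm2]; linarith
  have mulb : ∀ {x y X Y : ℝ}, |x| ≤ X → |y| ≤ Y → |x * y| ≤ X * Y := by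
    intro x y X Y hx hy
    rw [abs_mul]; exact mul_le_mul hx hy (abs_nonneg _) ((abs_nonneg _).trans hx)
  have hC1 : |c1| ≤ 4 * κ := by
    rw [hc1]; refine (abs_sub _ _).trans ?_
    have := mulb ha hA0; linarith
  have hC2 : |c2| ≤ 10 * κ ^ 2 := by
    rw [hc2]; refine (abs_sub _ _).trans ?_
    have := abs_sub m2 (a * c1)
    have := mulb ha hC1; have := mulb hb0 hA0; nlinarith
  have hC3 : |c3| ≤ 24 * κ ^ 3 := by
    rw [hc3]; refine (abs_sub _ _).trans ?_
    rw [neg_mul, abs_neg]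
    have := mulb ha hC2; have := mulb hb0 hC1; nlinarith
  refine ⟨m0, c1, c2, c3, fun z hz => ?_⟩
  have hzb : |z| ≤ 3 / 2 := abs_le_of_sq_le_sq (by nlinarith) (by norm_num)
  have hrem : (m0 + m1 * z + m2 * z ^ 2) / (1 + a * z + b * z ^ 2)
        - (m0 + c1 * z + c2 * z ^ 2 + c3 * z ^ 3)
      = (-(a * c3 + b * c2) * z ^ 4 - b * c3 * z ^ 5) / (1 + a * z + b * z ^ 2) := by
    rw [div_sub' (hpos z).ne']
    congr 1
    rw [hc3, hc2, hc1]; ring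
  rw [hrem, abs_div, div_le_iff₀ (abs_pos.2 (hpos z).ne')]
  have hQl : 1 / 2 ≤ 1 + a * z + b * z ^ 2 := by
    have h1 := mulb ha hzb
    have h2 := abs_le.1 h1
    have h3 : 0 ≤ b * z ^ 2 := by rw [← hb]; positivity
    linarith [h2.1]
  have e4 : |z ^ 4| ≤ 4 := by
    rw [abs_of_nonneg (by positivity)]; nlinarith [sq_nonneg z]
  have e5 : |z ^ 5| ≤ 6 := by
    rw [pow_succ]; have := mulb e4 hzb; linarith
  have s1 : |-(a * c3 + b * c2)| ≤ 58 * κ ^ 4 := by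
    rw [abs_neg]; refine (abs_add_le _ _).trans ?_
    have := mulb ha hC3; have := mulb hb0 hC2; nlinarith
  have s2 : |b * c3| ≤ 3 * κ ^ 4 := by
    have h1 := mulb hb0 hC3
    have h2 : κ ^ 2 * (24 * κ ^ 3) = 24 * (κ * κ ^ 4) := by ring
    have h3 : κ * κ ^ 4 ≤ 1 / 8 * κ ^ 4 := by gcongr
    rw [h2] at h1
    linarith
  have t1 := mulb s1 e4
  have t2 := mulb s2 e5
  have hk4 : 0 ≤ κ ^ 4 := by positivity
  calc |-(a * c3 + b * c2) * z ^ 4 - b * c3 * z ^ 5| ≤ _ := abs_sub _ _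
    _ ≤ 58 * κ ^ 4 * 4 + 3 * κ ^ 4 * 6 := add_le_add t1 t2
    _ ≤ 4096 * κ ^ 4 * (1 / 2) := by nlinarith
    _ ≤ 4096 * κ ^ 4 * |1 + a * z + b * z ^ 2| := by
      gcongr; exact hQl.trans (le_abs_self _)

section
variable {Ω : Type} [Fintype Ω] [Nonempty Ω]

lemma lind1 {v v' : Ω → ℝ} (hv : Good v) (hv' : Good v') {n0 n1 n2 q0 q1 q2 η : ℝ} (hη : 0 < η)
    (hN : ∀ z : ℝ, 0 ≤ n0 + n1 * z + n2 * z ^ 2)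
    (hQ : ∀ z : ℝ, n0 + n1 * z + n2 * z ^ 2 + η ≤ q0 + q1 * z + q2 * z ^ 2) :
    |𝔼 a, (n0 + n1 * v a + n2 * v a ^ 2) / (q0 + q1 * v a + q2 * v a ^ 2)
      - 𝔼 a, (n0 + n1 * v' a + n2 * v' a ^ 2) / (q0 + q1 * v' a + q2 * v' a ^ 2)|
      ≤ 8192 * (q2 / η) ^ 2 := by
  have hq0 : η ≤ q0 := by have := hQ 0; have := hN 0; simp at *; linarith
  have hq0p : 0 < q0 := hη.trans_le hq0
  have hq2 : 0 ≤ q2 := (quad_facts (fun z => by linarith [hQ z, hN z, hη] :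
    ∀ z : ℝ, 0 ≤ q0 + q1 * z + q2 * z ^ 2)).2.1
  obtain ⟨c0, c1, c2, c3, hc⟩ := ps (m0 := n0 / q0) (m1 := n1 / q0) (m2 := n2 / q0)
    (a := q1 / q0) (b := q2 / q0) (κ := √(q2 / q0)) (Real.sqrt_nonneg _)
    (Real.sq_sqrt (by positivity))
    (fun z => by
      have : n0 / q0 + n1 / q0 * z + n2 / q0 * z ^ 2 = (n0 + n1 * z + n2 * z ^ 2) / q0 := by
        field_simp
      rw [this]; exact div_nonneg (hN z) hq0p.le)
    (fun z => by
      have : n0 / q0 + n1 / q0 * z + n2 / q0 * z ^ 2 = (n0 + n1 * z + n2 * z ^ 2) / q0 := by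
        field_simp
      rw [this]
      have : 1 + q1 / q0 * z + q2 / q0 * z ^ 2 = (q0 + q1 * z + q2 * z ^ 2) / q0 := by
        field_simp
      rw [this]; apply div_le_div_of_nonneg_right _ hq0p.le; linarith [hQ z])
    (fun z => by
      have : 1 + q1 / q0 * z + q2 / q0 * z ^ 2 = (q0 + q1 * z + q2 * z ^ 2) / q0 := by
        field_simp
      rw [this]; apply div_pos _ hq0p; linarith [hQ z, hN z])
  have hk : √(q2 / q0) ^ 4 ≤ (q2 / η) ^ 2 := by
    have : √(q2 / q0) ^ 4 = (q2 / q0) ^ 2 := by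
      rw [show 4 = 2 * 2 from rfl, pow_mul, Real.sq_sqrt (by positivity)]
    rw [this]; gcongr
  have hc' : ∀ z : ℝ, z ^ 2 ≤ 2 → |(n0 + n1 * z + n2 * z ^ 2) / (q0 + q1 * z + q2 * z ^ 2)
      - (c0 + c1 * z + c2 * z ^ 2 + c3 * z ^ 3)| ≤ 4096 * (q2 / η) ^ 2 := by
    intro z hz
    have h1 := hc z hz
    have : (n0 / q0 + n1 / q0 * z + n2 / q0 * z ^ 2) / (1 + q1 / q0 * z + q2 / q0 * z ^ 2)
        = (n0 + n1 * z + n2 * z ^ 2) / (q0 + q1 * z + q2 * z ^ 2) := by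
      have h2 : n0 / q0 + n1 / q0 * z + n2 / q0 * z ^ 2 = (n0 + n1 * z + n2 * z ^ 2) / q0 := by
        field_simp
      have h3 : 1 + q1 / q0 * z + q2 / q0 * z ^ 2 = (q0 + q1 * z + q2 * z ^ 2) / q0 := by
        field_simp
      rw [h2, h3, div_div_div_cancel_right₀ hq0p.ne']
    rw [this] at h1
    exact h1.trans (by gcongr)
  have key : ∀ w : Ω → ℝ, Good w →
      |𝔼 a, (n0 + n1 * w a + n2 * w a ^ 2) / (q0 + q1 * w a + q2 * w a ^ 2) - (c0 + c2)|
        ≤ 4096 * (q2 / η) ^ 2 := by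
    intro w hw
    have h1 : 𝔼 a, (c0 + c1 * w a + c2 * w a ^ 2 + c3 * w a ^ 3) = c0 + c2 := by
      simp_rw [expect_add_distrib, ← mul_expect, hw.m1, hw.m2, hw.m3, expect_const univ_nonempty]
      ring
    rw [← h1, ← expect_sub_distrib]
    refine (abs_expect_le _ _).trans ?_
    refine (expect_le_expect fun a _ => hc' (w a) (hw.bd a)).trans ?_
    rw [expect_const univ_nonempty]
  have k1 := key v hv
  have k2 := key v' hv'
  rw [abs_sub_comm] at k2
  have := abs_sub_le (𝔼 a, (n0 + n1 * v a + n2 * v a ^ 2) / (q0 + q1 * v a + q2 * v a ^ 2)) (c0 + c2)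
    (𝔼 a, (n0 + n1 * v' a + n2 * v' a ^ 2) / (q0 + q1 * v' a + q2 * v' a ^ 2))
  linarith

variable {ι : Type} [Fintype ι] [DecidableEq ι] {σ : Type} [Fintype σ]

noncomputable def ratio (a : σ → Finset ι → ℝ) (A : Finset σ) (η : ℝ) (z : ι → ℝ) : ℝ :=
  (∑ s ∈ A, ev (a s) z ^ 2) / (∑ s, ev (a s) z ^ 2 + η)

lemma mom4 {u : ι → Ω → ℝ} (hu : ∀ i, Good (u i)) {d : ℕ} {a : σ → Finset ι → ℝ}
    (ha : ∀ s, Deg d (a s)) :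
    𝔼 ω, (∑ s, ev (a s) (pt u ω) ^ 2) ^ 2 ≤ 9 ^ d * (∑ s, nrm (a s)) ^ 2 := by
  have h1 : ∀ ω, (∑ s, ev (a s) (pt u ω) ^ 2) ^ 2
      = ∑ s, ∑ s', ev (a s) (pt u ω) ^ 2 * ev (a s') (pt u ω) ^ 2 := by
    intro ω; rw [sq, sum_mul_sum]
  simp_rw [h1]
  rw [expect_sum_comm]
  simp_rw [expect_sum_comm]
  rw [sq, sum_mul_sum, mul_sum]
  apply sum_le_sum; intro s _
  rw [mul_sum]
  apply sum_le_sum; intro s' _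
  have hp := nrm_nonneg (a s)
  have hp' := nrm_nonneg (a s')
  apply abs_le_of_sq_le_sq' _ (by positivity) |>.2
  have h2 := expect_mul_sq_le_sq_mul_sq univ (fun ω => ev (a s) (pt u ω) ^ 2)
    (fun ω => ev (a s') (pt u ω) ^ 2)
  simp only [← pow_mul] at h2
  refine h2.trans ?_
  calc _ ≤ (9 ^ d * nrm (a s) ^ 2) * (9 ^ d * nrm (a s') ^ 2) := by
        apply mul_le_mul (bonami' hu (ha s)) (bonami' hu (ha s'))
        · exact expect_nonneg fun _ _ => by positivity
        · positivity
    _ = _ := by ring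

lemma lind_step {u u' : ι → Ω → ℝ} (hu : ∀ i, Good (u i)) (hu' : ∀ i, Good (u' i)) {d : ℕ}
    {a : σ → Finset ι → ℝ} (ha : ∀ s, Deg d (a s)) (A : Finset σ) {η : ℝ} (hη : 0 < η)
    (i : ι) (hi : ∀ j, j ≠ i → u' j = u j) :
    |𝔼 ω, ratio a A η (pt u ω) - 𝔼 ω, ratio a A η (pt u' ω)|
      ≤ 8192 * 9 ^ d / η ^ 2 * (∑ s, infl i (a s)) ^ 2 := by
  rw [fub_update i, fub_update i (fun ω => ratio a A η (pt u' ω)), ← expect_sub_distrib]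
  refine (abs_expect_le _ _).trans ?_
  have h1 : ∀ ω, |𝔼 b, ratio a A η (pt u (Function.update ω i b))
        - 𝔼 b, ratio a A η (pt u' (Function.update ω i b))|
      ≤ 8192 / η ^ 2 * (∑ s, ev (D i (a s)) (pt u ω) ^ 2) ^ 2 := by
    intro ω
    have h2 : ∀ b, pt u' (Function.update ω i b) = Function.update (pt u ω) i (u' i b) := by
      intro b
      rw [pt_update]
      ext j; by_cases h : j = i
      · subst h; simp
      · simp [h, pt, hi j h]
    simp_rw [h2, pt_update]
    set z := pt u ω
    have hs : ∀ (S : Finset σ) (t : ℝ), ∑ s ∈ S, ev (a s) (Function.update z i t) ^ 2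
        = ∑ s ∈ S, ev (lo i (a s)) z ^ 2
          + (∑ s ∈ S, 2 * ev (lo i (a s)) z * ev (D i (a s)) z) * t
          + (∑ s ∈ S, ev (D i (a s)) z ^ 2) * t ^ 2 := by
      intro S t
      rw [sum_mul, sum_mul, ← sum_add_distrib, ← sum_add_distrib]
      apply sum_congr rfl; intro s _; rw [ev_update]; ring
    unfold ratio
    have hQ' : ∀ t : ℝ, ∑ s, ev (a s) (Function.update z i t) ^ 2 + η
        = (∑ s, ev (lo i (a s)) z ^ 2 + η)
          + (∑ s, 2 * ev (lo i (a s)) z * ev (D i (a s)) z) * t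
          + (∑ s, ev (D i (a s)) z ^ 2) * t ^ 2 := by
      intro t; rw [hs]; ring
    simp_rw [hQ', hs]
    refine (lind1 (hu i) (hu' i) hη ?_ ?_).trans (le_of_eq ?_)
    · intro t; rw [← hs]; positivity
    · intro t; rw [← hs, ← hQ']; gcongr
      exact subset_univ A
    · rw [div_pow]; ring
  refine (expect_le_expect fun ω _ => h1 ω).trans ?_
  rw [← mul_expect]
  have h3 := mom4 hu (fun s => (ha s).D' i)
  simp_rw [nrm_D] at h3
  calc _ ≤ 8192 / η ^ 2 * (9 ^ d * (∑ s, infl i (a s)) ^ 2) := by gcongr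
    _ = _ := by ring

lemma lind {u u' : ι → Ω → ℝ} (hu : ∀ i, Good (u i)) (hu' : ∀ i, Good (u' i)) {d : ℕ}
    {a : σ → Finset ι → ℝ} (ha : ∀ s, Deg d (a s)) (A : Finset σ) {η : ℝ} (hη : 0 < η) :
    |𝔼 ω, ratio a A η (pt u ω) - 𝔼 ω, ratio a A η (pt u' ω)|
      ≤ 8192 * 9 ^ d / η ^ 2 * ∑ i, (∑ s, infl i (a s)) ^ 2 := by
  have key : ∀ S : Finset ι, |𝔼 ω, ratio a A η (pt u ω)
      - 𝔼 ω, ratio a A η (pt (S.piecewise u' u) ω)|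
      ≤ 8192 * 9 ^ d / η ^ 2 * ∑ i ∈ S, (∑ s, infl i (a s)) ^ 2 := by
    intro S
    induction S using Finset.induction_on with
    | empty => simp
    | insert i S hi ih =>
      rw [sum_insert hi, mul_add, add_comm]
      refine (abs_sub_le _ (𝔼 ω, ratio a A η (pt (S.piecewise u' u) ω)) _).trans ?_
      apply add_le_add ih
      apply lind_step _ _ ha A hη
      · intro j hj; simp [piecewise_insert, Function.update_of_ne hj]
      · intro j; by_cases h : j ∈ S <;> simp [h, hu, hu']
      · intro j; by_cases h : j ∈ insert i S <;> simp [h, hu, hu']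
  have := key univ
  simpa using this

end

lemma expect_fst {Ω Ω' : Type} [Fintype Ω] [Nonempty Ω] [Fintype Ω'] [Nonempty Ω']
    {ι : Type} [Fintype ι] [DecidableEq ι] (F : (ι → Ω) → ℝ) :
    𝔼 ω : ι → Ω × Ω', F (fun i => (ω i).1) = 𝔼 ω, F ω := by
  have h := Fintype.expect_equiv (Equiv.arrowProdEquivProdArrow ι (fun _ => Ω) (fun _ => Ω'))
    (fun ω : ι → Ω × Ω' => F (fun i => (ω i).1)) (fun p => F p.1) (fun ω => rfl)
  rw [h, ← univ_product_univ, expect_product' univ univ (fun (x : ι → Ω) (y : ι → Ω') => F x)]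
  simp

lemma expect_snd {Ω Ω' : Type} [Fintype Ω] [Nonempty Ω] [Fintype Ω'] [Nonempty Ω']
    {ι : Type} [Fintype ι] [DecidableEq ι] (F : (ι → Ω') → ℝ) :
    𝔼 ω : ι → Ω × Ω', F (fun i => (ω i).2) = 𝔼 ω, F ω := by
  have h := Fintype.expect_equiv (Equiv.arrowProdEquivProdArrow ι (fun _ => Ω) (fun _ => Ω'))
    (fun ω : ι → Ω × Ω' => F (fun i => (ω i).2)) (fun p => F p.2) (fun ω => rfl)
  rw [h, ← univ_product_univ, expect_product' univ univ (fun (x : ι → Ω) (y : ι → Ω') => F y)]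
  simp

/-- Lindeberg for laws on different spaces. -/
lemma lind2 {Ω Ω' : Type} [Fintype Ω] [Nonempty Ω] [Fintype Ω'] [Nonempty Ω']
    {ι : Type} [Fintype ι] [DecidableEq ι] {σ : Type} [Fintype σ]
    {v : Ω → ℝ} {v' : Ω' → ℝ} (hv : Good v) (hv' : Good v') {d : ℕ}
    {a : σ → Finset ι → ℝ} (ha : ∀ s, Deg d (a s)) (A : Finset σ) {η : ℝ} (hη : 0 < η) :
    |𝔼 ω, ratio a A η (pt (fun _ => v) ω) - 𝔼 ω, ratio a A η (pt (fun _ => v') ω)|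
      ≤ 8192 * 9 ^ d / η ^ 2 * ∑ i, (∑ s, infl i (a s)) ^ 2 := by
  have e1 : ∀ f : Ω → ℝ, 𝔼 p : Ω × Ω', f p.1 = 𝔼 a, f a := by
    intro f
    rw [← univ_product_univ, expect_product' univ univ (fun (x : Ω) (y : Ω') => f x)]; simp
  have e2 : ∀ f : Ω' → ℝ, 𝔼 p : Ω × Ω', f p.2 = 𝔼 a, f a := by
    intro f
    rw [← univ_product_univ, expect_product' univ univ (fun (x : Ω) (y : Ω') => f y)]; simp
  have g1 : Good (fun p : Ω × Ω' => v p.1) :=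
    ⟨(e1 _).trans hv.m1, (e1 (fun a => v a ^ 2)).trans hv.m2, (e1 (fun a => v a ^ 3)).trans hv.m3,
      fun a => hv.bd _⟩
  have g2 : Good (fun p : Ω × Ω' => v' p.2) :=
    ⟨(e2 _).trans hv'.m1, (e2 (fun a => v' a ^ 2)).trans hv'.m2,
      (e2 (fun a => v' a ^ 3)).trans hv'.m3, fun a => hv'.bd _⟩
  have := lind (fun _ => g1) (fun _ => g2) ha A hη
  have f1 := expect_fst (ι := ι) (Ω' := Ω') (fun ω => ratio a A η (pt (fun _ => v) ω))
  have f2 := expect_snd (ι := ι) (Ω := Ω) (fun ω => ratio a A η (pt (fun _ => v') ω))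
  rw [← f1, ← f2]
  exact this

end PT

end

section

open Finset
open scoped Classical BigOperators

set_option linter.all false

namespace PT

noncomputable def gr {N : ℕ} [NeZero N] (j : ZMod N) : ℂ := ZMod.stdAddChar j

section grid
variable {N : ℕ} [NeZero N]

lemma gr_norm (j : ZMod N) : ‖gr j‖ = 1 := AddChar.norm_apply _ _

lemma gr_add (j k : ZMod N) : gr (j + k) = gr j * gr k := AddChar.map_add_eq_mul _ _ _

lemma gr_zero : gr (0 : ZMod N) = 1 := AddChar.map_zero_eq_one _

lemma gr_dist0 (j : ZMod N) : 4 * |(j.valMinAbs : ℝ)| / N ≤ ‖gr j - 1‖ := by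
  have hN : (0:ℝ) < N := by exact_mod_cast Nat.pos_of_ne_zero (NeZero.ne N)
  have h1 : gr j = Complex.exp (Complex.I * ((2 * Real.pi * j.valMinAbs / N : ℝ) : ℂ)) := by
    conv_lhs => rw [← ZMod.coe_valMinAbs j]
    unfold gr
    rw [ZMod.stdAddChar_coe]
    congr 1; push_cast; ring
  rw [h1, Complex.norm_exp_I_mul_ofReal_sub_one, norm_mul, Real.norm_eq_abs, Real.norm_eq_abs]
  have hv : |(j.valMinAbs : ℝ)| ≤ N / 2 := by
    have := ZMod.natAbs_valMinAbs_le j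
    have h2 : 2 * j.valMinAbs.natAbs ≤ N := by omega
    have h3 : (2:ℝ) * (j.valMinAbs.natAbs : ℝ) ≤ N := by exact_mod_cast h2
    rw [Nat.cast_natAbs] at h3
    push_cast at h3; linarith
  have hx : |2 * Real.pi * j.valMinAbs / N / 2| = Real.pi * |(j.valMinAbs : ℝ)| / N := by
    have : 2 * Real.pi * j.valMinAbs / N / 2 = Real.pi / N * j.valMinAbs := by ring
    rw [this, abs_mul, abs_of_pos (by positivity)]; ring
  have := Real.mul_abs_le_abs_sin (x := 2 * Real.pi * j.valMinAbs / N / 2) (by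
    rw [hx, div_le_div_iff₀ hN (by norm_num)]
    nlinarith [Real.pi_pos])
  rw [hx] at this
  have h4 : 2 / Real.pi * (Real.pi * |(j.valMinAbs : ℝ)| / N) = 2 * |(j.valMinAbs : ℝ)| / N := by
    field_simp
  rw [h4] at this
  calc 4 * |(j.valMinAbs : ℝ)| / N = 2 * (2 * |(j.valMinAbs : ℝ)| / N) := by ring
    _ ≤ _ := by rw [abs_of_pos (by norm_num : (0:ℝ) < 2)]; gcongr

lemma gr_dist (j k : ZMod N) : 4 * |((j - k).valMinAbs : ℝ)| / N ≤ ‖gr j - gr k‖ := by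
  refine (gr_dist0 (j - k)).trans (le_of_eq ?_)
  have : gr j - gr k = (gr (j - k) - 1) * gr k := by
    rw [sub_mul, ← gr_add, sub_add_cancel, one_mul]
  rw [this, norm_mul, gr_norm, mul_one]

noncomputable def cz : ℝ := ∑' v : ℤ, 1 / (v : ℝ) ^ 2

lemma cz_sum : ∑ j : ZMod N, 1 / (j.valMinAbs : ℝ) ^ 2 ≤ cz := by
  have hs : Summable (fun v : ℤ => 1 / (v : ℝ) ^ 2) :=
    Real.summable_one_div_int_pow.2 (by norm_num)
  rw [← sum_image (f := fun v : ℤ => 1 / (v : ℝ) ^ 2) (g := fun j : ZMod N => j.valMinAbs)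
    (fun a _ b _ h => ZMod.injective_valMinAbs h)]
  exact hs.sum_le_tsum _ (fun v _ => by positivity)

lemma cz_nonneg : 0 ≤ cz := tsum_nonneg fun v => by positivity

/-- Nearest grid point. -/
lemma exists_near (z : ℂ) : ∃ k : ZMod N, ∀ j : ZMod N, ‖gr j - gr k‖ ≤ 2 * ‖gr j - z‖ := by
  obtain ⟨k, -, hk⟩ := exists_min_image univ (fun j : ZMod N => ‖gr j - z‖) univ_nonempty
  refine ⟨k, fun j => ?_⟩
  have h1 := hk j (mem_univ j)
  have h2 : ‖gr j - gr k‖ ≤ ‖gr j - z‖ + ‖gr k - z‖ := by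
    have : gr j - gr k = (gr j - z) - (gr k - z) := by ring
    rw [this]; exact norm_sub_le _ _
  linarith

lemma near_dist {z : ℂ} {k : ZMod N} (hk : ∀ j : ZMod N, ‖gr j - gr k‖ ≤ 2 * ‖gr j - z‖)
    (j : ZMod N) : 2 * |((j - k).valMinAbs : ℝ)| / N ≤ ‖gr j - z‖ := by
  have h1 := gr_dist j k
  have h2 := hk j
  have : 4 * |((j - k).valMinAbs : ℝ)| / N = 2 * (2 * |((j - k).valMinAbs : ℝ)| / N) := by ring
  linarith

lemma near_sum {z : ℂ} {k : ZMod N} (hk : ∀ j : ZMod N, ‖gr j - gr k‖ ≤ 2 * ‖gr j - z‖) :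
    ∑ j ∈ univ.erase k, 1 / ‖gr j - z‖ ^ 2 ≤ cz * N ^ 2 := by
  have hN : (0:ℝ) < N := by exact_mod_cast Nat.pos_of_ne_zero (NeZero.ne N)
  calc ∑ j ∈ univ.erase k, 1 / ‖gr j - z‖ ^ 2
      ≤ ∑ j ∈ univ.erase k, N ^ 2 * (1 / ((j - k).valMinAbs : ℝ) ^ 2) := by
        apply sum_le_sum; intro j hj
        have hne : j - k ≠ 0 := sub_ne_zero.2 (ne_of_mem_erase hj)
        have hv : ((j - k).valMinAbs : ℝ) ≠ 0 := by
          have : (j - k).valMinAbs ≠ 0 := by rwa [Ne, ZMod.valMinAbs_eq_zero]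
          exact_mod_cast this
        have h1 := near_dist hk j
        have h0 : 0 < |((j - k).valMinAbs : ℝ)| := abs_pos.2 hv
        have h2 : |((j - k).valMinAbs : ℝ)| / N ≤ ‖gr j - z‖ := by
          refine le_trans ?_ h1
          gcongr; linarith
        calc 1 / ‖gr j - z‖ ^ 2 ≤ 1 / (|((j - k).valMinAbs : ℝ)| / N) ^ 2 := by gcongr
          _ = _ := by rw [div_pow, sq_abs]; field_simp
    _ ≤ ∑ j, N ^ 2 * (1 / ((j - k).valMinAbs : ℝ) ^ 2) :=
        sum_le_sum_of_subset_of_nonneg (subset_univ _) (fun _ _ _ => by positivity)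
    _ = N ^ 2 * ∑ j : ZMod N, 1 / (j.valMinAbs : ℝ) ^ 2 := by
        rw [← mul_sum]; congr 1
        exact Fintype.sum_equiv (Equiv.subRight k) _ _ (fun j => rfl)
    _ ≤ _ := by rw [mul_comm]; gcongr; exact cz_sum

lemma near_card {z : ℂ} {ε : ℝ} (hε : 0 < ε) (hN : 1 ≤ ε * N) :
    (#(univ.filter (fun j : ZMod N => ‖gr j - z‖ < ε)) : ℝ) ≤ 2 * ε * N := by
  have hNp : (0:ℝ) < N := by exact_mod_cast Nat.pos_of_ne_zero (NeZero.ne N)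
  obtain ⟨k, hk⟩ := exists_near (N := N) z
  set M : ℤ := ⌊ε * N / 2⌋ with hM
  have h1 : #(univ.filter (fun j : ZMod N => ‖gr j - z‖ < ε)) ≤ #(Icc (-M) M) := by
    apply card_le_card_of_injOn (fun j : ZMod N => (j - k).valMinAbs)
    · intro j hj
      simp only [coe_filter, mem_univ, true_and, Set.mem_setOf_eq] at hj
      have h2 := (near_dist hk j).trans hj.le
      rw [div_le_iff₀ hNp] at h2
      have h3 : |((j - k).valMinAbs : ℝ)| ≤ ε * N / 2 := by linarith
      have h4 : |(j - k).valMinAbs| ≤ M := by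
        rw [hM, Int.le_floor]; push_cast; exact h3
      simpa [abs_le] using h4
    · intro a _ b _ h
      have := ZMod.injective_valMinAbs h
      simpa using this
  have hM0 : 0 ≤ M := Int.floor_nonneg.2 (by positivity)
  rw [Int.card_Icc] at h1
  have h5 : (#(univ.filter (fun j : ZMod N => ‖gr j - z‖ < ε)) : ℤ) ≤ 2 * M + 1 := by omega
  have h6 : (#(univ.filter (fun j : ZMod N => ‖gr j - z‖ < ε)) : ℝ) ≤ 2 * M + 1 := by
    exact_mod_cast h5
  have h7 : (M : ℝ) ≤ ε * N / 2 := Int.floor_le _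
  linarith

end grid

lemma roots_data {P : Polynomial ℂ} (hP : P ≠ 0) : ∃ (σ : Type) (_ : Fintype σ) (r : σ → ℂ),
    Fintype.card σ ≤ P.natDegree ∧ (∀ x, P.eval x = P.leadingCoeff * ∏ i, (x - r i)) ∧
    ∀ x, P.eval x ≠ 0 → P.derivative.eval x / P.eval x = ∑ i, 1 / (x - r i) := by
  refine ⟨P.roots, inferInstance, fun x => x.1, ?_, ?_, ?_⟩
  · rw [Multiset.card_coe]; exact P.card_roots'
  · intro x
    rw [(IsAlgClosed.splits P).eval_eq_prod_roots x]
    congr 1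
    rw [← Multiset.map_univ]; rfl
  · intro x hx
    rw [(IsAlgClosed.splits P).eval_derivative_div_eval_of_ne_zero hx]
    rw [← Multiset.map_univ]; rfl

section T
variable {N : ℕ} [NeZero N]

/-- T1. -/
lemma trig_T1 {P : Polynomial ℂ} {m : ℕ} (hm : P.natDegree ≤ m) {q q' : ZMod N → ℝ} {d : ℝ}
    (hd : 0 ≤ d)
    (hq : ∀ j, |q j| = ‖P.eval (gr j)‖)
    (hq' : ∀ j, |q' j| ≤ d * ‖P.eval (gr j)‖ + ‖P.derivative.eval (gr j)‖) :
    𝔼 j, q' j ^ 2 / (q j ^ 2 + q' j ^ 2 / N ^ 2) ≤ (2 * d ^ 2 + m + 2 * m ^ 2 * cz) * N := by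
  have hN : (0:ℝ) < N := by exact_mod_cast Nat.pos_of_ne_zero (NeZero.ne N)
  have hN1 : (1:ℝ) ≤ N := by exact_mod_cast Nat.pos_of_ne_zero (NeZero.ne N)
  have hcz := cz_nonneg
  rw [Fintype.expect_eq_sum_div_card, ZMod.card, div_le_iff₀ hN]
  have htriv : ∀ j, q' j ^ 2 / (q j ^ 2 + q' j ^ 2 / N ^ 2) ≤ N ^ 2 := by
    intro j
    apply div_le_of_le_mul₀ (by positivity) (by positivity)
    have : (N:ℝ) ^ 2 * (q j ^ 2 + q' j ^ 2 / N ^ 2) = N ^ 2 * q j ^ 2 + q' j ^ 2 := by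
      field_simp
    rw [this]; nlinarith [sq_nonneg (N * q j)]
  by_cases hP : P = 0
  · have h0 : ∀ j, q' j = 0 := by
      intro j; have := hq' j; simpa [hP] using this
    simp [h0]; positivity
  obtain ⟨σ, _, r, hcard, hprod, hder⟩ := roots_data hP
  choose k hk using fun s : σ => exists_near (N := N) (r s)
  have hσ : (Fintype.card σ : ℝ) ≤ m := by exact_mod_cast hcard.trans hm
  have hpt : ∀ j, q' j ^ 2 / (q j ^ 2 + q' j ^ 2 / N ^ 2) ≤ 2 * d ^ 2 +
      ∑ s, ((if j = k s then (N:ℝ) ^ 2 else 0) +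
        2 * m * (if j ∈ univ.erase (k s) then 1 / ‖gr j - r s‖ ^ 2 else 0)) := by
    intro j
    by_cases hj : ∃ s, j = k s
    · obtain ⟨s, hs⟩ := hj
      refine (htriv j).trans ?_
      have h1 : (N:ℝ) ^ 2 ≤ (if j = k s then (N:ℝ) ^ 2 else 0) +
        2 * m * (if j ∈ univ.erase (k s) then 1 / ‖gr j - r s‖ ^ 2 else 0) := by
        rw [if_pos hs]; have : (0:ℝ) ≤ 2 * (m:ℝ) * (if j ∈ univ.erase (k s) then 1 / ‖gr j - r s‖ ^ 2 else 0) := by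
          split_ifs <;> positivity
        linarith
      have h2 := single_le_sum (f := fun s => (if j = k s then (N:ℝ) ^ 2 else 0) +
        2 * m * (if j ∈ univ.erase (k s) then 1 / ‖gr j - r s‖ ^ 2 else 0))
        (fun s _ => by split_ifs <;> positivity) (mem_univ s)
      nlinarith [sq_nonneg d]
    · push Not at hj
      have hne : ∀ s, gr j - r s ≠ 0 := by
        intro s h0
        have h1 := near_dist (hk s) j
        rw [h0, norm_zero] at h1
        have h2 : |((j - k s).valMinAbs : ℝ)| ≤ 0 := by
          rw [div_le_iff₀ hN] at h1; linarith
        have h3 : ((j - k s).valMinAbs : ℝ) = 0 := abs_nonpos_iff.1 h2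
        have h4 : (j - k s).valMinAbs = 0 := by exact_mod_cast h3
        rw [ZMod.valMinAbs_eq_zero, sub_eq_zero] at h4
        exact hj s h4
      have hPne : P.eval (gr j) ≠ 0 := by
        rw [hprod]
        exact mul_ne_zero (Polynomial.leadingCoeff_ne_zero.2 hP) (prod_ne_zero_iff.2 fun s _ => hne s)
      have hqp : 0 < |q j| := by rw [hq]; exact norm_pos_iff.2 hPne
      set S := ∑ s, 1 / ‖gr j - r s‖ with hS
      have hS0 : 0 ≤ S := sum_nonneg fun s _ => by positivity
      have hb : ‖P.derivative.eval (gr j)‖ ≤ S * |q j| := by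
        rw [hq, ← div_le_iff₀ (norm_pos_iff.2 hPne), ← norm_div, hder _ hPne]
        refine (norm_sum_le _ _).trans (le_of_eq ?_)
        apply sum_congr rfl; intro s _; rw [norm_div, norm_one]
      have hq'b : |q' j| ≤ (d + S) * |q j| := by
        have := hq' j; rw [← hq] at this; linarith
      have hsq : q' j ^ 2 ≤ (d + S) ^ 2 * q j ^ 2 := by
        rw [← sq_abs (q' j), ← sq_abs (q j), ← mul_pow]; gcongr
      have h1 : q' j ^ 2 / (q j ^ 2 + q' j ^ 2 / N ^ 2) ≤ (d + S) ^ 2 := by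
        apply div_le_of_le_mul₀ (by positivity) (by positivity)
        refine hsq.trans ?_
        gcongr
        have : 0 ≤ q' j ^ 2 / N ^ 2 := by positivity
        linarith
      have h2 : S ^ 2 ≤ m * ∑ s, 1 / ‖gr j - r s‖ ^ 2 := by
        refine (sq_sum_le_card_mul_sum_sq).trans ?_
        simp only [div_pow, one_pow]
        gcongr
        simpa using hσ
      have h3 : ∑ s, ((if j = k s then (N:ℝ) ^ 2 else 0) +
          2 * m * (if j ∈ univ.erase (k s) then 1 / ‖gr j - r s‖ ^ 2 else 0))
          = 2 * (m * ∑ s, 1 / ‖gr j - r s‖ ^ 2) := by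
        rw [mul_sum, mul_sum]; apply sum_congr rfl; intro s _
        rw [if_neg (hj s), if_pos (mem_erase.2 ⟨hj s, mem_univ j⟩)]; ring
      rw [h3]
      nlinarith [sq_nonneg (d - S)]
  calc ∑ j, q' j ^ 2 / (q j ^ 2 + q' j ^ 2 / N ^ 2) ≤ _ := sum_le_sum fun j _ => hpt j
    _ = 2 * d ^ 2 * N + ∑ s, ((N:ℝ) ^ 2 + 2 * (m:ℝ) * ∑ j ∈ univ.erase (k s), 1 / ‖gr j - r s‖ ^ 2) := by
      rw [sum_add_distrib, sum_comm]
      congr 1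
      · simp [ZMod.card]; ring
      · apply sum_congr rfl; intro s _
        rw [sum_add_distrib, ← mul_sum]
        congr 1
        · simp
        · rw [← sum_filter]; congr 1
          apply sum_congr _ (fun _ _ => rfl)
          ext; simp
    _ ≤ 2 * d ^ 2 * N + ∑ s : σ, ((N:ℝ) ^ 2 + 2 * (m:ℝ) * (cz * N ^ 2)) := by
      gcongr with s
      exact near_sum (hk s)
    _ = 2 * d ^ 2 * N + (Fintype.card σ:ℝ) * ((N:ℝ) ^ 2 + 2 * m * (cz * N ^ 2)) := by simp; ring
    _ ≤ 2 * d ^ 2 * N ^ 2 + m * (N ^ 2 + 2 * m * (cz * N ^ 2)) := by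
      gcongr; nlinarith
    _ = _ := by ring

/-- T2. -/
lemma trig_T2 {P : Polynomial ℂ} {m : ℕ} (hm : P.natDegree ≤ m) (hN : m < N) (j0 : ZMod N) :
    ‖P.eval (gr j0)‖ ≤ (m + 1) * 𝔼 j : ZMod N, ‖P.eval (gr j)‖ := by
  have hNp : (0:ℝ) < N := by exact_mod_cast Nat.pos_of_ne_zero (NeZero.ne N)
  have hpow : ∀ (j : ZMod N) (k : ℕ), gr j ^ k = gr ((k : ZMod N) * j) := by
    intro j k
    unfold gr
    rw [← nsmul_eq_mul, AddChar.map_nsmul_eq_pow]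
  have horth : ∀ l k : ℕ, l < N → k < N →
      ∑ j : ZMod N, gr j ^ l * gr (-((k : ZMod N) * j)) = if l = k then (N:ℂ) else 0 := by
    intro l k hl hk
    have h1 : ∀ j : ZMod N, gr j ^ l * gr (-((k : ZMod N) * j)) = gr (j * ((l : ZMod N) - (k : ZMod N))) := by
      intro j; rw [hpow, ← gr_add]; congr 1; ring
    simp_rw [h1]
    have h2 := AddChar.sum_mulShift (R := ZMod N) (R' := ℂ) ((l : ZMod N) - k)
      (ZMod.isPrimitive_stdAddChar N)
    have h3 : ((l : ZMod N) - k = 0) ↔ l = k := by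
      rw [sub_eq_zero, ZMod.natCast_eq_natCast_iff', Nat.mod_eq_of_lt hl, Nat.mod_eq_of_lt hk]
    simp only [h3, ZMod.card] at h2
    unfold gr
    rw [h2]; split_ifs <;> simp
  have hcoef : ∀ k, k < N → ‖P.coeff k‖ ≤ 𝔼 j : ZMod N, ‖P.eval (gr j)‖ := by
    intro k hk
    have h1 : ∑ j : ZMod N, P.eval (gr j) * gr (-((k : ZMod N) * j)) = N * P.coeff k := by
      simp_rw [Polynomial.eval_eq_sum_range' (lt_of_le_of_lt hm hN), sum_mul]
      rw [sum_comm]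
      have : ∀ l ∈ range N, ∑ j : ZMod N, P.coeff l * gr j ^ l * gr (-((k : ZMod N) * j))
          = if l = k then N * P.coeff k else 0 := by
        intro l hl
        simp_rw [mul_assoc]
        rw [← mul_sum, horth l k (mem_range.1 hl) hk]
        split_ifs with h
        · rw [h]; ring
        · simp
      rw [sum_congr rfl this, sum_ite_eq' (range N) k, if_pos (mem_range.2 hk)]
    rw [Fintype.expect_eq_sum_div_card, ZMod.card, le_div_iff₀ hNp]
    have h2 : ‖P.coeff k‖ * N = ‖(N:ℂ) * P.coeff k‖ := by simp [mul_comm]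
    rw [h2, ← h1]
    refine (norm_sum_le _ _).trans (le_of_eq ?_)
    apply sum_congr rfl; intro j _; rw [norm_mul, gr_norm, mul_one]
  rw [Polynomial.eval_eq_sum_range' (Nat.lt_succ_of_le hm)]
  refine (norm_sum_le _ _).trans ?_
  refine (sum_le_sum (g := fun _ => 𝔼 j : ZMod N, ‖P.eval (gr j)‖) fun k hk => ?_).trans ?_
  · rw [norm_mul, norm_pow, gr_norm, one_pow, mul_one]
    exact hcoef k (by have := mem_range.1 hk; omega)
  · simp

/-- T3. -/
lemma trig_T3 {P : Polynomial ℂ} {m : ℕ} (hm : P.natDegree ≤ m) {q : ZMod N → ℝ}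
    (hq : ∀ j, |q j| = ‖P.eval (gr j)‖) {ε l Q : ℝ} (hε : 0 < ε) (hε1 : ε ≤ 1) (hN : 1 ≤ ε * N)
    (hl : 0 < l) (hQ : 0 < Q) {w : ℂ} (hw : ‖w‖ = 1) (hQw : Q ≤ ‖P.eval w‖) :
    𝔼 j, l / (q j ^ 2 + l) ≤ l / ((ε / 3) ^ (2 * m) * Q ^ 2) + 2 * m * ε := by
  have hNp : (0:ℝ) < N := by exact_mod_cast Nat.pos_of_ne_zero (NeZero.ne N)
  have hP : P ≠ 0 := by
    rintro rfl; simp at hQw; linarith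
  obtain ⟨σ, _, r, hcard, hprod, hder⟩ := roots_data hP
  have hσ : (Fintype.card σ : ℝ) ≤ m := by exact_mod_cast hcard.trans hm
  set t := (ε / 3) ^ (2 * m) * Q ^ 2 with ht
  have htp : 0 < t := by positivity
  have hpt : ∀ j, l / (q j ^ 2 + l) ≤ l / t + ∑ s, if ‖gr j - r s‖ < ε then (1:ℝ) else 0 := by
    intro j
    by_cases hj : ∃ s, ‖gr j - r s‖ < ε
    · obtain ⟨s, hs⟩ := hj
      have h1 : l / (q j ^ 2 + l) ≤ 1 := by
        rw [div_le_one (by positivity)]; nlinarith [sq_nonneg (q j)]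
      have h2 := single_le_sum (f := fun s => if ‖gr j - r s‖ < ε then (1:ℝ) else 0)
        (fun s _ => by split_ifs <;> positivity) (mem_univ s)
      simp only [hs, if_true] at h2
      have : 0 ≤ l / t := by positivity
      linarith
    · push Not at hj
      have h0 : ∑ s, (if ‖gr j - r s‖ < ε then (1:ℝ) else 0) = 0 :=
        sum_eq_zero fun s _ => by rw [if_neg (not_lt.2 (hj s))]
      rw [h0, add_zero]
      have h1 : (ε / 3) ^ m * ‖P.eval w‖ ≤ |q j| := by
        rw [hq, hprod, hprod, norm_mul, norm_mul, norm_prod, norm_prod]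
        have h2 : (ε / 3) ^ m * ∏ s, ‖w - r s‖ ≤ ∏ s, ‖gr j - r s‖ := by
          calc (ε / 3) ^ m * ∏ s, ‖w - r s‖ ≤ (ε / 3) ^ (Fintype.card σ) * ∏ s, ‖w - r s‖ := by
                apply mul_le_mul_of_nonneg_right _ (prod_nonneg fun _ _ => norm_nonneg _)
                exact pow_le_pow_of_le_one (by positivity) (by linarith) (hcard.trans hm)
            _ = ∏ s, (ε / 3 * ‖w - r s‖) := by
                rw [prod_mul_distrib, prod_const, card_univ]
            _ ≤ _ := by
                apply prod_le_prod
                · intro s _; positivity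
                · intro s _
                  have h3 : ‖w - r s‖ ≤ 2 + ‖gr j - r s‖ := by
                    have : w - r s = (w - gr j) + (gr j - r s) := by ring
                    rw [this]
                    refine (norm_add_le _ _).trans ?_
                    have := norm_sub_le w (gr j)
                    rw [hw, gr_norm] at this; linarith
                  have h4 := hj s
                  nlinarith
        calc _ = ‖P.leadingCoeff‖ * ((ε / 3) ^ m * ∏ s, ‖w - r s‖) := by ring
          _ ≤ _ := by gcongr
      have h5 : t ≤ q j ^ 2 := by
        rw [← sq_abs, ht]
        calc (ε / 3) ^ (2 * m) * Q ^ 2 = ((ε / 3) ^ m * Q) ^ 2 := by ring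
          _ ≤ ((ε / 3) ^ m * ‖P.eval w‖) ^ 2 := by gcongr
          _ ≤ _ := by gcongr
      gcongr
      linarith
  refine (expect_le_expect fun j _ => hpt j).trans ?_
  rw [expect_add_distrib, expect_const univ_nonempty]
  gcongr
  rw [expect_sum_comm]
  have : ∀ s, 𝔼 j : ZMod N, (if ‖gr j - r s‖ < ε then (1:ℝ) else 0) ≤ 2 * ε := by
    intro s
    rw [Fintype.expect_eq_sum_div_card, ZMod.card, div_le_iff₀ hNp, sum_boole]
    exact near_card hε hN
  refine (sum_le_sum fun s _ => this s).trans ?_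
  simp only [sum_const, nsmul_eq_mul]
  rw [card_univ]
  nlinarith

end T

/-! ### trigonometric polynomial along a rotation -/

def rot {ι : Type} (a b : ι → ℝ) (w : ℂ) : ι → ℝ := fun i => a i * w.re + b i * w.im
def rotp {ι : Type} (a b : ι → ℝ) (w : ℂ) : ι → ℝ := fun i => - a i * w.im + b i * w.re

variable {ι : Type} [Fintype ι] [DecidableEq ι]

lemma sum_D (c : Finset ι → ℝ) (z y : ι → ℝ) :
    ∑ T, c T * ∑ i ∈ T, (∏ j ∈ T.erase i, z j) * y i = ∑ i, y i * ev (D i c) z := by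
  have h1 : ∀ T : Finset ι, c T * ∑ i ∈ T, (∏ j ∈ T.erase i, z j) * y i
      = ∑ i, if i ∈ T then c T * ((∏ j ∈ T.erase i, z j) * y i) else 0 := by
    intro T
    rw [mul_sum, ← sum_filter]; congr 1; ext; simp
  simp_rw [h1]
  rw [sum_comm]
  apply sum_congr rfl; intro i _
  rw [sum_split i]
  have h2 : ∑ T, (if i ∈ T then (0:ℝ) else
      if i ∈ T then c T * ((∏ j ∈ T.erase i, z j) * y i) else 0) = 0 := by
    apply sum_eq_zero; intro T _; split_ifs <;> rfl
  rw [h2, zero_add, ev, mul_sum]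
  apply sum_congr rfl; intro T _
  by_cases h : i ∈ T
  · simp [h, D]
  · simp only [h, if_false, D, mem_insert_self, if_true, erase_insert h]; ring

noncomputable def trigP (d : ℕ) (c : Finset ι → ℝ) (a b : ι → ℝ) : Polynomial ℂ :=
  ∑ T, Polynomial.C (c T : ℂ) * (Polynomial.X ^ (d - #T) *
    ∏ i ∈ T, (Polynomial.C (((a i : ℂ) - b i * Complex.I) / 2) * Polynomial.X ^ 2
      + Polynomial.C (((a i : ℂ) + b i * Complex.I) / 2)))

lemma trigP_deg {d : ℕ} {c : Finset ι → ℝ} (hc : Deg d c) (a b : ι → ℝ) :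
    (trigP d c a b).natDegree ≤ 2 * d := by
  apply Polynomial.natDegree_sum_le_of_forall_le
  intro T _
  by_cases h : d < #T
  · simp [hc T h]
  · refine (Polynomial.natDegree_C_mul_le _ _).trans ?_
    refine Polynomial.natDegree_mul_le.trans ?_
    have h1 := Polynomial.natDegree_prod_le T (fun i =>
      (Polynomial.C (((a i : ℂ) - b i * Complex.I) / 2) * Polynomial.X ^ 2
      + Polynomial.C (((a i : ℂ) + b i * Complex.I) / 2)))
    have h2 : ∑ i ∈ T, (Polynomial.C (((a i : ℂ) - b i * Complex.I) / 2) * Polynomial.X ^ 2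
      + Polynomial.C (((a i : ℂ) + b i * Complex.I) / 2)).natDegree ≤ ∑ i ∈ T, 2 := by
      apply sum_le_sum; intro i _
      compute_degree
    rw [Polynomial.natDegree_X_pow]
    simp only [sum_const, smul_eq_mul] at h2
    have := h1.trans h2
    omega

lemma trigP_eval {d : ℕ} {c : Finset ι → ℝ} (hc : Deg d c) (a b : ι → ℝ) {w : ℂ} (hw : ‖w‖ = 1) :
    (trigP d c a b).eval w = w ^ d * (ev c (rot a b w) : ℝ) := by
  have hww : w * (starRingEnd ℂ) w = 1 := by
    rw [Complex.mul_conj, Complex.normSq_eq_norm_sq, hw]; simp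
  unfold trigP ev
  rw [Polynomial.eval_finset_sum]
  push_cast
  rw [mul_sum]
  apply sum_congr rfl; intro T _
  by_cases h : d < #T
  · simp [hc T h]
  · simp only [Polynomial.eval_mul, Polynomial.eval_C, Polynomial.eval_pow, Polynomial.eval_X,
      Polynomial.eval_prod, Polynomial.eval_add]
    have h1 : ∀ i, ((a i : ℂ) - b i * Complex.I) / 2 * w ^ 2 + ((a i : ℂ) + b i * Complex.I) / 2
        = w * ((rot a b w i : ℝ) : ℂ) := by
      intro i
      have h2 : ((a i : ℂ) - b i * Complex.I) / 2 * w ^ 2 + ((a i : ℂ) + b i * Complex.I) / 2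
        = w * (((a i : ℂ) - b i * Complex.I) / 2 * w
          + ((a i : ℂ) + b i * Complex.I) / 2 * (starRingEnd ℂ) w) := by
        linear_combination (-((a i : ℂ) + b i * Complex.I) / 2) * hww
      rw [h2]; congr 1
      apply Complex.ext <;> simp [rot] <;> ring
    simp_rw [h1]
    rw [prod_mul_distrib, prod_const]
    have h3 : w ^ d = w ^ (d - #T) * w ^ #T := by rw [← pow_add]; congr 1; omega
    rw [h3]; ring

lemma trigP_norm {d : ℕ} {c : Finset ι → ℝ} (hc : Deg d c) (a b : ι → ℝ) {w : ℂ} (hw : ‖w‖ = 1) :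
    |ev c (rot a b w)| = ‖(trigP d c a b).eval w‖ := by
  rw [trigP_eval hc a b hw, norm_mul, norm_pow, hw, one_pow, one_mul, Complex.norm_real,
    Real.norm_eq_abs]

lemma trigP_deriv {d : ℕ} {c : Finset ι → ℝ} (hc : Deg d c) (a b : ι → ℝ) {w : ℂ} (hw : ‖w‖ = 1) :
    |∑ i, rotp a b w i * ev (D i c) (rot a b w)|
      ≤ d * ‖(trigP d c a b).eval w‖ + ‖(trigP d c a b).derivative.eval w‖ := by
  obtain ⟨θ, hθ⟩ : ∃ θ : ℝ, Complex.exp (θ * Complex.I) = w := by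
    refine ⟨w.arg, ?_⟩
    have := Complex.norm_mul_exp_arg_mul_I w
    rwa [hw, Complex.ofReal_one, one_mul] at this
  have hre : ∀ s : ℝ, (Complex.exp (s * Complex.I)).re = Real.cos s := fun s =>
    Complex.exp_ofReal_mul_I_re s
  have him : ∀ s : ℝ, (Complex.exp (s * Complex.I)).im = Real.sin s := fun s =>
    Complex.exp_ofReal_mul_I_im s
  set z := rot a b w
  set q' := ∑ i, rotp a b w i * ev (D i c) z
  have hz : ∀ i, HasDerivAt (fun s : ℝ => rot a b (Complex.exp (s * Complex.I)) i)
      (rotp a b w i) θ := by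
    intro i
    simp only [rot, hre, him]
    have h1 := ((Real.hasDerivAt_cos θ).const_mul (a i)).add ((Real.hasDerivAt_sin θ).const_mul (b i))
    refine HasDerivAt.congr_deriv h1 ?_
    have e1 : w.re = Real.cos θ := by rw [← hθ, hre]
    have e2 : w.im = Real.sin θ := by rw [← hθ, him]
    rw [rotp, e1, e2]; ring
  have hq : HasDerivAt (fun s : ℝ => ev c (rot a b (Complex.exp (s * Complex.I)))) q' θ := by
    unfold ev
    have h2 : HasDerivAt (fun s : ℝ => ∑ T, c T * ∏ i ∈ T, rot a b (Complex.exp (s * Complex.I)) i)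
        (∑ T, c T * ∑ i ∈ T, (∏ j ∈ T.erase i, z j) * rotp a b w i) θ := by
      apply HasDerivAt.fun_sum
      intro T _
      apply HasDerivAt.const_mul
      have h3 := HasDerivAt.fun_finsetProd (u := T) (fun i _ => hz i)
      convert h3 using 1
      apply sum_congr rfl; intro i _
      simp only [smul_eq_mul, hθ, z]
    rw [sum_D] at h2
    exact h2
  have hexp : HasDerivAt (fun s : ℝ => Complex.exp (s * Complex.I)) (w * Complex.I) θ := by
    have h1 : HasDerivAt (fun s : ℝ => (s : ℂ) * Complex.I) Complex.I θ := by
      simpa using (Complex.ofRealCLM.hasDerivAt (x := θ)).mul_const Complex.I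
    have := h1.cexp
    rwa [hθ] at this
  have hL : HasDerivAt (fun s : ℝ => (trigP d c a b).eval (Complex.exp (s * Complex.I)))
      ((trigP d c a b).derivative.eval w * (w * Complex.I)) θ := by
    have h1 := (trigP d c a b).hasDerivAt w
    rw [← hθ] at h1
    have h2 := HasDerivAt.comp (h := fun s : ℝ => Complex.exp (s * Complex.I)) θ h1 hexp
    rw [hθ] at h2
    exact h2
  have hR : HasDerivAt (fun s : ℝ => (Complex.exp (s * Complex.I)) ^ d *
      ((ev c (rot a b (Complex.exp (s * Complex.I))) : ℝ) : ℂ))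
      ((d * w ^ (d - 1) * (w * Complex.I)) * (ev c z : ℝ) + w ^ d * (q' : ℝ)) θ := by
    have h1 := (hexp.fun_pow d).mul hq.ofReal_comp
    rw [hθ] at h1
    exact h1
  have hfun : (fun s : ℝ => (trigP d c a b).eval (Complex.exp (s * Complex.I)))
      = (fun s : ℝ => (Complex.exp (s * Complex.I)) ^ d *
      ((ev c (rot a b (Complex.exp (s * Complex.I))) : ℝ) : ℂ)) := by
    ext s
    exact trigP_eval hc a b (Complex.norm_exp_ofReal_mul_I s)
  rw [hfun] at hL
  have heq := hL.unique hR
  have h5 : w ^ d * (q' : ℂ) = (trigP d c a b).derivative.eval w * (w * Complex.I)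
      - (d * w ^ (d - 1) * (w * Complex.I)) * (ev c z : ℝ) := by rw [heq]; ring
  have h6 : ‖w ^ d * (q' : ℂ)‖ = |q'| := by
    rw [norm_mul, norm_pow, hw, one_pow, one_mul, Complex.norm_real, Real.norm_eq_abs]
  rw [← h6, h5, ← trigP_norm hc a b hw, add_comm]
  refine (norm_sub_le _ _).trans (le_of_eq ?_)
  simp only [norm_mul, norm_pow, hw, Complex.norm_I, one_pow, mul_one, Complex.norm_real,
    Real.norm_eq_abs, Complex.norm_natCast, z]

end PT

end

section

open Finset
open scoped Classical BigOperators

set_option linter.all false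

namespace PT

variable {ι : Type} [Fintype ι] [DecidableEq ι]

noncomputable def sb (c : Finset ι → ℝ) (l : ℝ) : ℝ :=
  𝔼 x : ι → Bool, if ev c (ch x) ^ 2 ≤ l then (1:ℝ) else 0

lemma sb_nonneg (c : Finset ι → ℝ) (l : ℝ) : 0 ≤ sb c l :=
  expect_nonneg fun x _ => by split_ifs <;> norm_num

lemma sb_le_one (c : Finset ι → ℝ) (l : ℝ) : sb c l ≤ 1 :=
  expect_le univ_nonempty fun x _ => by split_ifs <;> norm_num

lemma sb_mono (c : Finset ι → ℝ) {l l' : ℝ} (h : l ≤ l') : sb c l ≤ sb c l' :=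
  expect_le_expect fun x _ => by
    split_ifs with h1 h2
    · exact le_rfl
    · exact absurd (h1.trans h) h2
    · exact zero_le_one
    · exact le_rfl

noncomputable def rotlaw (w : ℂ) : Bool × Bool → ℝ := fun p => chi p.1 * w.re + chi p.2 * w.im

lemma good_rotlaw {w : ℂ} (hw : ‖w‖ = 1) : Good (rotlaw w) := by
  have h : w.re ^ 2 + w.im ^ 2 = 1 := by
    have h1 := Complex.normSq_eq_norm_sq w
    rw [hw, Complex.normSq_apply] at h1; nlinarith
  have hE : ∀ F : Bool × Bool → ℝ, 𝔼 p, F p =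
      (F (true, true) + F (true, false) + F (false, true) + F (false, false)) / 4 := by
    intro F
    rw [Fintype.expect_eq_sum_div_card, Fintype.sum_prod_type]
    simp; ring
  constructor
  · rw [hE]; simp [rotlaw, chi]; ring
  · rw [hE]; simp [rotlaw, chi]; linarith
  · rw [hE]; simp [rotlaw, chi]; ring
  · rintro ⟨a, b⟩
    cases a <;> cases b <;> simp [rotlaw, chi] <;> nlinarith [sq_nonneg (w.re - w.im), sq_nonneg (w.re + w.im)]

lemma expect_pair {Ω Ω' : Type} [Fintype Ω] [Fintype Ω']
    (F : (ι → Ω) → (ι → Ω') → ℝ) :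
    𝔼 ω : ι → Ω × Ω', F (fun i => (ω i).1) (fun i => (ω i).2) = 𝔼 x, 𝔼 y, F x y := by
  have h := Fintype.expect_equiv (Equiv.arrowProdEquivProdArrow ι (fun _ => Ω) (fun _ => Ω'))
    (fun ω : ι → Ω × Ω' => F (fun i => (ω i).1) (fun i => (ω i).2)) (fun p => F p.1 p.2)
    (fun ω => rfl)
  rw [h, ← univ_product_univ, expect_product' univ univ F]

lemma pt_rotlaw (w : ℂ) (ω : ι → Bool × Bool) :
    pt (fun _ => rotlaw w) ω = rot (ch (fun i => (ω i).1)) (ch (fun i => (ω i).2)) w := rfl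

lemma ratio_one (c : Finset ι → ℝ) {l : ℝ} (hl : 0 < l) (z : ι → ℝ) :
    ratio (fun _ : Unit => c) univ l z = 1 - l / (ev c z ^ 2 + l) := by
  have : 0 < ev c z ^ 2 + l := by positivity
  simp only [ratio, univ_unique, sum_singleton]
  field_simp; ring

lemma sum_infl_sq_le {d : ℕ} {c : Finset ι → ℝ} (hc : Deg d c) {τ : ℝ}
    (hτ : ∀ i, infl i c ≤ τ) (hτ0 : 0 ≤ τ) : ∑ i, infl i c ^ 2 ≤ τ * (d * vr c) := by
  calc ∑ i, infl i c ^ 2 ≤ ∑ i, τ * infl i c := by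
        apply sum_le_sum; intro i _
        rw [sq]; exact mul_le_mul_of_nonneg_right (hτ i) (infl_nonneg i c)
    _ = τ * ∑ i, infl i c := by rw [mul_sum]
    _ ≤ _ := mul_le_mul_of_nonneg_left (sum_infl_le hc) hτ0

lemma sb_step1 {d : ℕ} {c : Finset ι → ℝ} (hc : Deg d c) (hv : vr c = 1) {τ : ℝ}
    (hτ : ∀ i, infl i c ≤ τ) (hτ0 : 0 ≤ τ) (N : ℕ) [NeZero N] {l : ℝ} (hl : 0 < l) :
    𝔼 x : ι → Bool, l / (ev c (ch x) ^ 2 + l)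
      ≤ 𝔼 x : ι → Bool, 𝔼 y : ι → Bool,
        (𝔼 j : ZMod N, l / (ev c (rot (ch x) (ch y) (gr j)) ^ 2 + l))
        + 8192 * 9 ^ d / l ^ 2 * (τ * d) := by
  have hj : ∀ j : ZMod N, 𝔼 x : ι → Bool, l / (ev c (ch x) ^ 2 + l)
      ≤ (𝔼 ω : ι → Bool × Bool, l / (ev c (pt (fun _ => rotlaw (gr j)) ω) ^ 2 + l))
        + 8192 * 9 ^ d / l ^ 2 * (τ * d) := by
    intro j
    have h1 := lind2 (ι := ι) (a := fun _ : Unit => c) good_chi (good_rotlaw (gr_norm j))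
      (fun _ => hc) univ hl
    simp only [ratio_one c hl, expect_sub_distrib] at h1
    simp only [univ_unique, sum_singleton, pt_chi] at h1
    rw [expect_const univ_nonempty, expect_const univ_nonempty] at h1
    have h2 := sum_infl_sq_le hc hτ hτ0
    rw [hv, mul_one] at h2
    have h3 := (abs_le.1 h1).1
    have h4 : 8192 * 9 ^ d / l ^ 2 * ∑ i, infl i c ^ 2 ≤ 8192 * 9 ^ d / l ^ 2 * (τ * d) := by
      gcongr
    linarith
  have h5 : 𝔼 x : ι → Bool, l / (ev c (ch x) ^ 2 + l) ≤
      𝔼 j : ZMod N, ((𝔼 ω : ι → Bool × Bool, l / (ev c (pt (fun _ => rotlaw (gr j)) ω) ^ 2 + l))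
        + 8192 * 9 ^ d / l ^ 2 * (τ * d)) := by
    rw [← expect_const (s := (univ : Finset (ZMod N))) univ_nonempty
      (𝔼 x : ι → Bool, l / (ev c (ch x) ^ 2 + l))]
    exact expect_le_expect fun j _ => hj j
  refine h5.trans (le_of_eq ?_)
  rw [expect_add_distrib, expect_const univ_nonempty, expect_comm]
  have h6 := expect_pair (fun x y : ι → Bool => 𝔼 j : ZMod N, l / (ev c (rot (ch x) (ch y) (gr j)) ^ 2 + l))
  simp only [pt_rotlaw]
  rw [h6]

lemma g_bound {d : ℕ} {c : Finset ι → ℝ} (hc : Deg d c) (hd : 1 ≤ d) {κ k i : ℕ} (hκ : 2 ≤ κ) (hik : i ≤ k)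
    [NeZero (κ ^ k)] {l : ℝ} (hl : 0 < l) (a b : ι → ℝ) {w : ℂ} (hw : ‖w‖ = 1)
    (hQ : (κ:ℝ) ^ (8 * d * i) * l ≤ ev c (rot a b w) ^ 2) :
    𝔼 j : ZMod (κ ^ k), l / (ev c (rot a b (gr j)) ^ 2 + l) ≤ (81 ^ d + 4 * d) * (1 / κ) ^ i := by
  have hκ0 : (0:ℝ) < κ := by positivity
  have hκ1 : (1:ℝ) ≤ κ := by exact_mod_cast (by omega : 1 ≤ κ)
  have hQp : 0 < |ev c (rot a b w)| := by
    rw [abs_pos]; intro h0; rw [h0] at hQ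
    have : 0 < (κ:ℝ) ^ (8 * d * i) * l := by positivity
    norm_num at hQ; linarith
  have h := trig_T3 (N := κ ^ k) (trigP_deg hc a b) (q := fun j => ev c (rot a b (gr j)))
    (fun j => trigP_norm hc a b (gr_norm j)) (ε := (1 / (κ:ℝ)) ^ i) (l := l)
    (Q := |ev c (rot a b w)|) (by positivity)
    (pow_le_one₀ (by positivity) (by rw [div_le_one hκ0]; exact hκ1))
    (by
      push_cast
      rw [one_div, inv_pow, ← div_eq_inv_mul, le_div_iff₀ (by positivity), one_mul]
      exact pow_le_pow_right₀ hκ1 hik) hl hQp hw (le_of_eq (trigP_norm hc a b hw))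
  refine h.trans ?_
  rw [sq_abs, add_mul]
  have h1 : l / (((1 / (κ:ℝ)) ^ i / 3) ^ (2 * (2 * d)) * ev c (rot a b w) ^ 2)
      ≤ l / (((1 / (κ:ℝ)) ^ i / 3) ^ (2 * (2 * d)) * ((κ:ℝ) ^ (8 * d * i) * l)) := by
    gcongr
  have h2 : l / (((1 / (κ:ℝ)) ^ i / 3) ^ (2 * (2 * d)) * ((κ:ℝ) ^ (8 * d * i) * l))
      = 81 ^ d * (1 / κ) ^ (4 * d * i) := by
    have e1 : (81:ℝ) ^ d = 3 ^ (4 * d) := by rw [pow_mul]; norm_num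
    have e2 : (κ:ℝ) ^ (8 * d * i) = κ ^ (4 * d * i) * κ ^ (4 * d * i) := by rw [← pow_add]; ring_nf
    have e3 : ((1 / (κ:ℝ)) ^ i / 3) ^ (2 * (2 * d)) = 1 / (κ ^ (4 * d * i) * 3 ^ (4 * d)) := by
      rw [div_pow, ← pow_mul, one_div, inv_pow]
      have h1 : i * (2 * (2 * d)) = 4 * d * i := by ring
      have h2 : 2 * (2 * d) = 4 * d := by ring
      rw [h1, h2]; field_simp
    rw [e1, e2, e3, one_div_pow]; field_simp
  have h3 : (1 / (κ:ℝ)) ^ (4 * d * i) ≤ (1 / κ) ^ i := by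
    apply pow_le_pow_of_le_one (by positivity) (by rw [div_le_one hκ0]; exact hκ1)
    nlinarith
  have h4 : (81:ℝ) ^ d * (1 / κ) ^ (4 * d * i) ≤ 81 ^ d * (1 / κ) ^ i := by gcongr
  push_cast
  have h5 : 2 * (2 * (d:ℝ)) * (1 / κ) ^ i = 4 * d * (1 / κ) ^ i := by ring
  linarith

/-- Paley-Zygmund -/
lemma sb_pz {d : ℕ} {c : Finset ι → ℝ} (hc : Deg d c) (hv : vr c = 1) :
    sb c (1/4) ≤ 1 - 1 / (2 * 9 ^ d) := by
  set M := nrm c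
  have hM : 1 ≤ M := by rw [← hv]; exact vr_le_nrm c
  set I : (ι → Bool) → ℝ := fun x => if ev c (ch x) ^ 2 ≤ 1/4 then 0 else 1 with hI
  have h1 : 𝔼 x, ev c (ch x) ^ 2 = M := by
    have := parseval_sq (ι := ι) (u := fun _ => chi) (fun _ => good_chi) c
    exact this
  have h2 : 𝔼 x, ev c (ch x) ^ 4 ≤ 9 ^ d * M ^ 2 := by
    have := bonami' (ι := ι) (u := fun _ => chi) (fun _ => good_chi) hc
    exact this
  have hP : sb c (1/4) = 1 - 𝔼 x, I x := by
    have : sb c (1/4) + 𝔼 x, I x = 1 := by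
      rw [sb, ← expect_add_distrib]
      have : ∀ x, (if ev c (ch x) ^ 2 ≤ 1/4 then (1:ℝ) else 0) + I x = 1 := by
        intro x; simp only [hI]; split_ifs <;> norm_num
      simp only [this]; exact expect_const univ_nonempty _
    linarith
  have h3 : M ≤ 1/4 + 𝔼 x, ev c (ch x) ^ 2 * I x := by
    rw [← h1, ← expect_const (s := (univ : Finset (ι → Bool))) univ_nonempty (1/4:ℝ),
      ← expect_add_distrib]
    apply expect_le_expect; intro x _
    simp only [hI]; split_ifs with h <;> linarith
  have h4 := expect_mul_sq_le_sq_mul_sq univ (fun x => ev c (ch x) ^ 2) I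
  have h5 : ∀ x, I x ^ 2 = I x := by intro x; simp only [hI]; split_ifs <;> norm_num
  have h6 : ∀ x : ι → Bool, (ev c (ch x) ^ 2) ^ 2 = ev c (ch x) ^ 4 := by intro x; ring
  simp only [h5, h6] at h4
  set P := 𝔼 x, I x
  have hP0 : 0 ≤ P := expect_nonneg fun x _ => by simp only [hI]; split_ifs <;> norm_num
  have h7 : (3/4 * M) ^ 2 ≤ 9 ^ d * M ^ 2 * P := by
    calc (3/4*M)^2 ≤ (𝔼 x, ev c (ch x) ^ 2 * I x) ^ 2 := by
          apply pow_le_pow_left₀ (by linarith); linarith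
      _ ≤ _ := h4
      _ ≤ _ := by gcongr
  have h8 : 9/16 ≤ 9 ^ d * P := by
    have : 0 < M ^ 2 := by positivity
    by_contra hcon
    push Not at hcon
    nlinarith
  rw [hP]
  have h9 : 1 / (2 * 9 ^ d) ≤ P := by
    rw [div_le_iff₀ (by positivity)]; linarith
  linarith

end PT

end

section

open Finset
open scoped Classical BigOperators

set_option linter.all false

namespace PT

variable {ι : Type} [Fintype ι] [DecidableEq ι]

lemma rot_one (a b : ι → ℝ) : rot a b 1 = a := by ext i; simp [rot]
lemma rot_I (a b : ι → ℝ) : rot a b Complex.I = b := by ext i; simp [rot]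

lemma sb_sq (c : Finset ι → ℝ) (s : ℝ) :
    𝔼 x : ι → Bool, 𝔼 y : ι → Bool, (if ev c (ch x) ^ 2 ≤ s ∧ ev c (ch y) ^ 2 ≤ s then (1:ℝ) else 0)
      = sb c s ^ 2 := by
  rw [sb, sq, expect_mul]
  apply expect_congr rfl; intro x _
  rw [mul_expect]
  apply expect_congr rfl; intro y _
  by_cases h : ev c (ch x) ^ 2 ≤ s <;> simp [h]

lemma g_layers {d : ℕ} {c : Finset ι → ℝ} (hc : Deg d c) (hd : 1 ≤ d) {κ : ℕ} (hκ : 2 ≤ κ) (n : ℕ)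
    [NeZero (κ ^ (n + 2))] {K A : ℝ} (hK : K = (κ:ℝ) ^ (8 * d)) (hA : A = 81 ^ d + 4 * d) (a b : ι → ℝ) :
    𝔼 j : ZMod (κ ^ (n + 2)), 1 / K ^ (n + 2) / (ev c (rot a b (gr j)) ^ 2 + 1 / K ^ (n + 2)) ≤
      (if ev c a ^ 2 ≤ 1 / K ^ n ∧ ev c b ^ 2 ≤ 1 / K ^ n then (1:ℝ) else 0)
      + ∑ j ∈ range n, A * (1 / κ) ^ (n + 1 - j) *
        (if ev c a ^ 2 ≤ 1 / K ^ j ∧ ev c b ^ 2 ≤ 1 / K ^ j then (1:ℝ) else 0)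
      + A * (1 / κ) ^ (n + 2) := by
  have hκ0 : (0:ℝ) < κ := by positivity
  have hK0 : 0 < K := by rw [hK]; positivity
  have hA0 : 0 ≤ A := by rw [hA]; positivity
  set l := 1 / K ^ (n + 2) with hl
  have hl0 : 0 < l := by positivity
  set I : ℕ → ℝ := fun j => if ev c a ^ 2 ≤ 1 / K ^ j ∧ ev c b ^ 2 ≤ 1 / K ^ j then (1:ℝ) else 0 with hI
  have hI0 : ∀ j, 0 ≤ I j := fun j => by simp only [hI]; split_ifs <;> norm_num
  have hs0 : 0 ≤ ∑ j ∈ range n, A * (1 / κ) ^ (n + 1 - j) * I j :=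
    sum_nonneg fun j _ => by have := hI0 j; positivity
  have hl1 : 0 ≤ A * (1 / (κ:ℝ)) ^ (n + 2) := by positivity
  have key : ∀ i ≤ n + 2, ∀ s : ℝ, K ^ i * l ≤ s → ¬ (ev c a ^ 2 ≤ s ∧ ev c b ^ 2 ≤ s) →
      𝔼 j : ZMod (κ ^ (n + 2)), l / (ev c (rot a b (gr j)) ^ 2 + l) ≤ A * (1 / κ) ^ i := by
    intro i hi s hs hn
    rw [hK, ← pow_mul] at hs
    rw [hA]
    by_cases h1 : ev c a ^ 2 ≤ s
    · have h2 : s < ev c b ^ 2 := by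
        by_contra h3; exact hn ⟨h1, not_lt.1 h3⟩
      refine g_bound hc hd hκ hi hl0 a b Complex.norm_I ?_
      rw [rot_I]; linarith
    · refine g_bound hc hd hκ hi hl0 a b (w := 1) norm_one ?_
      rw [rot_one]; push Not at h1; linarith
  by_cases h0 : ev c a ^ 2 ≤ 1 / K ^ 0 ∧ ev c b ^ 2 ≤ 1 / K ^ 0
  · have ind : ∀ m ≤ n, (ev c a ^ 2 ≤ 1 / K ^ m ∧ ev c b ^ 2 ≤ 1 / K ^ m) ∨
        ∃ j < m, (ev c a ^ 2 ≤ 1 / K ^ j ∧ ev c b ^ 2 ≤ 1 / K ^ j) ∧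
          ¬ (ev c a ^ 2 ≤ 1 / K ^ (j + 1) ∧ ev c b ^ 2 ≤ 1 / K ^ (j + 1)) := by
      intro m
      induction m with
      | zero => intro _; exact Or.inl h0
      | succ m ih =>
        intro hm
        rcases ih (by omega) with h | ⟨j, hj, h⟩
        · by_cases h2 : ev c a ^ 2 ≤ 1 / K ^ (m + 1) ∧ ev c b ^ 2 ≤ 1 / K ^ (m + 1)
          · exact Or.inl h2
          · exact Or.inr ⟨m, by omega, h, h2⟩
        · exact Or.inr ⟨j, by omega, h⟩
    rcases ind n le_rfl with h | ⟨j, hj, h1, h2⟩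
    · have h3 : I n = 1 := by simp only [hI, if_pos h]
      have h4 : 𝔼 j : ZMod (κ ^ (n + 2)), l / (ev c (rot a b (gr j)) ^ 2 + l) ≤ 1 := by
        apply expect_le univ_nonempty
        intro j _
        rw [div_le_one (by positivity)]
        have := sq_nonneg (ev c (rot a b (gr j)))
        linarith
      change _ ≤ I n + _ + _
      rw [h3]; linarith
    · have h3 : I j = 1 := by simp only [hI, if_pos h1]
      have h4 := key (n + 1 - j) (by omega) (1 / K ^ (j + 1)) (by
        rw [hl, mul_one_div, div_le_div_iff₀ (by positivity) (by positivity), ← pow_add, one_mul]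
        apply le_of_eq; congr 1; omega) h2
      have h5 := single_le_sum (f := fun j => A * (1 / (κ:ℝ)) ^ (n + 1 - j) * I j)
        (fun j _ => by have := hI0 j; positivity) (mem_range.2 hj)
      simp only [h3, mul_one] at h5
      have h6 := hI0 n
      change _ ≤ I n + _ + _
      refine h4.trans ?_
      linarith
  · have h4 := key (n + 2) le_rfl (1 / K ^ 0) (by
      rw [hl, pow_zero, mul_one_div, div_self (by positivity)]; norm_num) h0
    have h6 := hI0 n
    change _ ≤ I n + _ + _
    linarith

lemma sb_rec {d : ℕ} {c : Finset ι → ℝ} (hc : Deg d c) (hd : 1 ≤ d) (hv : vr c = 1) {τ : ℝ}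
    (hτ : ∀ i, infl i c ≤ τ) (hτ0 : 0 ≤ τ) {κ : ℕ} (hκ : 2 ≤ κ) (n : ℕ)
    {K A : ℝ} (hK : K = (κ:ℝ) ^ (8 * d)) (hA : A = 81 ^ d + 4 * d) :
    sb c (1 / K ^ (n + 3)) ≤ (1 + 1 / K) * (sb c (1 / K ^ n) ^ 2 +
      ∑ j ∈ range n, A * (1 / κ) ^ (n + 1 - j) * sb c (1 / K ^ j) + A * (1 / κ) ^ (n + 2)
      + 8192 * 9 ^ d * d * τ * K ^ (2 * (n + 2))) := by
  have hκ0 : (0:ℝ) < κ := by positivity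
  have hK0 : 0 < K := by rw [hK]; positivity
  have hA0 : 0 ≤ A := by rw [hA]; positivity
  haveI : NeZero (κ ^ (n + 2)) := ⟨by positivity⟩
  set l := 1 / K ^ (n + 2) with hl
  have hl0 : 0 < l := by positivity
  have h1 : sb c (1 / K ^ (n + 3)) ≤ (1 + 1 / K) * 𝔼 x : ι → Bool, l / (ev c (ch x) ^ 2 + l) := by
    rw [sb, mul_expect]
    apply expect_le_expect; intro x _
    split_ifs with h
    · have h2 : 1 / K ^ (n + 3) = l / K := by rw [hl]; field_simp; ring
      rw [h2] at h
      have h3 : l / (l / K + l) ≤ l / (ev c (ch x) ^ 2 + l) := by gcongr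
      have h4 : (1 + 1 / K) * (l / (l / K + l)) = 1 := by field_simp; ring
      have h5 : 0 < 1 + 1 / K := by positivity
      nlinarith
    · positivity
  have h2 := sb_step1 hc hv hτ hτ0 (κ ^ (n + 2)) hl0
  refine h1.trans ?_
  gcongr
  refine h2.trans ?_
  have e1 : 8192 * 9 ^ d / l ^ 2 * (τ * d) = 8192 * 9 ^ d * d * τ * K ^ (2 * (n + 2)) := by
    rw [hl, pow_mul']; field_simp
  rw [e1]
  gcongr
  calc _ ≤ 𝔼 x : ι → Bool, 𝔼 y : ι → Bool,
      ((if ev c (ch x) ^ 2 ≤ 1 / K ^ n ∧ ev c (ch y) ^ 2 ≤ 1 / K ^ n then (1:ℝ) else 0)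
      + ∑ j ∈ range n, A * (1 / (κ:ℝ)) ^ (n + 1 - j) *
        (if ev c (ch x) ^ 2 ≤ 1 / K ^ j ∧ ev c (ch y) ^ 2 ≤ 1 / K ^ j then (1:ℝ) else 0)
      + A * (1 / (κ:ℝ)) ^ (n + 2)) := by
        apply expect_le_expect; intro x _
        apply expect_le_expect; intro y _
        exact g_layers hc hd hκ n hK hA (ch x) (ch y)
    _ = sb c (1 / K ^ n) ^ 2 +
      ∑ j ∈ range n, A * (1 / (κ:ℝ)) ^ (n + 1 - j) * sb c (1 / K ^ j) ^ 2 + A * (1 / (κ:ℝ)) ^ (n + 2) := by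
        simp only [expect_add_distrib, expect_sum_comm, ← mul_expect, sb_sq]
        rw [expect_const univ_nonempty, expect_const univ_nonempty]
    _ ≤ _ := by
        gcongr with j hj
        have h0 := sb_nonneg c (1 / K ^ j)
        have h1 := sb_le_one c (1 / K ^ j)
        nlinarith

end PT

end

section

open Finset
open scoped Classical BigOperators

set_option linter.all false

namespace PT

lemma geo_conv {κ q : ℝ} (hκ : 0 < κ) (hq : 2 ≤ q * κ) (n : ℕ) :
    ∑ j ∈ range n, (1 / κ) ^ (n + 1 - j) * q ^ j ≤ 1 / κ * q ^ n := by
  have hq0 : 0 < q := by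
    by_contra h; push Not at h; nlinarith
  induction n with
  | zero => simp; positivity
  | succ n ih =>
    rw [sum_range_succ]
    have h1 : ∑ j ∈ range n, (1 / κ) ^ (n + 1 + 1 - j) * q ^ j
        = 1 / κ * ∑ j ∈ range n, (1 / κ) ^ (n + 1 - j) * q ^ j := by
      rw [mul_sum]; apply sum_congr rfl; intro j hj
      have : n + 1 + 1 - j = (n + 1 - j) + 1 := by have := mem_range.1 hj; omega
      rw [this, pow_succ]; ring
    have h2 : n + 1 + 1 - n = 2 := by omega
    rw [h1, h2]
    have h3 : 1 / κ * ∑ j ∈ range n, (1 / κ) ^ (n + 1 - j) * q ^ j ≤ 1 / κ * (1 / κ * q ^ n) := by gcongr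
    have h4 : 1 / κ * (1 / κ * q ^ n) + (1 / κ) ^ 2 * q ^ n ≤ 1 / κ * q ^ (n + 1) := by
      have h5 : 2 / κ ≤ q := by rw [div_le_iff₀ hκ]; exact hq
      calc _ = 1 / κ * q ^ n * (2 / κ) := by ring
        _ ≤ 1 / κ * q ^ n * q := by gcongr
        _ = _ := by ring
    linarith

lemma rec_solve {h : ℕ → ℝ} {c0 A κ K T : ℝ} (hc0 : 0 < c0) (hc1 : c0 ≤ 1 / 2) (hA : 0 ≤ A)
    (hκ : 16 * (A + 1) ≤ c0 * κ) (hK : κ ≤ K) (hT : 0 ≤ T) (h0 : ∀ n, 0 ≤ h n) (h1 : ∀ n, h n ≤ 1)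
    (hb : ∀ n, 1 ≤ n → h n ≤ 1 - c0)
    (hrec : ∀ n, h (n + 3) ≤ (1 + 1 / K) * (h n ^ 2 + ∑ j ∈ range n, A * (1 / κ) ^ (n + 1 - j) * h j
      + A * (1 / κ) ^ (n + 2) + T * K ^ (2 * (n + 2)))) (n : ℕ) :
    h n ≤ 2 * (1 - c0 / 6) ^ n + T * K ^ 4 * (K ^ 3) ^ n := by
  have hκ16 : 32 ≤ κ := by nlinarith
  have hK16 : 32 ≤ K := by linarith
  have hκ0 : 0 < κ := by linarith
  have hK0 : 0 < K := by linarith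
  set ρ := 1 - c0 / 6 with hρ
  have hρ0 : 11 / 12 ≤ ρ := by linarith
  have hρ1 : ρ ≤ 1 := by linarith
  have hρ3 : 1 - c0 / 2 ≤ ρ ^ 3 := by
    rw [hρ]
    have : 0 ≤ c0 ^ 2 * (18 - c0) := by apply mul_nonneg (by positivity); linarith
    nlinarith
  induction n using Nat.strong_induction_on with
  | _ n ih =>
    by_cases hn : n ≤ 3
    · have h2 : ρ ^ 3 ≤ ρ ^ n := pow_le_pow_of_le_one (by linarith) hρ1 hn
      have h3 : 0 ≤ T * K ^ 4 * (K ^ 3) ^ n := by positivity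
      have := h1 n
      linarith
    · obtain ⟨m, rfl⟩ : ∃ m, n = m + 3 := ⟨n - 3, by omega⟩
      have hm : 1 ≤ m := by omega
      set X := ρ ^ m with hX
      set Y := T * K ^ 4 * (K ^ 3) ^ m with hY
      have hX0 : 0 ≤ X := by positivity
      have hY0 : 0 ≤ Y := by positivity
      have e1 : h m ^ 2 ≤ (1 - c0) * (2 * X + Y) := by
        have a1 := ih m (by omega)
        have a2 := hb m hm
        have a3 := h0 m
        calc h m ^ 2 = h m * h m := by ring
          _ ≤ (1 - c0) * h m := by gcongr
          _ ≤ _ := by apply mul_le_mul_of_nonneg_left a1; linarith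
      have e2 : ∑ j ∈ range m, A * (1 / κ) ^ (m + 1 - j) * h j ≤ A * (2 * (1 / κ * X) + 1 / κ * Y) := by
        calc _ ≤ ∑ j ∈ range m, A * (1 / κ) ^ (m + 1 - j) * (2 * ρ ^ j + T * K ^ 4 * (K ^ 3) ^ j) := by
              apply sum_le_sum; intro j hj
              have := ih j (by have := mem_range.1 hj; omega)
              gcongr
          _ = A * (2 * ∑ j ∈ range m, (1 / κ) ^ (m + 1 - j) * ρ ^ j
              + T * K ^ 4 * ∑ j ∈ range m, (1 / κ) ^ (m + 1 - j) * (K ^ 3) ^ j) := by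
              simp only [mul_sum, ← sum_add_distrib]
              apply sum_congr rfl; intro j _; ring
          _ ≤ A * (2 * (1 / κ * ρ ^ m) + T * K ^ 4 * (1 / κ * (K ^ 3) ^ m)) := by
              have g1 := geo_conv hκ0 (q := ρ) (by nlinarith) m
              have g2 := geo_conv hκ0 (q := K ^ 3) (by
                have : 1 ≤ K ^ 3 := one_le_pow₀ (by linarith)
                nlinarith) m
              gcongr
          _ = _ := by rw [hX, hY]; ring
      have e3 : A * (1 / κ) ^ (m + 2) ≤ A * (1 / κ * X) := by
        have a1 : 1 / κ ≤ ρ := by rw [div_le_iff₀ hκ0]; nlinarith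
        have a2 : (1 / κ) ^ m ≤ X := pow_le_pow_left₀ (by positivity) a1 m
        have a3 : (1 / κ) ^ (m + 2) = (1 / κ) * (1 / κ) * (1 / κ) ^ m := by ring
        have a4 : 1 / κ ≤ 1 := by linarith
        rw [a3]
        have a5 : (1 / κ) * (1 / κ) * (1 / κ) ^ m ≤ 1 / κ * 1 * X := by gcongr
        have : 1 / κ * 1 * X = 1 / κ * X := by ring
        rw [this] at a5
        exact mul_le_mul_of_nonneg_left a5 hA
      have e4 : T * K ^ (2 * (m + 2)) ≤ Y := by
        have : K ^ (2 * (m + 2)) ≤ K ^ 4 * (K ^ 3) ^ m := by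
          rw [← pow_mul, ← pow_add]
          exact pow_le_pow_right₀ (by linarith) (by omega)
        rw [hY, mul_assoc]; gcongr
      have f1 : A * (1 / κ) ≤ c0 / 16 := by
        rw [mul_one_div, div_le_iff₀ hκ0]; nlinarith
      have f2 : 1 / K ≤ c0 / 16 := by
        rw [div_le_iff₀ hK0]; nlinarith
      have f3 : A * (2 * (1 / κ * X) + 1 / κ * Y) + A * (1 / κ * X) ≤ c0 / 16 * (3 * X + Y) := by
        calc _ = A * (1 / κ) * (3 * X + Y) := by ring
          _ ≤ _ := by gcongr
      have g : h m ^ 2 + ∑ j ∈ range m, A * (1 / κ) ^ (m + 1 - j) * h j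
          + A * (1 / κ) ^ (m + 2) + T * K ^ (2 * (m + 2)) ≤ (1 - c0 + 3 * c0 / 32) * (2 * X) + 3 * Y := by
        have : 0 ≤ c0 * Y := by positivity
        nlinarith
      have gp : 0 ≤ (1 - c0 + 3 * c0 / 32) * (2 * X) + 3 * Y := by
        have : 0 ≤ (1 - c0 + 3 * c0 / 32) := by linarith
        positivity
      have k1 : (1 + c0 / 16) * (1 - c0 + 3 * c0 / 32) ≤ 1 - c0 / 2 := by nlinarith
      have k2 : (1 + c0 / 16) * (1 - c0 + 3 * c0 / 32) * (2 * X) ≤ ρ ^ 3 * (2 * X) := by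
        apply mul_le_mul_of_nonneg_right _ (by positivity); linarith
      have k3 : (1 + c0 / 16) * 3 * Y ≤ K ^ 9 * Y := by
        apply mul_le_mul_of_nonneg_right _ hY0
        have : K ≤ K ^ 9 := le_self_pow₀ (by linarith) (by norm_num)
        linarith
      calc h (m + 3) ≤ _ := hrec m
        _ ≤ (1 + c0 / 16) * ((1 - c0 + 3 * c0 / 32) * (2 * X) + 3 * Y) := by
            apply mul_le_mul (by linarith) g _ (by linarith)
            have := h0 (m + 3)
            have h5 := hrec m
            by_contra hneg
            push Not at hneg
            have : 0 < 1 + 1 / K := by positivity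
            nlinarith
        _ = (1 + c0 / 16) * (1 - c0 + 3 * c0 / 32) * (2 * X) + (1 + c0 / 16) * 3 * Y := by ring
        _ ≤ ρ ^ 3 * (2 * X) + K ^ 9 * Y := by linarith
        _ = _ := by rw [hX, hY]; ring

section
variable {ι : Type} [Fintype ι] [DecidableEq ι]

lemma ev_smul (s : ℝ) (c : Finset ι → ℝ) (z : ι → ℝ) : ev (fun T => s * c T) z = s * ev c z := by
  simp only [ev, mul_sum, mul_assoc]

lemma vr_smul (s : ℝ) (c : Finset ι → ℝ) : vr (fun T => s * c T) = s ^ 2 * vr c := by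
  simp only [vr, mul_sum]; apply sum_congr rfl; intro T _; split_ifs <;> ring

lemma infl_smul (s : ℝ) (i : ι) (c : Finset ι → ℝ) : infl i (fun T => s * c T) = s ^ 2 * infl i c := by
  simp only [infl, mul_sum]; apply sum_congr rfl; intro T _; split_ifs <;> ring

lemma Deg.smul {d : ℕ} {c : Finset ι → ℝ} (hc : Deg d c) (s : ℝ) : Deg d (fun T => s * c T) := by
  intro T hT; simp [hc T hT]

end

theorem small_ball (d : ℕ) (hd : 1 ≤ d) : ∃ m : ℕ, 1 ≤ m ∧ ∃ C : ℝ, 0 < C ∧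
    ∀ (ι : Type) [Fintype ι] [DecidableEq ι] (c : Finset ι → ℝ), Deg d c → 0 < vr c →
    ∀ τ : ℝ, 0 ≤ τ → (∀ i, infl i c ≤ τ * vr c) → ∀ N : ℕ, 1 ≤ N →
      sb c (vr c / N ^ m) ≤ C * (1 / N ^ 2 + τ * N ^ (3 * m)) := by
  set c0 : ℝ := 1 / (2 * 9 ^ d) with hc0
  have h9 : (1:ℝ) ≤ 9 ^ d := one_le_pow₀ (by norm_num)
  have hc0p : 0 < c0 := by positivity
  have hc01 : c0 ≤ 1 / 2 := by
    rw [hc0]; apply one_div_le_one_div_of_le <;> linarith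
  set A : ℝ := 81 ^ d + 4 * d with hA
  have hA0 : 0 ≤ A := by positivity
  obtain ⟨κ, hκ⟩ := exists_nat_ge (16 * (A + 1) / c0)
  rw [div_le_iff₀ hc0p, mul_comm (κ:ℝ)] at hκ
  have hκ32 : (32:ℝ) ≤ κ := by
    have : (0:ℝ) ≤ κ := by positivity
    nlinarith
  have hκ2 : 2 ≤ κ := by
    have : (2:ℝ) ≤ κ := by linarith
    exact_mod_cast this
  set K : ℝ := (κ:ℝ) ^ (8 * d) with hK
  have hKκ : (κ:ℝ) ≤ K := by
    rw [hK]; exact le_self_pow₀ (by linarith) (by omega)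
  have hK32 : 32 ≤ K := by linarith
  set ρ := 1 - c0 / 6 with hρ
  have hρ0 : 1 / 2 ≤ ρ := by linarith
  have hρ1 : ρ < 1 := by linarith
  obtain ⟨a, ha⟩ := exists_pow_lt_of_lt_one (show 0 < 1 / K by positivity) hρ1
  have ha1 : 1 ≤ a := by
    by_contra h
    have : a = 0 := by omega
    rw [this, pow_zero, lt_div_iff₀ (by positivity)] at ha; linarith
  refine ⟨2 * a, by omega, 4 + 8192 * 9 ^ d * d * K ^ 4, by positivity, ?_⟩
  intro ι _ _ c hc hvr τ hτ0 hτ N hN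
  have hN1 : (1:ℝ) ≤ N := by exact_mod_cast hN
  set c' : Finset ι → ℝ := fun T => (1 / √(vr c)) * c T with hc'
  have hs : (1 / √(vr c)) ^ 2 = 1 / vr c := by rw [div_pow, Real.sq_sqrt hvr.le, one_pow]
  have hc'd : Deg d c' := hc.smul _
  have hv' : vr c' = 1 := by rw [hc', vr_smul, hs]; field_simp
  have hi' : ∀ i, infl i c' ≤ τ := by
    intro i; rw [hc', infl_smul, hs, one_div, ← div_eq_inv_mul, div_le_iff₀ hvr]; exact hτ i
  have hsb : ∀ s, sb c (vr c * s) = sb c' s := by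
    intro s
    unfold sb
    apply expect_congr rfl; intro x _
    have : ev c (ch x) ^ 2 ≤ vr c * s ↔ ev c' (ch x) ^ 2 ≤ s := by
      rw [hc', ev_smul, mul_pow, hs, one_div, ← div_eq_inv_mul, div_le_iff₀ hvr, mul_comm s]
    simp only [this]
  obtain ⟨k, hk1, hk2⟩ := exists_nat_pow_near (x := (N:ℝ) ^ (2 * a)) (y := K)
    (one_le_pow₀ hN1) (by linarith)
  have hNp : (0:ℝ) < (N:ℝ) ^ (2 * a) := by positivity
  rw [div_eq_mul_one_div, hsb]
  have h1 : sb c' (1 / (N:ℝ) ^ (2 * a)) ≤ sb c' (1 / K ^ k) := by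
    apply sb_mono; gcongr
  refine h1.trans ?_
  have h2 := rec_solve (h := fun n => sb c' (1 / K ^ n)) hc0p hc01 hA0 hκ hKκ
    (T := 8192 * 9 ^ d * d * τ) (by positivity) (fun n => sb_nonneg _ _) (fun n => sb_le_one _ _)
    (by
      intro n hn
      refine le_trans (sb_mono c' ?_) (sb_pz hc'd hv')
      apply one_div_le_one_div_of_le (by norm_num)
      have : K ≤ K ^ n := le_self_pow₀ (by linarith) (by omega)
      linarith)
    (fun n => sb_rec hc'd hd hv' hi' hτ0 hκ2 n hK hA) k
  refine h2.trans ?_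
  have h3 : ρ ^ (k + 1) ≤ 1 / (N:ℝ) ^ 2 := by
    have h4 : (ρ ^ (k + 1)) ^ a ≤ (1 / (N:ℝ) ^ 2) ^ a := by
      calc (ρ ^ (k + 1)) ^ a = (ρ ^ a) ^ (k + 1) := by rw [← pow_mul, ← pow_mul, mul_comm]
        _ ≤ (1 / K) ^ (k + 1) := by gcongr
        _ = 1 / K ^ (k + 1) := by rw [one_div_pow]
        _ ≤ 1 / (N:ℝ) ^ (2 * a) := by gcongr
        _ = _ := by rw [one_div_pow, pow_mul]
    exact (pow_le_pow_iff_left₀ (by positivity) (by positivity) (by omega)).1 h4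
  have h5 : 2 * ρ ^ k ≤ 4 * (1 / (N:ℝ) ^ 2) := by
    have : ρ ^ (k + 1) = ρ ^ k * ρ := pow_succ _ _
    have : 0 ≤ ρ ^ k := by positivity
    nlinarith
  have h6 : (K ^ 3) ^ k ≤ (N:ℝ) ^ (3 * (2 * a)) := by
    calc (K ^ 3) ^ k = (K ^ k) ^ 3 := pow_right_comm _ _ _
      _ ≤ ((N:ℝ) ^ (2 * a)) ^ 3 := by gcongr
      _ = _ := by rw [← pow_mul]; ring_nf
  have h7 : 8192 * 9 ^ d * d * τ * K ^ 4 * (K ^ 3) ^ k ≤ 8192 * 9 ^ d * d * τ * K ^ 4 * (N:ℝ) ^ (3 * (2 * a)) := by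
    gcongr
  have h8 : 0 ≤ 8192 * 9 ^ d * d * K ^ 4 * (1 / (N:ℝ) ^ 2) := by positivity
  have h9 : 0 ≤ 4 * (τ * (N:ℝ) ^ (3 * (2 * a))) := by positivity
  nlinarith

end PT

end

section

open Finset
open scoped Classical BigOperators

set_option linter.all false

namespace PT

variable {ι : Type} [Fintype ι] [DecidableEq ι]

/-! ### the circle law -/
section circ
variable {N : ℕ} [NeZero N]

lemma gr_pow (j : ZMod N) (k : ℕ) : gr j ^ k = gr ((k : ZMod N) * j) := by
  unfold gr
  rw [← nsmul_eq_mul, AddChar.map_nsmul_eq_pow]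

lemma gr_pow_expect {l : ℕ} (h1 : 1 ≤ l) (h2 : l < N) : ∑ j : ZMod N, gr j ^ l = 0 := by
  have h3 := AddChar.sum_mulShift (R := ZMod N) (R' := ℂ) (l : ZMod N)
      (ZMod.isPrimitive_stdAddChar N)
  have h4 : (l : ZMod N) ≠ 0 := by
    intro h
    rw [ZMod.natCast_eq_zero_iff] at h
    exact absurd (Nat.le_of_dvd (by omega) h) (by omega)
  simp only [h4, if_false] at h3
  simp_rw [gr_pow]
  unfold gr
  simp_rw [mul_comm (l : ZMod N)]
  exact_mod_cast h3

lemma gr_sq_add (j : ZMod N) : (gr j).re ^ 2 + (gr j).im ^ 2 = 1 := by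
  have h1 := Complex.normSq_eq_norm_sq (gr j)
  rw [gr_norm, Complex.normSq_apply] at h1; nlinarith

noncomputable def uc (k : ZMod N) : ℝ := √2 * (gr k).re
noncomputable def vc (k : ZMod N) : ℝ := -(√2 * (gr k).im)

lemma gr_re_sum {l : ℕ} (h1 : 1 ≤ l) (h2 : l < N) : ∑ j : ZMod N, (gr j ^ l).re = 0 := by
  rw [← Complex.re_sum, gr_pow_expect h1 h2, Complex.zero_re]

lemma good_uc (hN : 4 ≤ N) : Good (uc (N := N)) := by
  have s2 : √2 ^ 2 = (2:ℝ) := Real.sq_sqrt (by norm_num)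
  have e1 : ∑ j : ZMod N, (gr j).re = 0 := by
    have := gr_re_sum (N := N) (l := 1) le_rfl (by omega); simpa using this
  have e2 : ∑ j : ZMod N, (2 * (gr j).re ^ 2 - 1) = 0 := by
    rw [← gr_re_sum (N := N) (l := 2) (by omega) (by omega)]
    apply sum_congr rfl; intro j _
    rw [sq (gr j), Complex.mul_re]; have := gr_sq_add j; nlinarith
  have e3 : ∑ j : ZMod N, (4 * (gr j).re ^ 3 - 3 * (gr j).re) = 0 := by
    rw [← gr_re_sum (N := N) (l := 3) (by omega) (by omega)]
    apply sum_congr rfl; intro j _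
    rw [pow_succ (gr j), sq (gr j), Complex.mul_re, Complex.mul_re, Complex.mul_im]
    have := gr_sq_add j
    have h5 : (gr j).im * (gr j).im = 1 - (gr j).re ^ 2 := by linarith
    linear_combination (3 * (gr j).re) * this
  have hc : (Fintype.card (ZMod N) : ℝ) ≠ 0 := by
    rw [ZMod.card]; exact_mod_cast NeZero.ne N
  constructor
  · rw [Fintype.expect_eq_sum_div_card]
    simp only [uc]; rw [← mul_sum, e1]; simp
  · rw [Fintype.expect_eq_sum_div_card]
    rw [sum_sub_distrib] at e2
    simp only [uc, mul_pow, s2]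
    rw [div_eq_one_iff_eq hc]
    simp at e2 ⊢
    linarith
  · rw [Fintype.expect_eq_sum_div_card]
    rw [sum_sub_distrib, ← mul_sum, ← mul_sum, e1] at e3
    simp only [uc, mul_pow]
    rw [← mul_sum]
    have : ∑ j : ZMod N, (gr j).re ^ 3 = 0 := by linarith
    rw [this]; simp
  · intro k
    rw [uc, mul_pow, s2]
    have := gr_sq_add k; nlinarith [sq_nonneg (gr k).im]

lemma vc_sq (hN : 4 ≤ N) : 𝔼 k : ZMod N, vc k ^ 2 = 1 := by
  have h := (good_uc hN).m2
  have h2 : ∀ k : ZMod N, vc k ^ 2 = 2 - uc k ^ 2 := by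
    intro k
    have s2 : √2 ^ 2 = (2:ℝ) := Real.sq_sqrt (by norm_num)
    rw [vc, uc, neg_sq, mul_pow, mul_pow, s2]
    have := gr_sq_add k; linarith
  simp only [h2, expect_sub_distrib, h]
  rw [expect_const univ_nonempty]; norm_num

lemma vc_le (k : ZMod N) : vc k ^ 2 ≤ 2 := by
  have s2 : √2 ^ 2 = (2:ℝ) := Real.sq_sqrt (by norm_num)
  rw [vc, neg_sq, mul_pow, s2]
  have := gr_sq_add k; nlinarith [sq_nonneg (gr k).re]

end circ

/-! ### linear forms in signs -/

noncomputable def lcf (t : ι → ℝ) : Finset ι → ℝ := fun T => ∑ i, if T = {i} then t i else 0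

lemma ev_lcf (t z : ι → ℝ) : ev (lcf t) z = ∑ i, z i * t i := by
  simp only [ev, lcf, sum_mul]
  rw [sum_comm]
  apply sum_congr rfl; intro i _
  rw [sum_eq_single {i}]
  · simp [mul_comm]
  · intro T _ hT; simp [hT]
  · simp

lemma deg_lcf (t : ι → ℝ) : Deg 1 (lcf t) := by
  intro T hT
  apply sum_eq_zero; intro i _
  rw [if_neg]; rintro rfl; simp at hT

lemma nrm_lcf (t : ι → ℝ) : nrm (lcf t) = ∑ i, t i ^ 2 := by
  have h : ∀ T : Finset ι, lcf t T ^ 2 = ∑ i, if T = {i} then t i ^ 2 else 0 := by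
    intro T
    by_cases hT : ∃ i, T = {i}
    · obtain ⟨i, rfl⟩ := hT
      have h1 : ∀ (f : ι → ℝ), ∑ j, (if ({i} : Finset ι) = {j} then f j else 0) = f i := by
        intro f
        simp only [singleton_inj]
        simp
      rw [lcf, h1, h1 (fun j => t j ^ 2)]
    · push Not at hT
      rw [lcf]; simp [hT]
  simp only [nrm, h]
  rw [sum_comm]
  simp

lemma sign_sq (t : ι → ℝ) : 𝔼 s : ι → Bool, (∑ i, chi (s i) * t i) ^ 2 = ∑ i, t i ^ 2 := by
  have h := parseval_sq (ι := ι) (u := fun _ => chi) (fun _ => good_chi) (lcf t)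
  simp only [ev_lcf, nrm_lcf] at h
  exact h

lemma sign_four (t : ι → ℝ) : 𝔼 s : ι → Bool, (∑ i, chi (s i) * t i) ^ 4 ≤ 9 * (∑ i, t i ^ 2) ^ 2 := by
  have h := bonami' (ι := ι) (u := fun _ => chi) (fun _ => good_chi) (deg_lcf t)
  simp only [ev_lcf, nrm_lcf, pow_one] at h
  exact h

lemma tangent {Y Dn θ : ℝ} (hY : 0 ≤ Y) (hD : 0 ≤ Dn) (h0 : Dn = 0 → Y = 0) :
    2 * θ * Y - θ ^ 2 * (Y * Dn) ≤ Y / Dn := by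
  rcases hD.eq_or_lt with h | h
  · rw [h0 h.symm]; simp
  · rw [le_div_iff₀ h]
    have : 0 ≤ Y * (1 - θ * Dn) ^ 2 := by positivity
    nlinarith

/-- Second part of the fifth step. -/
lemma five_b (t : ι → ℝ) (p : ℝ) {b : ℝ} (hb : 0 < b) (hb1 : 1 ≤ b) :
    (∑ i, t i ^ 2) / (p ^ 2 + (∑ i, t i ^ 2) / b) ≤
      9 * 𝔼 s : ι → Bool, (∑ i, chi (s i) * t i) ^ 2 / (p ^ 2 + (∑ i, chi (s i) * t i) ^ 2 / b) := by
  set G := ∑ i, t i ^ 2 with hG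
  have hG0 : 0 ≤ G := sum_nonneg fun i _ => sq_nonneg _
  set E := 𝔼 s : ι → Bool, (∑ i, chi (s i) * t i) ^ 2 / (p ^ 2 + (∑ i, chi (s i) * t i) ^ 2 / b) with hE
  set W := p ^ 2 + G / b with hW
  have hW0 : 0 ≤ W := by positivity
  rcases hW0.eq_or_lt with h | h
  · rw [← h, div_zero]
    have : 0 ≤ E := expect_nonneg fun s _ => by positivity
    linarith
  set θ := 1 / (9 * W) with hθ
  have h1 : 𝔼 s : ι → Bool, (2 * θ * (∑ i, chi (s i) * t i) ^ 2 - θ ^ 2 *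
      ((∑ i, chi (s i) * t i) ^ 2 * (p ^ 2 + (∑ i, chi (s i) * t i) ^ 2 / b))) ≤ E := by
    apply expect_le_expect; intro s _
    apply tangent (by positivity) (by positivity)
    intro h0
    have h2 : 0 ≤ (∑ i, chi (s i) * t i) ^ 2 := sq_nonneg _
    have h3 : 0 ≤ (∑ i, chi (s i) * t i) ^ 2 / b := by positivity
    have h4 : (∑ i, chi (s i) * t i) ^ 2 / b = 0 := by nlinarith [sq_nonneg p]
    rcases div_eq_zero_iff.1 h4 with h5 | h5
    · exact h5
    · exact absurd h5 hb.ne'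
  have h2 : 𝔼 s : ι → Bool, (2 * θ * (∑ i, chi (s i) * t i) ^ 2 - θ ^ 2 *
      ((∑ i, chi (s i) * t i) ^ 2 * (p ^ 2 + (∑ i, chi (s i) * t i) ^ 2 / b)))
      = 2 * θ * G - θ ^ 2 * (p ^ 2 * G + (𝔼 s : ι → Bool, (∑ i, chi (s i) * t i) ^ 4) / b) := by
    have hS : 𝔼 s : ι → Bool, (∑ i, chi (s i) * t i) ^ 2 = G := sign_sq t
    have hS2 : 𝔼 s : ι → Bool, ((∑ i, chi (s i) * t i) ^ 2 * (p ^ 2 + (∑ i, chi (s i) * t i) ^ 2 / b))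
        = p ^ 2 * (𝔼 s : ι → Bool, (∑ i, chi (s i) * t i) ^ 2)
          + (𝔼 s : ι → Bool, (∑ i, chi (s i) * t i) ^ 4) / b := by
      rw [mul_expect, expect_div, ← expect_add_distrib]
      apply expect_congr rfl; intro s _; ring
    rw [expect_sub_distrib, ← mul_expect, ← mul_expect, hS2, hS]
  have h3 := sign_four t
  rw [← hG] at h3
  have h4 : p ^ 2 * G + (𝔼 s : ι → Bool, (∑ i, chi (s i) * t i) ^ 4) / b ≤ 9 * W * G := by
    have : (𝔼 s : ι → Bool, (∑ i, chi (s i) * t i) ^ 4) / b ≤ 9 * G ^ 2 / b := by gcongr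
    have h5 : 9 * W * G = 9 * (p ^ 2 * G) + 9 * G ^ 2 / b := by rw [hW]; ring
    have : 0 ≤ p ^ 2 * G := by positivity
    linarith
  have h5 : θ ^ 2 * (p ^ 2 * G + (𝔼 s : ι → Bool, (∑ i, chi (s i) * t i) ^ 4) / b) ≤ θ * G := by
    calc _ ≤ θ ^ 2 * (9 * W * G) := by gcongr
      _ = θ * G := by rw [hθ]; field_simp
  have h6 : G / W = 9 * (θ * G) := by rw [hθ]; field_simp
  rw [h6]; linarith

lemma concave_sum {L : Type} (A : Finset L) (x : L → ℝ) {q G b : ℝ} (hx : ∀ l ∈ A, 0 ≤ x l) (hq : 0 ≤ q)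
    (hG : ∑ l ∈ A, x l ≤ G) (hb : 0 < b) (hA : (#A : ℝ) ≤ b) :
    ∑ l ∈ A, x l / (q + x l) ≤ G / (q + G / b) := by
  have hs0 : 0 ≤ ∑ l ∈ A, x l := sum_nonneg hx
  have hG0 : 0 ≤ G := hs0.trans hG
  have hy0 : 0 ≤ G / b := by positivity
  set y := G / b with hy
  have hGy : G = b * y := by rw [hy]; field_simp
  rcases (add_nonneg hq hy0).eq_or_lt with h | h
  · have h1 : y = 0 := by linarith
    have h2 : G = 0 := by rw [hGy, h1, mul_zero]
    rw [h2] at hG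
    have h3 : ∑ l ∈ A, x l = 0 := le_antisymm hG hs0
    have h4 := (sum_eq_zero_iff_of_nonneg hx).1 h3
    rw [← h, div_zero]
    apply le_of_eq; apply sum_eq_zero; intro l hl; rw [h4 l hl]; simp
  · have h1 : ∀ l ∈ A, x l / (q + x l) ≤ (y ^ 2 + q * x l) / (q + y) ^ 2 := by
      intro l hl
      have hxl := hx l hl
      rcases (add_nonneg hq hxl).eq_or_lt with h2 | h2
      · rw [← h2, div_zero]; positivity
      · rw [div_le_div_iff₀ h2 (by positivity)]
        nlinarith [mul_nonneg hq (sq_nonneg (y - x l))]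
    calc _ ≤ ∑ l ∈ A, (y ^ 2 + q * x l) / (q + y) ^ 2 := sum_le_sum h1
      _ = (#A * y ^ 2 + q * ∑ l ∈ A, x l) / (q + y) ^ 2 := by
          rw [← sum_div, sum_add_distrib, ← mul_sum]; simp
      _ ≤ (b * y ^ 2 + q * G) / (q + y) ^ 2 := by gcongr
      _ = G / (q + y) := by rw [hGy]; field_simp; ring

end PT

end

section

open Finset
open scoped Classical BigOperators

set_option linter.all false

namespace PT

variable {ι : Type} [Fintype ι] [DecidableEq ι]

section circ2
variable {N : ℕ} [NeZero N]

/-- the point on the torus -/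
noncomputable def zc (k : ι → ZMod N) : ι → ℝ := pt (fun _ => uc) k

noncomputable def tc (c : Finset ι → ℝ) (k : ι → ZMod N) (i : ι) : ℝ := vc (k i) * ev (D i c) (zc k)

noncomputable def Xc (c : Finset ι → ℝ) (k : ι → ZMod N) (s : ι → Bool) : ℝ :=
  ∑ i, chi (s i) * tc c k i

noncomputable def Gc (c : Finset ι → ℝ) (k : ι → ZMod N) : ℝ := ∑ i, tc c k i ^ 2

lemma Gc_nonneg (c : Finset ι → ℝ) (k : ι → ZMod N) : 0 ≤ Gc c k := sum_nonneg fun i _ => sq_nonneg _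

lemma shift_expect (F : (ι → ZMod N) → ℝ) (v : ZMod N → ι → ZMod N) :
    𝔼 k, F k = 𝔼 k, 𝔼 j, F (k + v j) := by
  rw [expect_comm]
  have h : ∀ j : ZMod N, 𝔼 k, F (k + v j) = 𝔼 k, F k := by
    intro j
    exact Fintype.expect_equiv (Equiv.addRight (v j)) _ _ (fun k => rfl)
  simp only [h]
  rw [expect_const univ_nonempty]

noncomputable def sh (s : ι → Bool) (j : ZMod N) : ι → ZMod N := fun i => if s i then j else -j

lemma gr_neg (j : ZMod N) : gr (-j) = (starRingEnd ℂ) (gr j) := by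
  have h1 : gr (-j) * gr j = 1 := by rw [← gr_add, neg_add_cancel, gr_zero]
  have hww : (starRingEnd ℂ) (gr j) * gr j = 1 := by
    rw [mul_comm, Complex.mul_conj, Complex.normSq_eq_norm_sq, gr_norm]; simp
  have h0 : gr j ≠ 0 := by intro h; rw [h, mul_zero] at h1; exact zero_ne_one h1
  exact mul_right_cancel₀ h0 (h1.trans hww.symm)

lemma gr_sh (s : Bool) (j : ZMod N) : (gr (if s then j else -j)).re = (gr j).re ∧
    (gr (if s then j else -j)).im = chi s * (gr j).im := by
  cases s
  · simp [gr_neg, chi]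
  · simp [chi]

lemma zc_shift (k : ι → ZMod N) (s : ι → Bool) (j : ZMod N) :
    zc (k + sh s j) = rot (fun i => uc (k i)) (fun i => chi (s i) * vc (k i)) (gr j) := by
  funext i
  simp only [zc, pt, uc, vc, rot, sh, Pi.add_apply, gr_add, Complex.mul_re, (gr_sh (s i) j).1,
    (gr_sh (s i) j).2]
  ring

lemma chi_sq (b : Bool) : chi b ^ 2 = 1 := by cases b <;> simp [chi]

lemma vc_shift (k : ι → ZMod N) (s : ι → Bool) (j : ZMod N) (i : ι) :
    chi (s i) * vc ((k + sh s j) i)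
      = rotp (fun i => uc (k i)) (fun i => chi (s i) * vc (k i)) (gr j) i := by
  simp only [zc, pt, uc, vc, rotp, sh, Pi.add_apply, gr_add, Complex.mul_im, (gr_sh (s i) j).1,
    (gr_sh (s i) j).2]
  linear_combination (-√2 * (gr (k i)).re * (gr j).im) * chi_sq (s i)

lemma Xc_shift (c : Finset ι → ℝ) (k : ι → ZMod N) (s : ι → Bool) (j : ZMod N) :
    Xc c (k + sh s j) s = ∑ i, rotp (fun i => uc (k i)) (fun i => chi (s i) * vc (k i)) (gr j) i *
      ev (D i c) (rot (fun i => uc (k i)) (fun i => chi (s i) * vc (k i)) (gr j)) := by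
  unfold Xc tc
  apply sum_congr rfl; intro i _
  rw [← mul_assoc, vc_shift, zc_shift]

noncomputable def K1 (d : ℕ) : ℝ := 2 * (d:ℝ) ^ 2 + (2 * d : ℕ) + 2 * ((2 * d : ℕ):ℝ) ^ 2 * cz

lemma K1_nonneg (d : ℕ) : 0 ≤ K1 d := by
  have := cz_nonneg; unfold K1; positivity

def zer (c : Finset ι → ℝ) : Finset ι → ℝ := fun T => if T = ∅ then 0 else c T

lemma ev_zer (c : Finset ι → ℝ) (z : ι → ℝ) : ev (zer c) z = ev c z - c ∅ := by
  have : ∀ T : Finset ι, zer c T * ∏ i ∈ T, z i = c T * ∏ i ∈ T, z i - if T = ∅ then c ∅ else 0 := by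
    intro T
    by_cases h : T = ∅
    · simp [zer, h]
    · simp [zer, h]
  simp only [ev, this, sum_sub_distrib]
  simp

lemma nrm_zer (c : Finset ι → ℝ) : nrm (zer c) = vr c := by
  unfold nrm vr zer
  apply sum_congr rfl; intro T _; split_ifs <;> simp

lemma Deg.zer {d : ℕ} {c : Finset ι → ℝ} (h : Deg d c) : Deg d (zer c) := by
  intro T hT; simp only [PT.zer, h T hT]; simp

lemma expect_Gc (hN : 4 ≤ N) (c : Finset ι → ℝ) : 𝔼 k : ι → ZMod N, Gc c k = ∑ i, infl i c := by
  unfold Gc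
  rw [expect_sum_comm]
  apply sum_congr rfl; intro i _
  rw [fub_update i]
  have h1 : ∀ (k : ι → ZMod N) (a : ZMod N), tc c (Function.update k i a) i ^ 2
      = vc a ^ 2 * ev (D i c) (zc k) ^ 2 := by
    intro k a
    unfold tc zc
    rw [Function.update_self, pt_update, ev_D_update, mul_pow]
  simp only [h1, ← expect_mul, vc_sq hN, one_mul]
  rw [← nrm_D]
  exact parseval_sq (fun _ => good_uc hN) (D i c)

lemma expect_Xc (hN : 4 ≤ N) (c : Finset ι → ℝ) :
    𝔼 k : ι → ZMod N, 𝔼 s : ι → Bool, Xc c k s ^ 2 = ∑ i, infl i c := by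
  rw [← expect_Gc hN]
  apply expect_congr rfl; intro k _
  exact sign_sq _

lemma five_a_pt {d : ℕ} {c : Finset ι → ℝ} (hc : Deg d c) (k : ι → ZMod N) (s : ι → Bool) :
    𝔼 j : ZMod N, Xc c (k + sh s j) s ^ 2 / (ev c (zc (k + sh s j)) ^ 2
      + Xc c (k + sh s j) s ^ 2 / (N:ℝ) ^ 2) ≤ K1 d * N := by
  simp only [Xc_shift, zc_shift]
  exact trig_T1 (trigP_deg hc _ _) (Nat.cast_nonneg d) (fun j => trigP_norm hc _ _ (gr_norm j))
    (fun j => trigP_deriv hc _ _ (gr_norm j))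

lemma five_a_pt2 {d : ℕ} (hN2 : 2 * d < N) {c : Finset ι → ℝ} (hc : Deg d c) (k : ι → ZMod N) (s : ι → Bool)
    (hμ : c ∅ ≠ 0) :
    𝔼 j : ZMod N, Xc c (k + sh s j) s ^ 2 / (ev c (zc (k + sh s j)) ^ 2
      + Xc c (k + sh s j) s ^ 2 / (N:ℝ) ^ 2) ≤
      4 / (c ∅) ^ 2 * (𝔼 j : ZMod N, Xc c (k + sh s j) s ^ 2)
      + K1 d * N * (4 * (2 * d + 1) ^ 2 / (c ∅) ^ 2 * 𝔼 j : ZMod N, ev (zer c) (zc (k + sh s j)) ^ 2) := by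
  have hK := K1_nonneg d
  have hμ2 : 0 < (c ∅) ^ 2 := by positivity
  have hE1 : 0 ≤ 𝔼 j : ZMod N, Xc c (k + sh s j) s ^ 2 := expect_nonneg fun j _ => sq_nonneg _
  have hE2 : 0 ≤ 𝔼 j : ZMod N, ev (zer c) (zc (k + sh s j)) ^ 2 := expect_nonneg fun j _ => sq_nonneg _
  by_cases h : ∀ j : ZMod N, |ev (zer c) (zc (k + sh s j))| ≤ |c ∅| / 2
  · have h1 : 𝔼 j : ZMod N, Xc c (k + sh s j) s ^ 2 / (ev c (zc (k + sh s j)) ^ 2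
      + Xc c (k + sh s j) s ^ 2 / (N:ℝ) ^ 2) ≤ 4 / (c ∅) ^ 2 * (𝔼 j : ZMod N, Xc c (k + sh s j) s ^ 2) := by
      rw [mul_expect]
      apply expect_le_expect; intro j _
      have h2 := h j
      rw [ev_zer] at h2
      have h3 : |c ∅| / 2 ≤ |ev c (zc (k + sh s j))| := by
        have := abs_sub_abs_le_abs_sub (c ∅) (ev c (zc (k + sh s j)))
        rw [abs_sub_comm] at this; linarith
      have h4 : (c ∅) ^ 2 / 4 ≤ ev c (zc (k + sh s j)) ^ 2 := by
        rw [← sq_abs (c ∅), ← sq_abs (ev c _)]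
        nlinarith [abs_nonneg (c ∅)]
      calc _ ≤ Xc c (k + sh s j) s ^ 2 / ((c ∅) ^ 2 / 4) := by
            apply div_le_div_of_nonneg_left (sq_nonneg _) (by positivity)
            have : 0 ≤ Xc c (k + sh s j) s ^ 2 / (N:ℝ) ^ 2 := by positivity
            linarith
        _ = _ := by field_simp
    refine h1.trans ?_
    have : 0 ≤ K1 d * N * (4 * (2 * d + 1) ^ 2 / (c ∅) ^ 2 * 𝔼 j : ZMod N, ev (zer c) (zc (k + sh s j)) ^ 2) := by
      positivity
    linarith
  · push Not at h
    obtain ⟨j0, hj0⟩ := h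
    set a := fun i => uc (k i)
    set b := fun i => chi (s i) * vc (k i)
    have h2 := trig_T2 (trigP_deg hc.zer a b) hN2 j0
    rw [← trigP_norm hc.zer a b (gr_norm j0), ← zc_shift] at h2
    have h3 : ∀ j : ZMod N, ‖(trigP d (zer c) a b).eval (gr j)‖ = |ev (zer c) (zc (k + sh s j))| := by
      intro j; rw [← trigP_norm hc.zer a b (gr_norm j), ← zc_shift]
    simp only [h3] at h2
    set Y := 𝔼 j : ZMod N, |ev (zer c) (zc (k + sh s j))| with hY
    have hY0 : 0 ≤ Y := expect_nonneg fun j _ => abs_nonneg _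
    have h4 : Y ^ 2 ≤ 𝔼 j : ZMod N, ev (zer c) (zc (k + sh s j)) ^ 2 := by
      have := expect_mul_sq_le_sq_mul_sq univ (fun j : ZMod N => |ev (zer c) (zc (k + sh s j))|) (fun _ => 1)
      simp only [mul_one, sq_abs, one_pow] at this
      rw [expect_const univ_nonempty, mul_one] at this
      exact this
    have h5 : |c ∅| / 2 ≤ (2 * d + 1) * Y := by push_cast at h2; linarith
    have h6 : (c ∅) ^ 2 / 4 ≤ (2 * d + 1) ^ 2 * Y ^ 2 := by
      rw [← sq_abs (c ∅), ← mul_pow]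
      have := pow_le_pow_left₀ (by positivity) h5 2
      linarith
    have h7 : 1 ≤ 4 * (2 * (d:ℝ) + 1) ^ 2 / (c ∅) ^ 2 * 𝔼 j : ZMod N, ev (zer c) (zc (k + sh s j)) ^ 2 := by
      rw [div_mul_eq_mul_div, le_div_iff₀ hμ2]
      have : (2 * (d:ℝ) + 1) ^ 2 * Y ^ 2 ≤ (2 * (d:ℝ) + 1) ^ 2 * 𝔼 j : ZMod N, ev (zer c) (zc (k + sh s j)) ^ 2 := by
        gcongr
      linarith
    refine (five_a_pt hc k s).trans ?_
    have h8 : K1 d * N * 1 ≤ K1 d * N * (4 * (2 * d + 1) ^ 2 / (c ∅) ^ 2 * 𝔼 j : ZMod N, ev (zer c) (zc (k + sh s j)) ^ 2) := by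
      gcongr
    have h9 : 0 ≤ 4 / (c ∅) ^ 2 * (𝔼 j : ZMod N, Xc c (k + sh s j) s ^ 2) := by positivity
    linarith

noncomputable def K5 (d : ℕ) : ℝ := 2 * K1 d + 8 * d + 8 * K1 d * (2 * d + 1) ^ 2

lemma K5_nonneg (d : ℕ) : 0 ≤ K5 d := by
  have := K1_nonneg d; unfold K5; positivity

/-- First part of the fifth step. -/
lemma five_a {d : ℕ} (hN : 4 ≤ N) (hN2 : 2 * d < N) {c : Finset ι → ℝ} (hc : Deg d c) :
    𝔼 s : ι → Bool, 𝔼 k : ι → ZMod N, Xc c k s ^ 2 / (ev c (zc k) ^ 2 + Xc c k s ^ 2 / (N:ℝ) ^ 2)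
      ≤ K5 d * N * (vr c / nrm c) := by
  have hK := K1_nonneg d
  have hN1 : (1:ℝ) ≤ N := by exact_mod_cast (by omega : 1 ≤ N)
  have hv := vr_nonneg c
  rcases (nrm_nonneg c).eq_or_lt with h0 | h0
  · have hc0 : c = fun _ => 0 := by
      funext T
      have := (sum_eq_zero_iff_of_nonneg (fun T _ => sq_nonneg (c T))).1 h0.symm T (mem_univ _)
      exact pow_eq_zero_iff (two_ne_zero) |>.1 this
    have hX : ∀ (k : ι → ZMod N) s, Xc c k s = 0 := by
      intro k s
      rw [hc0]; simp [Xc, tc, ev, D]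
    rw [← h0]
    simp [hX]
  have hsh : ∀ s : ι → Bool, 𝔼 k : ι → ZMod N, Xc c k s ^ 2 / (ev c (zc k) ^ 2 + Xc c k s ^ 2 / (N:ℝ) ^ 2)
    = 𝔼 k : ι → ZMod N, 𝔼 j : ZMod N, Xc c (k + sh s j) s ^ 2 / (ev c (zc (k + sh s j)) ^ 2
      + Xc c (k + sh s j) s ^ 2 / (N:ℝ) ^ 2) := fun s =>
    shift_expect (fun k => Xc c k s ^ 2 / (ev c (zc k) ^ 2 + Xc c k s ^ 2 / (N:ℝ) ^ 2)) (sh s)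
  by_cases hR : nrm c ≤ 2 * vr c
  · have h1 : 𝔼 s : ι → Bool, 𝔼 k : ι → ZMod N, Xc c k s ^ 2 / (ev c (zc k) ^ 2 + Xc c k s ^ 2 / (N:ℝ) ^ 2)
        ≤ K1 d * N := by
      apply expect_le univ_nonempty; intro s _
      rw [hsh]
      apply expect_le univ_nonempty; intro k _
      exact five_a_pt hc k s
    have h2 : 1 ≤ 2 * (vr c / nrm c) := by
      rw [← mul_div_assoc, le_div_iff₀ h0]; linarith
    have h3 : K1 d * N * 1 ≤ K1 d * N * (2 * (vr c / nrm c)) := by gcongr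
    have h4 : 0 ≤ (8 * d + 8 * K1 d * (2 * d + 1) ^ 2) * N * (vr c / nrm c) := by positivity
    unfold K5
    linarith
  · push Not at hR
    have hnv := nrm_eq c
    have hμ : nrm c / 2 ≤ (c ∅) ^ 2 := by linarith
    have hμ0 : c ∅ ≠ 0 := by intro h; rw [h] at hμ; norm_num at hμ; linarith
    have hμ2 : 0 < (c ∅) ^ 2 := by positivity
    have h1 : 𝔼 s : ι → Bool, 𝔼 k : ι → ZMod N, Xc c k s ^ 2 / (ev c (zc k) ^ 2 + Xc c k s ^ 2 / (N:ℝ) ^ 2)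
        ≤ 𝔼 s : ι → Bool, (4 / (c ∅) ^ 2 * (𝔼 k : ι → ZMod N, Xc c k s ^ 2)
      + K1 d * N * (4 * (2 * d + 1) ^ 2 / (c ∅) ^ 2 * 𝔼 k : ι → ZMod N, ev (zer c) (zc k) ^ 2)) := by
      apply expect_le_expect; intro s _
      rw [hsh, shift_expect (fun k => Xc c k s ^ 2) (sh s), shift_expect (fun k => ev (zer c) (zc k) ^ 2) (sh s)]
      rw [mul_expect, mul_expect, mul_expect, ← expect_add_distrib]
      apply expect_le_expect; intro k _
      exact five_a_pt2 hN2 hc k s hμ0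
    refine h1.trans ?_
    have h2 : 𝔼 k : ι → ZMod N, ev (zer c) (zc k) ^ 2 = vr c := by
      rw [← nrm_zer]; exact parseval_sq (fun _ => good_uc hN) (zer c)
    have h3 : 𝔼 s : ι → Bool, 𝔼 k : ι → ZMod N, Xc c k s ^ 2 ≤ d * vr c := by
      rw [expect_comm, expect_Xc hN]; exact sum_infl_le hc
    rw [expect_add_distrib, ← mul_expect, h2, expect_const univ_nonempty]
    have h4 : 4 / (c ∅) ^ 2 ≤ 8 / nrm c := by
      rw [div_le_div_iff₀ hμ2 h0]; linarith
    have h5 : 4 / (c ∅) ^ 2 * 𝔼 s : ι → Bool, 𝔼 k : ι → ZMod N, Xc c k s ^ 2 ≤ 8 / nrm c * (d * vr c) := by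
      apply mul_le_mul h4 h3 _ (by positivity)
      exact expect_nonneg fun s _ => expect_nonneg fun k _ => sq_nonneg _
    have h6 : 4 * (2 * (d:ℝ) + 1) ^ 2 / (c ∅) ^ 2 * vr c ≤ (2 * d + 1) ^ 2 * (8 / nrm c) * vr c := by
      rw [mul_comm 4, mul_div_assoc]; gcongr
    have h7 : K1 d * N * (4 * (2 * (d:ℝ) + 1) ^ 2 / (c ∅) ^ 2 * vr c) ≤
        K1 d * N * ((2 * d + 1) ^ 2 * (8 / nrm c) * vr c) := by gcongr
    have h8 : 8 / nrm c * (d * vr c) ≤ 8 * d * N * (vr c / nrm c) := by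
      calc 8 / nrm c * (d * vr c) = 8 * d * 1 * (vr c / nrm c) := by ring
        _ ≤ _ := by gcongr
    have h9 : 0 ≤ 2 * K1 d * N * (vr c / nrm c) := by positivity
    have h10 : K1 d * N * ((2 * d + 1) ^ 2 * (8 / nrm c) * vr c) = 8 * K1 d * (2 * d + 1) ^ 2 * N * (vr c / nrm c) := by
      ring
    unfold K5
    linarith

end circ2
end PT

end

section

open Finset
open scoped Classical BigOperators

set_option linter.all false

namespace PT

variable {ι : Type} [Fintype ι] [DecidableEq ι]

section circ3
variable {N : ℕ} [NeZero N]

noncomputable def Kc (d : ℕ) : ℝ := 4 * 9 ^ d * (d + 1)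

lemma expect_Gc_sq (hN : 4 ≤ N) {d : ℕ} {c : Finset ι → ℝ} (hc : Deg d c) :
    𝔼 k : ι → ZMod N, Gc c k ^ 2 ≤ 4 * 9 ^ d * (∑ i, infl i c) ^ 2 := by
  have h := mom4 (ι := ι) (σ := ι) (u := fun _ => uc (N := N)) (fun _ => good_uc hN) (a := fun i => D i c)
    (fun i => hc.D' i)
  simp only [nrm_D] at h
  calc 𝔼 k : ι → ZMod N, Gc c k ^ 2
      ≤ 𝔼 k : ι → ZMod N, 4 * (∑ i, ev (D i c) (pt (fun _ => uc) k) ^ 2) ^ 2 := by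
        apply expect_le_expect; intro k _
        have : Gc c k ≤ 2 * ∑ i, ev (D i c) (pt (fun _ => uc) k) ^ 2 := by
          unfold Gc tc
          rw [mul_sum]
          apply sum_le_sum; intro i _
          rw [mul_pow]
          exact mul_le_mul_of_nonneg_right (vc_le _) (sq_nonneg _)
        have h2 := pow_le_pow_left₀ (Gc_nonneg c k) this 2
        linarith
    _ = 4 * 𝔼 k : ι → ZMod N, (∑ i, ev (D i c) (pt (fun _ => uc) k) ^ 2) ^ 2 := by rw [mul_expect]
    _ ≤ _ := by linarith

lemma five_c (hN : 4 ≤ N) {d : ℕ} {c : Finset ι → ℝ} (hc : Deg d c) :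
    vr c / nrm c ≤ Kc d * 𝔼 k : ι → ZMod N, Gc c k / (ev c (zc k) ^ 2 + Gc c k) := by
  have hE0 : 0 ≤ 𝔼 k : ι → ZMod N, Gc c k / (ev c (zc k) ^ 2 + Gc c k) :=
    expect_nonneg fun k _ => div_nonneg (Gc_nonneg c k) (add_nonneg (sq_nonneg _) (Gc_nonneg c k))
  have hKc : 0 < Kc d := by unfold Kc; positivity
  rcases (vr_nonneg c).eq_or_lt with hv | hv
  · rw [← hv, zero_div]; positivity
  have hM : 0 < nrm c := hv.trans_le (vr_le_nrm c)
  set M := nrm c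
  have hIV := vr_le_sum_infl c
  have hId := sum_infl_le hc
  have hG2 := expect_Gc_sq (N := N) hN hc
  have hG1 := expect_Gc (N := N) hN c
  set I := ∑ i, infl i c
  have hI : 0 < I := hv.trans_le hIV
  have hIM : I ≤ d * M := hId.trans (by have := vr_le_nrm c; gcongr)
  have hp4 : 𝔼 k : ι → ZMod N, ev c (zc k) ^ 4 ≤ 9 ^ d * M ^ 2 :=
    bonami' (fun _ => good_uc hN) hc
  set θ := 1 / (Kc d * M) with hθ
  have h1 : 𝔼 k : ι → ZMod N, (2 * θ * Gc c k - θ ^ 2 *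
      ((M / I / 2 + 1) * Gc c k ^ 2 + (I / M / 2) * ev c (zc k) ^ 4)) ≤
      𝔼 k : ι → ZMod N, Gc c k / (ev c (zc k) ^ 2 + Gc c k) := by
    apply expect_le_expect; intro k _
    have hg := Gc_nonneg c k
    set p := ev c (zc k)
    refine le_trans ?_ (tangent (θ := θ) hg (add_nonneg (sq_nonneg p) hg) ?_)
    · have h2 : Gc c k * p ^ 2 ≤ M / I / 2 * Gc c k ^ 2 + I / M / 2 * p ^ 4 := by
        have h3 : M / I / 2 * Gc c k ^ 2 + I / M / 2 * p ^ 4 - Gc c k * p ^ 2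
          = M / I / 2 * (Gc c k - I / M * p ^ 2) ^ 2 := by field_simp; ring
        have h4 : 0 ≤ M / I / 2 * (Gc c k - I / M * p ^ 2) ^ 2 := by positivity
        linarith
      have h5 : Gc c k * (p ^ 2 + Gc c k) ≤ (M / I / 2 + 1) * Gc c k ^ 2 + (I / M / 2) * p ^ 4 := by
        linarith
      have h6 := mul_le_mul_of_nonneg_left h5 (sq_nonneg θ)
      linarith
    · intro h; nlinarith [sq_nonneg p]
  rw [expect_sub_distrib, ← mul_expect, ← mul_expect, expect_add_distrib, ← mul_expect, ← mul_expect, hG1] at h1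
  have h2 : (M / I / 2 + 1) * (𝔼 k : ι → ZMod N, Gc c k ^ 2) + (I / M / 2) * (𝔼 k : ι → ZMod N, ev c (zc k) ^ 4)
      ≤ Kc d * M * I := by
    calc _ ≤ (M / I / 2 + 1) * (4 * 9 ^ d * I ^ 2) + (I / M / 2) * (9 ^ d * M ^ 2) := by gcongr
      _ = 9 ^ d * (5 / 2 * I * M + 4 * I * I) := by field_simp; ring
      _ ≤ 9 ^ d * (4 * I * M + 4 * I * (d * M)) := by
          have : 0 ≤ I * M := by positivity
          gcongr
          norm_num
      _ = Kc d * M * I := by unfold Kc; ring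
  have h3 := mul_le_mul_of_nonneg_left h2 (sq_nonneg θ)
  have h4 : θ ^ 2 * (Kc d * M * I) = I / (Kc d * M) := by rw [hθ]; field_simp
  have h5 : 2 * θ * I = 2 * (I / (Kc d * M)) := by rw [hθ]; ring
  have h6 : I / (Kc d * M) ≤ 𝔼 k : ι → ZMod N, Gc c k / (ev c (zc k) ^ 2 + Gc c k) := by linarith
  have h7 : Kc d * (I / (Kc d * M)) = I / M := by field_simp
  calc vr c / M ≤ I / M := by gcongr
    _ ≤ _ := by rw [← h7]; gcongr

lemma zc_piecewise (B : Finset ι) (k k' : ι → ZMod N) :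
    zc (B.piecewise k' k) = B.piecewise (zc k') (zc k) := pt_piecewise _ _ _ _

lemma ev_D_res (B : Finset ι) (x z : ι → ℝ) (c : Finset ι → ℝ) (i : ι) :
    ev (D i (res B x c)) z = if i ∈ B then ev (D i c) (B.piecewise z x) else 0 := by
  have hpw : ∀ t, B.piecewise (Function.update z i t) x =
      if i ∈ B then Function.update (B.piecewise z x) i t else B.piecewise z x := by
    intro t
    split_ifs with h
    · exact (Finset.update_piecewise_of_mem B _ _ h _).symm
    · funext j
      by_cases hj : j ∈ B
      · have : j ≠ i := by rintro rfl; exact h hj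
        simp [hj, this]
      · simp [hj]
  rw [ev_D_eq, ev_res, ev_res, hpw, hpw]
  split_ifs with h
  · rw [ev_D_eq]
  · simp

lemma Gc_res (B : Finset ι) (c : Finset ι → ℝ) (k k' : ι → ZMod N) :
    Gc (res B (zc k) c) k' = ∑ i ∈ B, tc c (B.piecewise k' k) i ^ 2 := by
  unfold Gc tc
  rw [← sum_subset (subset_univ B)]
  · apply sum_congr rfl; intro i hi
    rw [ev_D_res, if_pos hi, zc_piecewise]; simp [hi]
  · intro i _ hi
    rw [ev_D_res, if_neg hi]; simp

lemma five_blocks (hN : 4 ≤ N) {d : ℕ} (hN2 : 2 * d < N) {c : Finset ι → ℝ} (hc : Deg d c) {L : Type}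
    (A : Finset L) (Bl : L → Finset ι) (hdis : ∀ l ∈ A, ∀ l' ∈ A, l ≠ l' → Disjoint (Bl l) (Bl l'))
    (hA : #A ≤ N ^ 2) :
    ∑ l ∈ A, 𝔼 k : ι → ZMod N, vr (res (Bl l) (zc k) c) / nrm (res (Bl l) (zc k) c)
      ≤ 9 * Kc d * K5 d * N * (vr c / nrm c) := by
  have hKc : 0 < Kc d := by unfold Kc; positivity
  have hN0 : (0:ℝ) < N := by exact_mod_cast (by omega : 0 < N)
  have hN1 : (1:ℝ) ≤ N := by exact_mod_cast (by omega : 1 ≤ N)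
  have h1 : ∀ B : Finset ι, 𝔼 k : ι → ZMod N, vr (res B (zc k) c) / nrm (res B (zc k) c) ≤
      Kc d * 𝔼 k : ι → ZMod N, (∑ i ∈ B, tc c k i ^ 2) / (ev c (zc k) ^ 2 + ∑ i ∈ B, tc c k i ^ 2) := by
    intro B
    rw [fub_piecewise B (fun k : ι → ZMod N => (∑ i ∈ B, tc c k i ^ 2) / (ev c (zc k) ^ 2 + ∑ i ∈ B, tc c k i ^ 2)),
      mul_expect]
    apply expect_le_expect; intro k _
    have := five_c (N := N) hN (hc.res B (zc k))
    simp only [Gc_res, ev_res, ← zc_piecewise] at this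
    exact this
  calc _ ≤ ∑ l ∈ A, Kc d * 𝔼 k : ι → ZMod N, (∑ i ∈ Bl l, tc c k i ^ 2) / (ev c (zc k) ^ 2 + ∑ i ∈ Bl l, tc c k i ^ 2) :=
        sum_le_sum fun l _ => h1 (Bl l)
    _ = Kc d * 𝔼 k : ι → ZMod N, ∑ l ∈ A, (∑ i ∈ Bl l, tc c k i ^ 2) / (ev c (zc k) ^ 2 + ∑ i ∈ Bl l, tc c k i ^ 2) := by
        rw [← mul_sum, expect_sum_comm]
    _ ≤ Kc d * 𝔼 k : ι → ZMod N, Gc c k / (ev c (zc k) ^ 2 + Gc c k / (N:ℝ) ^ 2) := by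
        gcongr with k _
        apply concave_sum A (fun l => ∑ i ∈ Bl l, tc c k i ^ 2) (fun l _ => sum_nonneg fun i _ => sq_nonneg _)
          (sq_nonneg _) _ (by positivity) (by exact_mod_cast hA)
        rw [← sum_biUnion (fun l hl l' hl' h => hdis l hl l' hl' h)]
        exact sum_le_univ_sum_of_nonneg fun i => sq_nonneg _
    _ ≤ Kc d * 𝔼 k : ι → ZMod N, 9 * 𝔼 s : ι → Bool, Xc c k s ^ 2 / (ev c (zc k) ^ 2 + Xc c k s ^ 2 / (N:ℝ) ^ 2) := by
        gcongr with k _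
        exact five_b _ _ (by positivity) (one_le_pow₀ hN1)
    _ = 9 * Kc d * 𝔼 s : ι → Bool, 𝔼 k : ι → ZMod N, Xc c k s ^ 2 / (ev c (zc k) ^ 2 + Xc c k s ^ 2 / (N:ℝ) ^ 2) := by
        rw [← mul_expect, expect_comm]; ring
    _ ≤ 9 * Kc d * (K5 d * N * (vr c / nrm c)) := by
        gcongr; exact five_a hN hN2 hc
    _ = _ := by ring

end circ3
end PT

end

section

open Finset
open scoped Classical BigOperators

set_option linter.all false

namespace PT

variable {ι : Type} [Fintype ι] [DecidableEq ι]

lemma split_sum (B : Finset ι) (g : Finset ι → Finset ι → ℝ) :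
    ∑ S, ∑ T', (if S ⊆ B ∧ T' ∩ B = ∅ then g S T' else 0) = ∑ T, g (T ∩ B) (T \ B) := by
  rw [← Fintype.sum_prod_type' (f := fun S T' => if S ⊆ B ∧ T' ∩ B = ∅ then g S T' else 0), ← sum_filter]
  refine sum_bij' (fun p _ => p.1 ∪ p.2) (fun T _ => (T ∩ B, T \ B)) ?_ ?_ ?_ ?_ ?_
  · intro p _; exact mem_univ _
  · intro T _
    simp only [mem_filter, mem_univ, true_and]
    exact ⟨inter_subset_right, by ext; simp⟩
  · rintro ⟨S, T'⟩ h
    simp only [mem_filter, mem_univ, true_and] at h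
    obtain ⟨h1, h2⟩ := h
    have h3 : ∀ j, j ∈ T' → j ∉ B := by
      intro j hj hB
      have : j ∈ T' ∩ B := mem_inter.2 ⟨hj, hB⟩
      rw [h2] at this; simp at this
    ext j
    · simp only [mem_inter, mem_union]
      constructor
      · rintro ⟨h | h, hB⟩
        · exact h
        · exact absurd hB (h3 j h)
      · intro h; exact ⟨Or.inl h, h1 h⟩
    · simp only [mem_sdiff, mem_union]
      constructor
      · rintro ⟨h | h, hB⟩
        · exact absurd (h1 h) hB
        · exact h
      · intro h; exact ⟨Or.inr h, h3 j h⟩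
  · intro T _; ext j; simp only [mem_union, mem_inter, mem_sdiff]; tauto
  · rintro ⟨S, T'⟩ h
    simp only [mem_filter, mem_univ, true_and] at h
    obtain ⟨h1, h2⟩ := h
    have h3 : ∀ j, j ∈ T' → j ∉ B := by
      intro j hj hB
      have : j ∈ T' ∩ B := mem_inter.2 ⟨hj, hB⟩
      rw [h2] at this; simp at this
    have e1 : (S ∪ T') ∩ B = S := by
      ext j
      simp only [mem_inter, mem_union]
      constructor
      · rintro ⟨h | h, hB⟩
        · exact h
        · exact absurd hB (h3 j h)
      · intro h; exact ⟨Or.inl h, h1 h⟩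
    have e2 : (S ∪ T') \ B = T' := by
      ext j
      simp only [mem_sdiff, mem_union]
      constructor
      · rintro ⟨h | h, hB⟩
        · exact absurd (h1 h) hB
        · exact h
      · intro h; exact ⟨Or.inr h, h3 j h⟩
    simp only [e1, e2]

def aR (B : Finset ι) (c : Finset ι → ℝ) (S : Finset ι) : Finset ι → ℝ :=
  fun T' => if S ⊆ B ∧ T' ∩ B = ∅ then c (S ∪ T') else 0

lemma union_split (T B : Finset ι) : (T ∩ B) ∪ (T \ B) = T := by
  ext j; simp only [mem_union, mem_inter, mem_sdiff]; tauto

lemma ev_aR (B : Finset ι) (c : Finset ι → ℝ) (S : Finset ι) (z : ι → ℝ) :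
    ev (aR B c S) z = res B z c S := by
  have h := split_sum B (fun S' T' => if S' = S then c (S' ∪ T') * ∏ i ∈ T', z i else 0)
  simp only [union_split] at h
  unfold res
  rw [← h, sum_eq_single S]
  · unfold ev aR
    apply sum_congr rfl; intro T' _
    simp only [if_true]
    split_ifs <;> simp
  · intro S' _ hS'
    apply sum_eq_zero; intro T' _
    simp [hS']
  · simp

lemma deg_aR {d : ℕ} {c : Finset ι → ℝ} (hc : Deg d c) (B S : Finset ι) : Deg d (aR B c S) := by
  intro T hT
  unfold aR
  split_ifs
  · apply hc; exact lt_of_lt_of_le hT (card_le_card subset_union_right)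
  · rfl

lemma infl_aR (B : Finset ι) (c : Finset ι → ℝ) (i : ι) : ∑ S, infl i (aR B c S) ≤ infl i c := by
  have h := split_sum B (fun S' T' => if i ∈ T' then c (S' ∪ T') ^ 2 else 0)
  simp only [union_split] at h
  have h2 : ∑ S, infl i (aR B c S) = ∑ T, if i ∈ T \ B then c T ^ 2 else 0 := by
    rw [← h]
    apply sum_congr rfl; intro S _
    unfold infl
    apply sum_congr rfl; intro T _
    unfold aR
    split_ifs <;> simp
  rw [h2]
  unfold infl
  apply sum_le_sum; intro T _
  split_ifs with h3 h4
  · exact le_rfl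
  · exact absurd (mem_sdiff.1 h3).1 h4
  · exact sq_nonneg _
  · exact le_rfl

lemma nrm_res (B : Finset ι) (c : Finset ι → ℝ) (z : ι → ℝ) :
    nrm (res B z c) = ∑ S, ev (aR B c S) z ^ 2 := by
  unfold nrm; apply sum_congr rfl; intro S _; rw [ev_aR]

lemma vr_res (B : Finset ι) (c : Finset ι → ℝ) (z : ι → ℝ) :
    vr (res B z c) = ∑ S ∈ univ.erase ∅, ev (aR B c S) z ^ 2 := by
  have h : vr (res B z c) = ∑ S ∈ univ.erase (∅ : Finset ι), res B z c S ^ 2 := by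
    unfold vr
    rw [← add_sum_erase univ _ (mem_univ (∅ : Finset ι))]
    simp only [if_true, zero_add]
    apply sum_congr rfl; intro S hS
    rw [if_neg (mem_erase.1 hS).1]
  rw [h]
  apply sum_congr rfl; intro S _; rw [ev_aR]

lemma sum_nrm_aR (B : Finset ι) (c : Finset ι → ℝ) : ∑ S ∈ univ.erase ∅, nrm (aR B c S) ≤ vr c := by
  have h := split_sum B (fun S' T' => if S' = ∅ then 0 else c (S' ∪ T') ^ 2)
  simp only [union_split] at h
  have h2 : ∑ S ∈ univ.erase ∅, nrm (aR B c S) = ∑ T, if T ∩ B = ∅ then 0 else c T ^ 2 := by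
    rw [← h, ← add_sum_erase univ _ (mem_univ (∅ : Finset ι))]
    simp only [if_true, ite_self, sum_const_zero, zero_add]
    apply sum_congr rfl; intro S hS
    unfold nrm
    apply sum_congr rfl; intro T _
    unfold aR
    rw [if_neg (mem_erase.1 hS).1]
    split_ifs <;> simp
  rw [h2]
  unfold vr
  apply sum_le_sum; intro T _
  split_ifs with h3 h4 h4
  · exact le_rfl
  · exact sq_nonneg _
  · rw [h4] at h3; simp at h3
  · exact le_rfl

lemma expect_vr_res (B : Finset ι) (c : Finset ι → ℝ) :
    𝔼 x : ι → Bool, vr (res B (ch x) c) ≤ vr c := by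
  simp only [vr_res]
  rw [expect_sum_comm]
  refine le_trans (le_of_eq ?_) (sum_nrm_aR B c)
  apply sum_congr rfl; intro S _
  exact parseval_sq (ι := ι) (u := fun _ => chi) (fun _ => good_chi) (aR B c S)

lemma ratio_res (B : Finset ι) (c : Finset ι → ℝ) (η : ℝ) (z : ι → ℝ) :
    ratio (aR B c) (univ.erase ∅) η z = vr (res B z c) / (nrm (res B z c) + η) := by
  rw [vr_res, nrm_res]; rfl

/-- Markov for the conditional second moment -/
lemma small_w (B : Finset ι) (c : Finset ι → ℝ) {l : ℝ} (hl : 0 < l) :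
    𝔼 x : ι → Bool, (if nrm (res B (ch x) c) ≤ l then (1:ℝ) else 0) ≤ 2 * sb c (2 * l) := by
  unfold sb
  rw [fub_piecewise B (fun x : ι → Bool => if ev c (ch x) ^ 2 ≤ 2 * l then (1:ℝ) else 0), mul_expect]
  apply expect_le_expect; intro x _
  have hpw : ∀ y : ι → Bool, ev c (ch (B.piecewise y x)) = ev (res B (ch x) c) (ch y) := by
    intro y
    rw [ev_res]; congr 1; exact pt_piecewise (fun _ => chi) x y B
  simp only [hpw]
  have hE0 : 0 ≤ 𝔼 y : ι → Bool, if ev (res B (ch x) c) (ch y) ^ 2 ≤ 2 * l then (1:ℝ) else 0 :=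
    expect_nonneg fun y _ => by split_ifs <;> norm_num
  split_ifs with h
  · have h1 : 𝔼 y : ι → Bool, (1 - ev (res B (ch x) c) (ch y) ^ 2 / (2 * l)) ≤
        𝔼 y : ι → Bool, if ev (res B (ch x) c) (ch y) ^ 2 ≤ 2 * l then (1:ℝ) else 0 := by
      apply expect_le_expect; intro y _
      split_ifs with h2
      · have : 0 ≤ ev (res B (ch x) c) (ch y) ^ 2 / (2 * l) := by positivity
        linarith
      · push Not at h2
        have : 1 ≤ ev (res B (ch x) c) (ch y) ^ 2 / (2 * l) := by
          rw [le_div_iff₀ (by positivity)]; linarith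
        linarith
    have h2 : 𝔼 y : ι → Bool, ev (res B (ch x) c) (ch y) ^ 2 = nrm (res B (ch x) c) :=
      parseval_sq (ι := ι) (u := fun _ => chi) (fun _ => good_chi) _
    rw [expect_sub_distrib, ← expect_div, h2, expect_const univ_nonempty] at h1
    have h3 : nrm (res B (ch x) c) / (2 * l) ≤ 1 / 2 := by
      rw [div_le_iff₀ (by positivity)]; linarith
    linarith
  · linarith

lemma nearmean {d : ℕ} {c : Finset ι → ℝ} (hc : Deg d c) (hM : 0 < nrm c) (hV : vr c ≤ nrm c / 4)
    {l : ℝ} (hl : l ≤ nrm c / 16) : sb c l ≤ 16 * 9 ^ d * (vr c / nrm c) ^ 2 := by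
  have h4 : 𝔼 x : ι → Bool, ev (zer c) (ch x) ^ 4 ≤ 9 ^ d * nrm (zer c) ^ 2 :=
    bonami' (ι := ι) (u := fun _ => chi) (fun _ => good_chi) hc.zer
  rw [nrm_zer] at h4
  have hn := nrm_eq c
  set M := nrm c
  have h1 : sb c l ≤ 𝔼 x : ι → Bool, 16 / M ^ 2 * ev (zer c) (ch x) ^ 4 := by
    apply expect_le_expect; intro x _
    split_ifs with h
    · rw [ev_zer]
      set p := ev c (ch x)
      have h2 : M / 4 ≤ (p - c ∅) ^ 2 := by nlinarith [sq_nonneg (2 * p - c ∅)]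
      have h3 : (M / 4) ^ 2 ≤ ((p - c ∅) ^ 2) ^ 2 := pow_le_pow_left₀ (by positivity) h2 2
      rw [div_mul_eq_mul_div, le_div_iff₀ (by positivity)]
      nlinarith
    · positivity
  rw [← mul_expect] at h1
  calc sb c l ≤ 16 / M ^ 2 * (9 ^ d * vr c ^ 2) := h1.trans (by gcongr)
    _ = _ := by rw [div_pow]; ring

lemma R_le_one (c : Finset ι → ℝ) : vr c / nrm c ≤ 1 :=
  div_le_one_of_le₀ (vr_le_nrm c) (nrm_nonneg c)

lemma R_nonneg (c : Finset ι → ℝ) : 0 ≤ vr c / nrm c := div_nonneg (vr_nonneg c) (nrm_nonneg c)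

lemma block_compare {N : ℕ} [NeZero N] (hN : 4 ≤ N) {d : ℕ} {c : Finset ι → ℝ} (hc : Deg d c)
    (hM : 0 < nrm c) {lam τ : ℝ} (hl : 0 < lam) (hτ0 : 0 ≤ τ) (hτ : ∀ i, infl i c ≤ τ * vr c) (B : Finset ι) :
    𝔼 x : ι → Bool, vr (res B (ch x) c) / nrm (res B (ch x) c) ≤
      𝔼 k : ι → ZMod N, vr (res B (zc k) c) / nrm (res B (zc k) c)
      + (8192 * 9 ^ d * d * τ / lam ^ 6 + lam) * (vr c / nrm c) + 2 * sb c (2 * (lam * nrm c)) := by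
  set M := nrm c with hMd
  have hη : 0 < lam ^ 3 * M := by positivity
  have hL := lind2 (good_chi) (good_uc (N := N) hN) (a := aR B c) (fun S => deg_aR hc B S) (univ.erase ∅) hη
  simp only [ratio_res] at hL
  have h1 := (abs_le.1 hL).2
  have h2 : 𝔼 k : ι → ZMod N, vr (res B (pt (fun _ => uc) k) c) / (nrm (res B (pt (fun _ => uc) k) c) + lam ^ 3 * M)
      ≤ 𝔼 k : ι → ZMod N, vr (res B (zc k) c) / nrm (res B (zc k) c) := by
    apply expect_le_expect; intro k _
    change vr (res B (zc k) c) / (nrm (res B (zc k) c) + lam ^ 3 * M) ≤ _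
    rcases (nrm_nonneg (res B (zc k) c)).eq_or_lt with h | h
    · have : vr (res B (zc k) c) = 0 := le_antisymm (h ▸ vr_le_nrm _) (vr_nonneg _)
      rw [this]; simp
    · exact div_le_div_of_nonneg_left (vr_nonneg _) h (by linarith)
  have h3 : 𝔼 x : ι → Bool, vr (res B (ch x) c) / nrm (res B (ch x) c) ≤
      𝔼 x : ι → Bool, (vr (res B (ch x) c) / (nrm (res B (ch x) c) + lam ^ 3 * M)
        + (lam / M * vr (res B (ch x) c) + if nrm (res B (ch x) c) ≤ lam * M then (1:ℝ) else 0)) := by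
    apply expect_le_expect; intro x _
    have hv := vr_nonneg (res B (ch x) c)
    have hvw := vr_le_nrm (res B (ch x) c)
    have hR := R_le_one (res B (ch x) c)
    set v := vr (res B (ch x) c)
    set w := nrm (res B (ch x) c)
    have hw : 0 ≤ w := hv.trans hvw
    split_ifs with h
    · have : 0 ≤ v / (w + lam ^ 3 * M) + lam / M * v := by positivity
      linarith
    · push Not at h
      have hlM : 0 < lam * M := by positivity
      have hw0 : 0 < w := hlM.trans h
      have e1 : v / w - v / (w + lam ^ 3 * M) = v * (lam ^ 3 * M) / (w * (w + lam ^ 3 * M)) := by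
        field_simp; ring
      have e2 : v * (lam ^ 3 * M) / (w * (w + lam ^ 3 * M)) ≤ v * (lam ^ 3 * M) / ((lam * M) * (lam * M)) := by
        apply div_le_div_of_nonneg_left (by positivity) (by positivity)
        apply mul_le_mul h.le (by linarith) hlM.le hw
      have e3 : v * (lam ^ 3 * M) / ((lam * M) * (lam * M)) = lam / M * v := by field_simp
      linarith
  rw [expect_add_distrib, expect_add_distrib, ← mul_expect] at h3
  have h4 := small_w B c (l := lam * M) (by positivity)
  have h5 : lam / M * 𝔼 x : ι → Bool, vr (res B (ch x) c) ≤ lam / M * vr c := by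
    have := expect_vr_res B c
    gcongr
  have hV := vr_nonneg c
  have h6 : ∑ i, (∑ S, infl i (aR B c S)) ^ 2 ≤ (τ * vr c) * (d * vr c) := by
    refine le_trans ?_ (sum_infl_sq_le hc hτ (by positivity))
    apply sum_le_sum; intro i _
    exact pow_le_pow_left₀ (sum_nonneg fun S _ => infl_nonneg _ _) (infl_aR B c i) 2
  have h7 : 8192 * 9 ^ d / (lam ^ 3 * M) ^ 2 * ∑ i, (∑ S, infl i (aR B c S)) ^ 2
      ≤ 8192 * 9 ^ d * d * τ / lam ^ 6 * (vr c / M) := by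
    calc _ ≤ 8192 * 9 ^ d / (lam ^ 3 * M) ^ 2 * ((τ * vr c) * (d * vr c)) := by gcongr
      _ = 8192 * 9 ^ d * d * τ / lam ^ 6 * (vr c / M) * (vr c / M) := by field_simp
      _ ≤ 8192 * 9 ^ d * d * τ / lam ^ 6 * (vr c / M) * 1 := by
          gcongr; exact R_le_one c
      _ = _ := by ring
  have h8 : 𝔼 ω : ι → Bool, vr (res B (pt (fun _ => chi) ω) c) / (nrm (res B (pt (fun _ => chi) ω) c) + lam ^ 3 * M)
    = 𝔼 x : ι → Bool, vr (res B (ch x) c) / (nrm (res B (ch x) c) + lam ^ 3 * M) := rfl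
  rw [h8] at h1
  have h9 : lam / M * vr c = lam * (vr c / M) := by ring
  rw [h9] at h5
  linarith

theorem regular (d : ℕ) (hd : 1 ≤ d) : ∃ e : ℕ, 1 ≤ e ∧ ∃ C : ℝ, 0 < C ∧
    ∀ (ι : Type) [Fintype ι] [DecidableEq ι] (c : Finset ι → ℝ), Deg d c →
    ∀ N : ℕ, 4 ≤ N → 2 * d < N → (∀ i, infl i c ≤ 1 / (N:ℝ) ^ e * vr c) →
    ∀ (L : Type) (A : Finset L) (Bl : L → Finset ι),
      (∀ l ∈ A, ∀ l' ∈ A, l ≠ l' → Disjoint (Bl l) (Bl l')) → #A ≤ N ^ 2 →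
      ∑ l ∈ A, 𝔼 x : ι → Bool, vr (res (Bl l) (ch x) c) / nrm (res (Bl l) (ch x) c) ≤
        C * N * (vr c / nrm c) := by
  obtain ⟨m, hm, C0, hC0, hsb⟩ := small_ball d hd
  have hKc : 0 < Kc d := by unfold Kc; positivity
  have hK5 := K5_nonneg d
  refine ⟨6 * (m + 2) + 1, by omega, 9 * Kc d * K5 d + (8192 * 9 ^ d * d + 1 + 2 * (2 * C0 + 16 * 9 ^ d)), by positivity, ?_⟩
  intro ι _ _ c hc N hN hN2 hreg L A Bl hdis hA
  haveI : NeZero N := ⟨by omega⟩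
  have hN0 : (0:ℝ) < N := by exact_mod_cast (by omega : 0 < N)
  have hN1 : (1:ℝ) ≤ N := by exact_mod_cast (by omega : 1 ≤ N)
  have hN4 : (4:ℝ) ≤ N := by exact_mod_cast hN
  rcases (vr_nonneg c).eq_or_lt with hv | hv
  · have h1 : ∀ l, 𝔼 x : ι → Bool, vr (res (Bl l) (ch x) c) / nrm (res (Bl l) (ch x) c) = 0 := by
      intro l
      have h2 : 𝔼 x : ι → Bool, vr (res (Bl l) (ch x) c) = 0 :=
        le_antisymm (hv ▸ expect_vr_res (Bl l) c) (expect_nonneg fun x _ => vr_nonneg _)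
      rw [expect_eq_zero_iff_of_nonneg (fun x _ => vr_nonneg _)] at h2
      apply expect_eq_zero
      intro x hx
      rw [h2 x hx, zero_div]
    simp [h1, ← hv]
  have hM : 0 < nrm c := hv.trans_le (vr_le_nrm c)
  set τ : ℝ := 1 / (N:ℝ) ^ (6 * (m + 2) + 1) with hτ
  set lam : ℝ := 1 / (N:ℝ) ^ (m + 2) with hlam
  have hlam0 : 0 < lam := by positivity
  have hτ0 : 0 < τ := by positivity
  have hlamN : lam ≤ 1 / N := by
    rw [hlam]; apply one_div_le_one_div_of_le hN0
    calc (N:ℝ) = N ^ 1 := (pow_one _).symm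
      _ ≤ N ^ (m + 2) := pow_le_pow_right₀ hN1 (by omega)
  have hR0 := R_nonneg c
  set R := vr c / nrm c with hR
  have hsmall : sb c (2 * (lam * nrm c)) ≤ (2 * C0 + 16 * 9 ^ d) * (R / N) := by
    by_cases hRN : 1 / N ≤ R
    · have h1 : 2 * (lam * nrm c) ≤ vr c / (N:ℝ) ^ m := by
        have h2 : nrm c ≤ N * vr c := by
          rw [hR, div_le_div_iff₀ hN0 hM] at hRN; linarith
        calc 2 * (lam * nrm c) ≤ 2 * (lam * (N * vr c)) := by gcongr
          _ = 2 / N * (vr c / (N:ℝ) ^ m) := by rw [hlam, pow_add]; field_simp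
          _ ≤ 1 * (vr c / (N:ℝ) ^ m) := by
              gcongr; rw [div_le_one hN0]; linarith
          _ = _ := one_mul _
      have h2 := (sb_mono c h1).trans (hsb ι c hc hv τ hτ0.le hreg N (by omega))
      have h3 : τ * (N:ℝ) ^ (3 * m) ≤ 1 / (N:ℝ) ^ 2 := by
        rw [hτ, div_mul_eq_mul_div, one_mul, div_le_div_iff₀ (by positivity) (by positivity), one_mul, ← pow_add]
        exact pow_le_pow_right₀ hN1 (by omega)
      have h4 : 1 / (N:ℝ) ^ 2 ≤ R / N := by
        rw [sq, ← div_div]; gcongr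
      have h6 : 0 ≤ 16 * 9 ^ d * (R / N) := by positivity
      calc _ ≤ C0 * (1 / N ^ 2 + τ * N ^ (3 * m)) := h2
        _ ≤ C0 * (R / N + R / N) := by gcongr; exact h3.trans h4
        _ ≤ _ := by linarith
    · push Not at hRN
      have h1 : vr c ≤ nrm c / 4 := by
        rw [hR, div_lt_div_iff₀ hM hN0] at hRN
        nlinarith
      have hl16 : lam ≤ 1 / 32 := by
        rw [hlam]; apply one_div_le_one_div_of_le (by norm_num)
        calc (32:ℝ) ≤ 4 ^ 3 := by norm_num
          _ ≤ (N:ℝ) ^ 3 := by gcongr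
          _ ≤ N ^ (m + 2) := pow_le_pow_right₀ hN1 (by omega)
      have h2 := nearmean hc hM h1 (l := 2 * (lam * nrm c)) (by nlinarith)
      calc _ ≤ 16 * 9 ^ d * (R * R) := by rw [← sq]; exact h2
        _ ≤ 16 * 9 ^ d * (R * (1 / N)) := by gcongr
        _ ≤ _ := by
          have : 0 ≤ 2 * C0 * (R / N) := by positivity
          have e : R * (1 / N) = R / N := by ring
          rw [e]; linarith
  have hτl : 8192 * 9 ^ d * d * τ / lam ^ 6 = 8192 * 9 ^ d * d / N := by
    rw [hτ, hlam, pow_succ (N:ℝ) (6 * (m + 2)), mul_comm 6, pow_mul]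
    field_simp
  have hblock : ∀ l ∈ A, 𝔼 x : ι → Bool, vr (res (Bl l) (ch x) c) / nrm (res (Bl l) (ch x) c) ≤
      𝔼 k : ι → ZMod N, vr (res (Bl l) (zc k) c) / nrm (res (Bl l) (zc k) c)
      + (8192 * 9 ^ d * d + 1 + 2 * (2 * C0 + 16 * 9 ^ d)) * (R / N) := by
    intro l _
    have h1 := block_compare hN hc hM hlam0 hτ0.le hreg (Bl l)
    rw [hτl] at h1
    have h2 : (8192 * 9 ^ d * d / N + lam) * R ≤ (8192 * 9 ^ d * d / N + 1 / N) * R := by gcongr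
    have h3 : (8192 * 9 ^ d * d / N + 1 / N) * R = (8192 * 9 ^ d * d + 1) * (R / N) := by ring
    rw [← hR] at h1
    linarith
  have h5 := five_blocks hN hN2 hc A Bl hdis hA
  rw [← hR] at h5
  refine (sum_le_sum hblock).trans ?_
  rw [sum_add_distrib, sum_const, nsmul_eq_mul]
  have h6 : (#A : ℝ) * ((8192 * 9 ^ d * d + 1 + 2 * (2 * C0 + 16 * 9 ^ d)) * (R / N)) ≤
      (N:ℝ) ^ 2 * ((8192 * 9 ^ d * d + 1 + 2 * (2 * C0 + 16 * 9 ^ d)) * (R / N)) := by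
    have : (#A : ℝ) ≤ (N:ℝ) ^ 2 := by exact_mod_cast hA
    gcongr
  have h7 : (N:ℝ) ^ 2 * ((8192 * 9 ^ d * d + 1 + 2 * (2 * C0 + 16 * 9 ^ d)) * (R / N))
    = (8192 * 9 ^ d * d + 1 + 2 * (2 * C0 + 16 * 9 ^ d)) * N * R := by field_simp
  linarith

end PT

end

section

open Finset
open scoped Classical BigOperators

set_option linter.all false

namespace PT

variable {ι : Type} [Fintype ι] [DecidableEq ι]

def flp (i : ι) (x : ι → Bool) : ι → Bool := Function.update x i (!x i)

noncomputable def Sn (i : ι) (c : Finset ι → ℝ) : ℝ :=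
  𝔼 x : ι → Bool, if ev c (ch x) * ev c (ch (flp i x)) < 0 then (1:ℝ) else 0

noncomputable def AS (c : Finset ι → ℝ) : ℝ := ∑ i, Sn i c

lemma ch_update (x : ι → Bool) (i : ι) (b : Bool) : ch (Function.update x i b) = Function.update (ch x) i (chi b) := by
  funext j
  by_cases h : j = i
  · subst h; simp [ch]
  · simp [ch, h]

lemma ch_piecewise (B : Finset ι) (x y : ι → Bool) : ch (B.piecewise y x) = B.piecewise (ch y) (ch x) :=
  pt_piecewise (fun _ => chi) x y B

lemma Sn_nonneg (i : ι) (c : Finset ι → ℝ) : 0 ≤ Sn i c :=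
  expect_nonneg fun x _ => by split_ifs <;> norm_num

lemma Sn_le_one (i : ι) (c : Finset ι → ℝ) : Sn i c ≤ 1 :=
  expect_le univ_nonempty fun x _ => by split_ifs <;> norm_num

lemma ev_D_zero_of_supp {B : Finset ι} {c : Finset ι → ℝ} (h : Supp B c) {i : ι} (hi : i ∉ B) (z : ι → ℝ) :
    ev (D i c) z = 0 := by
  unfold ev D
  apply sum_eq_zero; intro T _
  split_ifs
  · simp
  · rw [h, zero_mul]
    intro h2; exact hi (h2 (mem_insert_self i T))

lemma Sn_eq_zero_of_D {c : Finset ι → ℝ} {i : ι} (h : ∀ z, ev (D i c) z = 0) : Sn i c = 0 := by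
  apply expect_eq_zero; intro x _
  rw [if_neg]
  rw [flp, ch_update, ev_update, h, ← Function.update_eq_self i (ch x), ev_update,
    Function.update_eq_self i (ch x), h]
  push Not
  nlinarith [sq_nonneg (ev (lo i c) (ch x))]

lemma Sn_eq_zero {B : Finset ι} {c : Finset ι → ℝ} (h : Supp B c) {i : ι} (hi : i ∉ B) : Sn i c = 0 :=
  Sn_eq_zero_of_D fun z => ev_D_zero_of_supp h hi z

lemma AS_eq {B : Finset ι} {c : Finset ι → ℝ} (h : Supp B c) : AS c = ∑ i ∈ B, Sn i c := by
  unfold AS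
  rw [← sum_subset (subset_univ B)]
  intro i _ hi; exact Sn_eq_zero h hi

lemma AS_block (B : Finset ι) (c : Finset ι → ℝ) :
    ∑ i ∈ B, Sn i c = 𝔼 x : ι → Bool, AS (res B (ch x) c) := by
  have h1 : ∀ x : ι → Bool, AS (res B (ch x) c) = ∑ i ∈ B, Sn i (res B (ch x) c) := fun x =>
    AS_eq (Supp.res B (ch x) c)
  simp only [h1]
  rw [expect_sum_comm]
  apply sum_congr rfl; intro i hi
  unfold Sn
  rw [fub_piecewise B (fun x : ι → Bool => if ev c (ch x) * ev c (ch (flp i x)) < 0 then (1:ℝ) else 0)]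
  apply expect_congr rfl; intro x _
  apply expect_congr rfl; intro y _
  have e : flp i (B.piecewise y x) = B.piecewise (flp i y) x := by
    unfold flp
    rw [Finset.update_piecewise_of_mem B _ _ hi]
    simp [hi]
  rw [e, ch_piecewise, ch_piecewise, ev_res, ev_res]

/-- probability of disagreeing with a reference sign -/
noncomputable def dis (μ : ℝ) (c : Finset ι → ℝ) : ℝ :=
  𝔼 x : ι → Bool, if ev c (ch x) * μ ≤ 0 then (1:ℝ) else 0

lemma flp_flp (i : ι) (x : ι → Bool) : flp i (flp i x) = x := by
  unfold flp; simp

lemma expect_flp (i : ι) (F : (ι → Bool) → ℝ) : 𝔼 x : ι → Bool, F (flp i x) = 𝔼 x : ι → Bool, F x := by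
  let e : (ι → Bool) ≃ (ι → Bool) := ⟨flp i, flp i, flp_flp i, flp_flp i⟩
  exact Fintype.expect_equiv e _ _ (fun x => rfl)

lemma Sn_le_dis (i : ι) (c : Finset ι → ℝ) {μ : ℝ} (hμ : μ ≠ 0) : Sn i c ≤ 2 * dis μ c := by
  have h : Sn i c ≤ 𝔼 x : ι → Bool, ((if ev c (ch x) * μ ≤ 0 then (1:ℝ) else 0)
      + (if ev c (ch (flp i x)) * μ ≤ 0 then (1:ℝ) else 0)) := by
    apply expect_le_expect; intro x _
    split_ifs with h1 h2 h3 h3 h2 h3 h3 <;> try norm_num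
    push Not at h2 h3
    have h4 := mul_pos h2 h3
    have h5 : ev c (ch x) * μ * (ev c (ch (flp i x)) * μ) = (ev c (ch x) * ev c (ch (flp i x))) * μ ^ 2 := by ring
    have h6 : 0 < μ ^ 2 := by positivity
    nlinarith
  rw [expect_add_distrib, expect_flp i (fun x => if ev c (ch x) * μ ≤ 0 then (1:ℝ) else 0)] at h
  unfold dis
  linarith

/-- subtract a constant -/
noncomputable def sbc (μ : ℝ) (c : Finset ι → ℝ) : Finset ι → ℝ := fun T => if T = ∅ then c T - μ else c T

lemma ev_sbc (μ : ℝ) (c : Finset ι → ℝ) (z : ι → ℝ) : ev (sbc μ c) z = ev c z - μ := by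
  have : ∀ T : Finset ι, sbc μ c T * ∏ i ∈ T, z i = c T * ∏ i ∈ T, z i - if T = ∅ then μ else 0 := by
    intro T
    by_cases h : T = ∅
    · simp [sbc, h]
    · simp [sbc, h]
  simp only [ev, this, sum_sub_distrib]
  simp

lemma Deg.sbc {d : ℕ} {c : Finset ι → ℝ} (h : Deg d c) (μ : ℝ) : Deg d (sbc μ c) := by
  intro T hT
  have : T ≠ ∅ := by rintro rfl; simp at hT
  simp only [PT.sbc, h T hT, this]; simp

lemma nrm_sbc (μ : ℝ) (c : Finset ι → ℝ) : nrm (sbc μ c) = (c ∅ - μ) ^ 2 + vr c := by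
  rw [nrm_eq]
  congr 1
  unfold vr sbc
  apply sum_congr rfl; intro T _; split_ifs <;> rfl

lemma dis_aux {p μ : ℝ} (h : p * μ ≤ 0) : μ ^ 2 ≤ (p - μ) ^ 2 := by nlinarith [sq_nonneg p]

lemma dis_le (c : Finset ι → ℝ) {μ : ℝ} (hμ : μ ≠ 0) : dis μ c ≤ nrm (sbc μ c) / μ ^ 2 := by
  have hμ2 : 0 < μ ^ 2 := by positivity
  have h : dis μ c ≤ 𝔼 x : ι → Bool, ev (sbc μ c) (ch x) ^ 2 / μ ^ 2 := by
    apply expect_le_expect; intro x _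
    rw [ev_sbc]
    split_ifs with h
    · rw [le_div_iff₀ hμ2, one_mul]; exact dis_aux h
    · positivity
  rw [← expect_div] at h
  have h2 : 𝔼 x : ι → Bool, ev (sbc μ c) (ch x) ^ 2 = nrm (sbc μ c) :=
    parseval_sq (ι := ι) (u := fun _ => chi) (fun _ => good_chi) _
  rwa [h2] at h

lemma dis_le4 {d : ℕ} {c : Finset ι → ℝ} (hc : Deg d c) {μ : ℝ} (hμ : μ ≠ 0) :
    dis μ c ≤ 9 ^ d * (nrm (sbc μ c) / μ ^ 2) ^ 2 := by
  have hμ2 : 0 < μ ^ 2 := by positivity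
  have h : dis μ c ≤ 𝔼 x : ι → Bool, ev (sbc μ c) (ch x) ^ 4 / μ ^ 4 := by
    apply expect_le_expect; intro x _
    rw [ev_sbc]
    split_ifs with h
    · rw [le_div_iff₀ (by positivity), one_mul]
      have := pow_le_pow_left₀ hμ2.le (dis_aux h) 2
      calc μ ^ 4 = (μ ^ 2) ^ 2 := by ring
        _ ≤ _ := this
        _ = _ := by ring
    · positivity
  rw [← expect_div] at h
  have h2 : 𝔼 x : ι → Bool, ev (sbc μ c) (ch x) ^ 4 ≤ 9 ^ d * nrm (sbc μ c) ^ 2 :=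
    bonami' (ι := ι) (u := fun _ => chi) (fun _ => good_chi) (hc.sbc μ)
  calc dis μ c ≤ _ := h
    _ ≤ 9 ^ d * nrm (sbc μ c) ^ 2 / μ ^ 4 := by gcongr
    _ = _ := by rw [div_pow]; ring

lemma eq_zero_of_nrm {c : Finset ι → ℝ} (h : nrm c = 0) (z : ι → ℝ) : ev c z = 0 := by
  unfold ev
  apply sum_eq_zero; intro T _
  have := (sum_eq_zero_iff_of_nonneg (fun T _ => sq_nonneg (c T))).1 h T (mem_univ _)
  rw [pow_eq_zero_iff (two_ne_zero) |>.1 this, zero_mul]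

lemma Sn_zero_nrm {c : Finset ι → ℝ} (h : nrm c = 0) (i : ι) : Sn i c = 0 := by
  apply expect_eq_zero; intro x _
  rw [if_neg]; rw [eq_zero_of_nrm h, zero_mul]; exact lt_irrefl _

lemma mean_big {c : Finset ι → ℝ} (hM : 0 < nrm c) (hR : vr c / nrm c ≤ 1 / 2) :
    c ∅ ≠ 0 ∧ nrm c / 2 ≤ (c ∅) ^ 2 ∧ nrm (sbc (c ∅) c) / (c ∅) ^ 2 ≤ 2 * (vr c / nrm c) := by
  have hn := nrm_eq c
  rw [div_le_iff₀ hM] at hR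
  have h1 : nrm c / 2 ≤ (c ∅) ^ 2 := by linarith
  have h0 : c ∅ ≠ 0 := by intro h; rw [h] at h1; norm_num at h1; linarith
  refine ⟨h0, h1, ?_⟩
  rw [nrm_sbc, sub_self, zero_pow two_ne_zero, zero_add, ← mul_div_assoc, div_le_div_iff₀ (by positivity) hM]
  nlinarith [vr_nonneg c]

lemma Sn_le (i : ι) (c : Finset ι → ℝ) : Sn i c ≤ 4 * (vr c / nrm c) := by
  have hR := R_nonneg c
  rcases (nrm_nonneg c).eq_or_lt with h | h
  · rw [Sn_zero_nrm h.symm]; positivity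
  by_cases h2 : vr c / nrm c ≤ 1 / 2
  · obtain ⟨h3, h4, h5⟩ := mean_big h h2
    have := Sn_le_dis i c h3
    have := dis_le c h3
    linarith
  · push Not at h2
    have := Sn_le_one i c
    linarith

lemma Sn_le4 {d : ℕ} {c : Finset ι → ℝ} (hc : Deg d c) (i : ι) (h2 : vr c / nrm c ≤ 1 / 2) :
    Sn i c ≤ 8 * 9 ^ d * (vr c / nrm c) ^ 2 := by
  rcases (nrm_nonneg c).eq_or_lt with h | h
  · rw [Sn_zero_nrm h.symm]; positivity
  obtain ⟨h3, h4, h5⟩ := mean_big h h2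
  have h6 := Sn_le_dis i c h3
  have h7 := dis_le4 hc h3
  have h8 : (nrm (sbc (c ∅) c) / (c ∅) ^ 2) ^ 2 ≤ (2 * (vr c / nrm c)) ^ 2 :=
    pow_le_pow_left₀ (div_nonneg (nrm_nonneg _) (sq_nonneg _)) h5 2
  calc Sn i c ≤ 2 * (9 ^ d * (2 * (vr c / nrm c)) ^ 2) := by
        refine h6.trans ?_
        have : (9:ℝ) ^ d * (nrm (sbc (c ∅) c) / (c ∅) ^ 2) ^ 2 ≤ 9 ^ d * (2 * (vr c / nrm c)) ^ 2 := by gcongr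
        linarith
    _ = _ := by ring

lemma AS_le_card {B : Finset ι} {c : Finset ι → ℝ} (h : Supp B c) {a : ℝ} (ha : ∀ i, Sn i c ≤ a) :
    AS c ≤ #B * a := by
  rw [AS_eq h]
  calc _ ≤ ∑ i ∈ B, a := sum_le_sum fun i _ => ha i
    _ = _ := by rw [sum_const, nsmul_eq_mul]

lemma AS_nonneg (c : Finset ι → ℝ) : 0 ≤ AS c := sum_nonneg fun i _ => Sn_nonneg i c

/-! ### fixing one coordinate -/

noncomputable def fx (i : ι) (b : Bool) (c : Finset ι → ℝ) : Finset ι → ℝ := fun T => lo i c T + chi b * D i c T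

lemma ev_fx (i : ι) (b : Bool) (c : Finset ι → ℝ) (z : ι → ℝ) :
    ev (fx i b c) z = ev c (Function.update z i (chi b)) := by
  rw [ev_update]
  unfold ev fx
  rw [mul_sum, ← sum_add_distrib]
  apply sum_congr rfl; intro T _; ring

lemma nrm_fx (i : ι) (c : Finset ι → ℝ) : nrm (fx i true c) + nrm (fx i false c) = 2 * nrm c := by
  have h1 := nrm_lo i c
  have h2 := nrm_D i c
  have h3 : nrm (fx i true c) + nrm (fx i false c) = 2 * (nrm (lo i c) + nrm (D i c)) := by
    unfold nrm fx
    rw [← sum_add_distrib, ← sum_add_distrib, mul_sum]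
    apply sum_congr rfl; intro T _
    simp [chi]; ring
  rw [h3, h2, h1]

lemma Deg.fx {d : ℕ} {c : Finset ι → ℝ} (h : Deg d c) (i : ι) (b : Bool) : Deg d (fx i b c) := by
  intro T hT
  simp only [PT.fx, h.lo i T hT, h.D' i T hT]; simp

lemma Supp.fx {B : Finset ι} {c : Finset ι → ℝ} (h : Supp B c) (i : ι) (b : Bool) : Supp B (fx i b c) := by
  intro T hT
  have h2 : c (insert i T) = 0 := h _ fun h3 => hT ((subset_insert i T).trans h3)
  simp [PT.fx, PT.lo, PT.D, h T hT, h2]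

lemma D_fx_self (i : ι) (b : Bool) (c : Finset ι → ℝ) : D i (fx i b c) = fun _ => 0 := by
  funext T
  unfold D fx
  split_ifs with h
  · rfl
  · simp [lo, D]

lemma D_fx {i j : ι} (h : j ≠ i) (b : Bool) (c : Finset ι → ℝ) : D j (fx i b c) = fx i b (D j c) := by
  funext T
  simp only [D, fx, lo, mem_insert, h.symm, false_or, Finset.insert_comm i j, h]
  split_ifs <;> simp

lemma infl_fx_self (i : ι) (b : Bool) (c : Finset ι → ℝ) : infl i (fx i b c) = 0 := by
  rw [← nrm_D, D_fx_self]; simp [nrm]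

lemma infl_fx {i j : ι} (h : j ≠ i) (c : Finset ι → ℝ) :
    infl j (fx i true c) + infl j (fx i false c) = 2 * infl j c := by
  rw [← nrm_D, ← nrm_D, ← nrm_D, D_fx h, D_fx h, nrm_fx]

lemma sum_infl_fx (i : ι) (c : Finset ι → ℝ) :
    ∑ j, infl j (fx i true c) + ∑ j, infl j (fx i false c) = 2 * (∑ j, infl j c - infl i c) := by
  rw [← sum_add_distrib, ← add_sum_erase univ _ (mem_univ i), infl_fx_self, infl_fx_self,
    ← add_sum_erase univ (fun j => infl j c) (mem_univ i)]
  have : ∑ j ∈ univ.erase i, (infl j (fx i true c) + infl j (fx i false c)) = ∑ j ∈ univ.erase i, 2 * infl j c := by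
    apply sum_congr rfl; intro j hj; exact infl_fx (mem_erase.1 hj).1 c
  rw [this, ← mul_sum]; ring

lemma expect_bool (g : Bool → ℝ) : 𝔼 b : Bool, g b = (g true + g false) / 2 := by
  rw [Fintype.expect_eq_sum_div_card]; simp

lemma Sn_fx {i j : ι} (h : j ≠ i) (c : Finset ι → ℝ) :
    Sn j (fx i true c) + Sn j (fx i false c) = 2 * Sn j c := by
  have h1 : Sn j c = 𝔼 x : ι → Bool, 𝔼 b : Bool, if ev (fx i b c) (ch x) * ev (fx i b c) (ch (flp j x)) < 0 then (1:ℝ) else 0 := by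
    unfold Sn
    rw [fub_update i]
    apply expect_congr rfl; intro x _
    apply expect_congr rfl; intro b _
    have e : flp j (Function.update x i b) = Function.update (flp j x) i b := by
      unfold flp
      rw [Function.update_comm h.symm, Function.update_of_ne h]
    rw [e, ch_update, ch_update, ev_fx, ev_fx]
  rw [h1, expect_comm, expect_bool]
  unfold Sn; ring

lemma Sn_fx_self (i : ι) (b : Bool) (c : Finset ι → ℝ) : Sn i (fx i b c) = 0 :=
  Sn_eq_zero_of_D fun z => by rw [D_fx_self]; simp [ev]

lemma AS_fx (i : ι) (c : Finset ι → ℝ) : AS c = Sn i c + (AS (fx i true c) + AS (fx i false c)) / 2 := by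
  unfold AS
  rw [← sum_add_distrib, ← add_sum_erase univ _ (mem_univ i), ← add_sum_erase univ
    (fun j => Sn j (fx i true c) + Sn j (fx i false c)) (mem_univ i), Sn_fx_self, Sn_fx_self]
  have : ∑ j ∈ univ.erase i, (Sn j (fx i true c) + Sn j (fx i false c)) = ∑ j ∈ univ.erase i, 2 * Sn j c := by
    apply sum_congr rfl; intro j hj; exact Sn_fx (mem_erase.1 hj).1 c
  rw [this, ← mul_sum]; ring

noncomputable def m4 (c : Finset ι → ℝ) : ℝ := 𝔼 x : ι → Bool, ev c (ch x) ^ 4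

lemma m4_nonneg (c : Finset ι → ℝ) : 0 ≤ m4 c := expect_nonneg fun x _ => by positivity

lemma m4_fx (i : ι) (c : Finset ι → ℝ) : m4 (fx i true c) + m4 (fx i false c) = 2 * m4 c := by
  have h1 : m4 c = 𝔼 x : ι → Bool, 𝔼 b : Bool, ev (fx i b c) (ch x) ^ 4 := by
    unfold m4
    rw [fub_update i]
    apply expect_congr rfl; intro x _
    apply expect_congr rfl; intro b _
    rw [ch_update, ev_fx]
  rw [h1, expect_comm, expect_bool]
  unfold m4; ring

lemma nrm_sq_le_m4 (c : Finset ι → ℝ) : nrm c ^ 2 ≤ m4 c := by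
  have h2 : 𝔼 x : ι → Bool, ev c (ch x) ^ 2 = nrm c :=
    parseval_sq (ι := ι) (u := fun _ => chi) (fun _ => good_chi) _
  have := expect_mul_sq_le_sq_mul_sq univ (fun x : ι → Bool => ev c (ch x) ^ 2) (fun _ => 1)
  simp only [mul_one, one_pow, ← pow_mul] at this
  rw [expect_const univ_nonempty, mul_one, h2] at this
  exact this

end PT

end

section

open Finset
open scoped Classical BigOperators

set_option linter.all false

namespace PT

variable {ι : Type} [Fintype ι] [DecidableEq ι]

/-- martingale-type functionals dominating everything -/
structure Mart (Z : (Finset ι → ℝ) → ℝ) : Prop where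
  nn : ∀ c, 0 ≤ Z c
  hR : ∀ c, vr c / nrm c ≤ Z c
  hS : ∀ c i, Sn i c ≤ Z c
  avg : ∀ c i, Z (fx i true c) + Z (fx i false c) = 2 * Z c

lemma exists_mart (c : Finset ι → ℝ) (hM : 0 < nrm c) :
    ∃ Z : (Finset ι → ℝ) → ℝ, Mart Z ∧ Z c ≤ 8 * (vr c / nrm c) := by
  have hR0 := R_nonneg c
  by_cases h : vr c / nrm c ≤ 1 / 2
  · obtain ⟨h3, h4, h5⟩ := mean_big hM h
    set μ := c ∅ with hμ
    have hμ2 : 0 < μ ^ 2 := by positivity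
    refine ⟨fun c' => 4 * (nrm (sbc μ c') / μ ^ 2), ⟨?_, ?_, ?_, ?_⟩, by linarith⟩
    · intro c'; have := nrm_nonneg (sbc μ c'); positivity
    · intro c'
      have hq := nrm_nonneg (sbc μ c')
      have hqe := nrm_sbc μ c'
      set Q := nrm (sbc μ c')
      have hv : vr c' ≤ Q := by nlinarith [sq_nonneg (c' ∅ - μ)]
      by_cases h6 : μ ^ 2 / 4 ≤ Q
      · refine (R_le_one c').trans ?_
        rw [← mul_div_assoc, le_div_iff₀ hμ2]; linarith
      · push Not at h6
        have h7 : μ ^ 2 / 4 ≤ nrm c' := by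
          rw [nrm_eq c']
          nlinarith [sq_nonneg (2 * c' ∅ - μ), vr_nonneg c']
        calc vr c' / nrm c' ≤ Q / (μ ^ 2 / 4) := by gcongr
          _ = _ := by field_simp
    · intro c' i
      have := Sn_le_dis i c' h3
      have := dis_le c' h3
      have := div_nonneg (nrm_nonneg (sbc μ c')) hμ2.le
      linarith
    · intro c' i
      have e : ∀ b, sbc μ (fx i b c') = fx i b (sbc μ c') := by
        intro b; funext T
        unfold sbc fx lo D
        by_cases hT : T = ∅
        · subst hT; simp; ring
        · simp [hT]
      have := nrm_fx i (sbc μ c')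
      simp only [e]
      rw [← mul_add, ← add_div, this]; ring
  · push Not at h
    refine ⟨fun _ => 1, ⟨fun _ => zero_le_one, R_le_one, fun c i => Sn_le_one i c, fun _ _ => by norm_num⟩, by linarith⟩

def Gd (τ θ : ℝ) (c : Finset ι → ℝ) : Prop := (∀ i, infl i c ≤ τ * vr c) ∨ vr c ≤ θ * nrm c

noncomputable def pick [Nonempty ι] (τ : ℝ) (c : Finset ι → ℝ) : ι :=
  Classical.epsilon (fun i => τ * vr c < infl i c)

lemma pick_spec [Nonempty ι] {τ θ : ℝ} {c : Finset ι → ℝ} (h : ¬ Gd τ θ c) :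
    τ * vr c < infl (pick τ c) c := by
  unfold Gd at h
  push Not at h
  exact Classical.epsilon_spec h.1

noncomputable def Fl [Nonempty ι] (τ θ : ℝ) : ℕ → (Finset ι → ℝ) → ℝ
  | 0, c => if Gd τ θ c then 0 else 1
  | K + 1, c => if Gd τ θ c then 0 else
      (Fl τ θ K (fx (pick τ c) true c) + Fl τ θ K (fx (pick τ c) false c)) / 2

noncomputable def Mr [Nonempty ι] (τ θ : ℝ) : ℕ → (Finset ι → ℝ) → ℝ
  | 0, c => if Gd τ θ c then 0 else nrm c
  | K + 1, c => if Gd τ θ c then 0 else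
      (Mr τ θ K (fx (pick τ c) true c) + Mr τ θ K (fx (pick τ c) false c)) / 2

lemma Fl_good [Nonempty ι] {τ θ : ℝ} {c : Finset ι → ℝ} (h : Gd τ θ c) (K : ℕ) : Fl τ θ K c = 0 := by
  cases K <;> simp [Fl, h]

lemma Mr_good [Nonempty ι] {τ θ : ℝ} {c : Finset ι → ℝ} (h : Gd τ θ c) (K : ℕ) : Mr τ θ K c = 0 := by
  cases K <;> simp [Mr, h]

lemma Fl_bd [Nonempty ι] (τ θ : ℝ) (K : ℕ) : ∀ c : Finset ι → ℝ, 0 ≤ Fl τ θ K c ∧ Fl τ θ K c ≤ 1 := by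
  induction K with
  | zero => intro c; unfold Fl; split_ifs <;> norm_num
  | succ K ih =>
    intro c; unfold Fl
    split_ifs
    · norm_num
    · have h1 := ih (fx (pick τ c) true c)
      have h2 := ih (fx (pick τ c) false c)
      constructor <;> linarith [h1.1, h1.2, h2.1, h2.2]

lemma AS_tree [Nonempty ι] {τ θ α : ℝ} {d : ℕ} {B : Finset ι} {Z : (Finset ι → ℝ) → ℝ} (hZ : Mart Z) {k : ℝ}
    (hk : (#B : ℝ) ≤ k) (hα : 0 ≤ α) (hθ : 0 ≤ θ)
    (hreg : ∀ c : Finset ι → ℝ, Deg d c → Supp B c → (∀ i, infl i c ≤ τ * vr c) → AS c ≤ α * (vr c / nrm c))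
    (K : ℕ) : ∀ c : Finset ι → ℝ, Deg d c → Supp B c →
      AS c ≤ (K + α) * Z c + 4 * k * θ + k * Fl τ θ K c := by
  have hk0 : 0 ≤ k := le_trans (Nat.cast_nonneg _) hk
  have hgood : ∀ (K : ℕ) (c : Finset ι → ℝ), Deg d c → Supp B c → Gd τ θ c →
      AS c ≤ (K + α) * Z c + 4 * k * θ + k * Fl τ θ K c := by
    intro K c hc hB hg
    have hz := hZ.nn c
    rw [Fl_good hg]
    rcases hg with hg | hg
    · have h1 := hreg c hc hB hg
      have h2 := mul_le_mul_of_nonneg_left (hZ.hR c) hα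
      have h3 : 0 ≤ K * Z c := by positivity
      have h4 : 0 ≤ 4 * k * θ := by positivity
      linarith
    · have h1 := AS_le_card hB (fun i => Sn_le i c)
      have h2 : vr c / nrm c ≤ θ := div_le_of_le_mul₀ (nrm_nonneg c) hθ hg
      have h3 : (#B:ℝ) * (4 * (vr c / nrm c)) ≤ k * (4 * θ) := by
        have := R_nonneg c
        gcongr
      have h4 : 0 ≤ (K + α) * Z c := by positivity
      linarith
  induction K with
  | zero =>
    intro c hc hB
    by_cases hg : Gd τ θ c
    · exact hgood 0 c hc hB hg
    · have h1 := AS_le_card hB (fun i => Sn_le_one i c)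
      have h4 : 0 ≤ ((0:ℕ) + α) * Z c := by have := hZ.nn c; positivity
      have h5 : 0 ≤ 4 * k * θ := by positivity
      have : Fl τ θ 0 c = 1 := by simp [Fl, hg]
      rw [this]; linarith
  | succ K ih =>
    intro c hc hB
    by_cases hg : Gd τ θ c
    · exact hgood (K + 1) c hc hB hg
    · set i := pick τ c with hi
      have h1 := ih (fx i true c) (hc.fx i true) (hB.fx i true)
      have h2 := ih (fx i false c) (hc.fx i false) (hB.fx i false)
      have h3 := hZ.avg c i
      have h4 := hZ.hS c i
      rw [AS_fx i]
      have h5 : Fl τ θ (K + 1) c = (Fl τ θ K (fx i true c) + Fl τ θ K (fx i false c)) / 2 := by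
        simp [Fl, hg, hi]
      rw [h5]
      push_cast
      have h6 : (K + α) * Z (fx i true c) + (K + α) * Z (fx i false c) = (K + α) * (2 * Z c) := by
        rw [← mul_add, h3]
      linarith

lemma Mr_le [Nonempty ι] {τ θ : ℝ} {d : ℕ} (hd : 1 ≤ d) (hτ0 : 0 ≤ τ) (hτ1 : τ ≤ 1) (hθ : 0 < θ) (K : ℕ) :
    ∀ c : Finset ι → ℝ, Deg d c → Mr τ θ K c ≤ θ⁻¹ * (1 - τ / d) ^ K * ∑ i, infl i c := by
  have hd0 : (1:ℝ) ≤ d := by exact_mod_cast hd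
  have hq : 0 ≤ 1 - τ / d := by
    have : τ / d ≤ 1 := by rw [div_le_one (by linarith)]; linarith
    linarith
  have hI : ∀ c : Finset ι → ℝ, 0 ≤ ∑ i, infl i c := fun c => sum_nonneg fun i _ => infl_nonneg i c
  induction K with
  | zero =>
    intro c hc
    have h0 := hI c
    by_cases hg : Gd τ θ c
    · rw [Mr_good hg]; positivity
    · have h2 : ¬ vr c ≤ θ * nrm c := fun h => hg (Or.inr h)
      push Not at h2
      have h3 : nrm c ≤ θ⁻¹ * vr c := by
        rw [inv_mul_eq_div, le_div_iff₀ hθ]; linarith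
      have h4 := vr_le_sum_infl c
      simp only [Mr, hg, if_false, pow_zero, mul_one]
      exact h3.trans (by gcongr)
  | succ K ih =>
    intro c hc
    have h0 := hI c
    by_cases hg : Gd τ θ c
    · rw [Mr_good hg]; positivity
    · have hp := pick_spec hg
      set i := pick τ c with hi
      have h1 := ih (fx i true c) (hc.fx i true)
      have h2 := ih (fx i false c) (hc.fx i false)
      have h3 := sum_infl_fx i c
      have h4 := sum_infl_le hc
      have h5 : Mr τ θ (K + 1) c = (Mr τ θ K (fx i true c) + Mr τ θ K (fx i false c)) / 2 := by
        simp [Mr, hg, hi]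
      rw [h5]
      have h6 : ∑ j, infl j c - infl i c ≤ (1 - τ / d) * ∑ j, infl j c := by
        have : τ / d * ∑ j, infl j c ≤ τ * vr c := by
          calc τ / d * ∑ j, infl j c ≤ τ / d * (d * vr c) := by gcongr
            _ = _ := by field_simp
        linarith
      have h7 : θ⁻¹ * (1 - τ / d) ^ K * (∑ j, infl j c - infl i c) ≤ θ⁻¹ * (1 - τ / d) ^ K * ((1 - τ / d) * ∑ j, infl j c) := by
        gcongr
      have h8 : θ⁻¹ * (1 - τ / d) ^ K * (∑ j, infl j (fx i true c)) + θ⁻¹ * (1 - τ / d) ^ K * (∑ j, infl j (fx i false c))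
        = θ⁻¹ * (1 - τ / d) ^ K * (2 * (∑ j, infl j c - infl i c)) := by rw [← mul_add, h3]
      calc _ ≤ θ⁻¹ * (1 - τ / d) ^ K * (∑ j, infl j c - infl i c) := by linarith
        _ ≤ _ := h7
        _ = _ := by rw [pow_succ]; ring

lemma cs_two {a b g a' b' g' : ℝ} (hb : 0 ≤ b) (hg : 0 ≤ g) (hb' : 0 ≤ b') (hg' : 0 ≤ g')
    (h : a ^ 2 ≤ b * g) (h' : a' ^ 2 ≤ b' * g') : ((a + a') / 2) ^ 2 ≤ ((b + b') / 2) * ((g + g') / 2) := by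
  have h1 : 2 * (a * a') ≤ b * g' + b' * g := by
    apply le_of_sq_le_sq _ (by positivity) |> fun h => h
    have h2 : a ^ 2 * a' ^ 2 ≤ (b * g) * (b' * g') := by gcongr
    nlinarith [sq_nonneg (b * g' - b' * g)]
  nlinarith

lemma Fl_cs [Nonempty ι] (τ θ : ℝ) (K : ℕ) : ∀ c : Finset ι → ℝ,
    (nrm c - Mr τ θ K c) ^ 2 ≤ m4 c * (1 - Fl τ θ K c) := by
  induction K with
  | zero =>
    intro c
    by_cases hg : Gd τ θ c
    · rw [Mr_good hg, Fl_good hg, sub_zero, sub_zero, mul_one]; exact nrm_sq_le_m4 c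
    · simp [Mr, Fl, hg]
  | succ K ih =>
    intro c
    by_cases hg : Gd τ θ c
    · rw [Mr_good hg, Fl_good hg, sub_zero, sub_zero, mul_one]; exact nrm_sq_le_m4 c
    · set i := pick τ c with hi
      have h5 : Mr τ θ (K + 1) c = (Mr τ θ K (fx i true c) + Mr τ θ K (fx i false c)) / 2 := by
        simp [Mr, hg, hi]
      have h6 : Fl τ θ (K + 1) c = (Fl τ θ K (fx i true c) + Fl τ θ K (fx i false c)) / 2 := by
        simp [Fl, hg, hi]
      have h1 := ih (fx i true c)
      have h2 := ih (fx i false c)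
      have h3 := cs_two (m4_nonneg _) (sub_nonneg.2 (Fl_bd τ θ K (fx i true c)).2) (m4_nonneg _)
        (sub_nonneg.2 (Fl_bd τ θ K (fx i false c)).2) h1 h2
      have h7 := nrm_fx i c
      have h8 := m4_fx i c
      have e1 : nrm c = (nrm (fx i true c) + nrm (fx i false c)) / 2 := by linarith
      have e2 : m4 c = (m4 (fx i true c) + m4 (fx i false c)) / 2 := by linarith
      rw [h5, h6, e1, e2]
      convert h3 using 2 <;> ring

lemma Fl_le_phi [Nonempty ι] {τ θ : ℝ} {d : ℕ} (hd : 1 ≤ d) (hτ0 : 0 ≤ τ) (hτ1 : τ ≤ 1) (hθ : 0 < θ) {K : ℕ}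
    (hK : θ⁻¹ * (1 - τ / d) ^ K * d ≤ 1 / 2) {c : Finset ι → ℝ} (hc : Deg d c) :
    Fl τ θ K c ≤ 1 - 1 / (4 * 9 ^ d) := by
  have h9 : (1:ℝ) ≤ 9 ^ d := one_le_pow₀ (by norm_num)
  have hq : 0 ≤ 1 - τ / d := by
    have hd0 : (1:ℝ) ≤ d := by exact_mod_cast hd
    have : τ / d ≤ 1 := by rw [div_le_one (by linarith)]; linarith
    linarith
  rcases (nrm_nonneg c).eq_or_lt with h | h
  · have hg : Gd τ θ c := by
      right; rw [← h, mul_zero, h]; exact vr_le_nrm c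
    rw [Fl_good hg]
    have : 1 / (4 * (9:ℝ) ^ d) ≤ 1 := by rw [div_le_one (by positivity)]; linarith
    linarith
  · have h1 := Mr_le hd hτ0 hτ1 hθ K c hc
    have h2 := sum_infl_le hc
    have h3 := vr_le_nrm c
    have h4 : Mr τ θ K c ≤ nrm c / 2 := by
      calc _ ≤ _ := h1
        _ ≤ θ⁻¹ * (1 - τ / d) ^ K * (d * nrm c) := by
            gcongr; exact h2.trans (by gcongr)
        _ = θ⁻¹ * (1 - τ / d) ^ K * d * nrm c := by ring
        _ ≤ 1 / 2 * nrm c := by gcongr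
        _ = _ := by ring
    have h5 := Fl_cs τ θ K c
    have h6 : m4 c ≤ 9 ^ d * nrm c ^ 2 := bonami' (ι := ι) (u := fun _ => chi) (fun _ => good_chi) hc
    have h7 := (Fl_bd τ θ K c).2
    have h8 : m4 c * (1 - Fl τ θ K c) ≤ 9 ^ d * nrm c ^ 2 * (1 - Fl τ θ K c) :=
      mul_le_mul_of_nonneg_right h6 (by linarith)
    have h10 : (nrm c / 2) ^ 2 ≤ (nrm c - Mr τ θ K c) ^ 2 := pow_le_pow_left₀ (by positivity) (by linarith) 2
    have h11 : nrm c ^ 2 * (1 / 4) ≤ nrm c ^ 2 * (9 ^ d * (1 - Fl τ θ K c)) := by linarith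
    have h12 := le_of_mul_le_mul_left h11 (by positivity)
    have h13 : 1 / (4 * (9:ℝ) ^ d) ≤ 1 - Fl τ θ K c := by
      rw [div_le_iff₀ (by positivity)]; linarith
    linarith

lemma Fl_add [Nonempty ι] {τ θ φ : ℝ} {d K2 : ℕ} (hφ : ∀ c : Finset ι → ℝ, Deg d c → Fl τ θ K2 c ≤ φ) (K1 : ℕ) :
    ∀ c : Finset ι → ℝ, Deg d c → Fl τ θ (K1 + K2) c ≤ φ * Fl τ θ K1 c := by
  induction K1 with
  | zero =>
    intro c hc
    by_cases hg : Gd τ θ c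
    · rw [Fl_good hg, Fl_good hg, mul_zero]
    · rw [zero_add]
      have : Fl τ θ 0 c = 1 := by simp [Fl, hg]
      rw [this, mul_one]; exact hφ c hc
  | succ K ih =>
    intro c hc
    by_cases hg : Gd τ θ c
    · rw [Fl_good hg, Fl_good hg, mul_zero]
    · set i := pick τ c with hi
      have h6 : ∀ K, Fl τ θ (K + 1) c = (Fl τ θ K (fx i true c) + Fl τ θ K (fx i false c)) / 2 := by
        intro K; simp [Fl, hg, hi]
      rw [show K + 1 + K2 = (K + K2) + 1 by ring, h6, h6]
      have h1 := ih (fx i true c) (hc.fx i true)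
      have h2 := ih (fx i false c) (hc.fx i false)
      linarith

lemma Fl_pow [Nonempty ι] {τ θ φ : ℝ} {d K : ℕ} (hφ0 : 0 ≤ φ) (hφ : ∀ c : Finset ι → ℝ, Deg d c → Fl τ θ K c ≤ φ) (j : ℕ) :
    ∀ c : Finset ι → ℝ, Deg d c → Fl τ θ (j * K) c ≤ φ ^ j := by
  induction j with
  | zero => intro c hc; rw [pow_zero]; exact (Fl_bd _ _ _ _).2
  | succ j ih =>
    intro c hc
    rw [add_mul, one_mul, pow_succ]
    refine (Fl_add hφ (j * K) c hc).trans ?_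
    rw [mul_comm]; exact mul_le_mul_of_nonneg_right (ih c hc) hφ0

theorem tree_bound {τ θ α : ℝ} {d : ℕ} (hd : 1 ≤ d) {B : Finset ι} {k : ℝ}
    (hk : (#B : ℝ) ≤ k) (hα : 0 ≤ α) (hθ : 0 < θ) (hτ0 : 0 ≤ τ) (hτ1 : τ ≤ 1)
    (hreg : ∀ c : Finset ι → ℝ, Deg d c → Supp B c → (∀ i, infl i c ≤ τ * vr c) → AS c ≤ α * (vr c / nrm c))
    {K j : ℕ} (hK : θ⁻¹ * (1 - τ / d) ^ K * d ≤ 1 / 2) (c : Finset ι → ℝ) (hc : Deg d c) (hB : Supp B c) :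
    AS c ≤ 8 * (j * K + α) * (vr c / nrm c) + 4 * k * θ + k * (1 - 1 / (4 * 9 ^ d)) ^ j := by
  have hk0 : 0 ≤ k := le_trans (Nat.cast_nonneg _) hk
  have h9 : (1:ℝ) ≤ 9 ^ d := one_le_pow₀ (by norm_num)
  have hφ0 : 0 ≤ 1 - 1 / (4 * (9:ℝ) ^ d) := by
    have : 1 / (4 * (9:ℝ) ^ d) ≤ 1 := by rw [div_le_one (by positivity)]; linarith
    linarith
  have hR := R_nonneg c
  rcases (nrm_nonneg c).eq_or_lt with h | h
  · have : AS c = 0 := sum_eq_zero fun i _ => Sn_zero_nrm h.symm i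
    rw [this]; positivity
  rcases isEmpty_or_nonempty ι with he | he
  · have : AS c = 0 := by unfold AS; simp
    rw [this]; positivity
  obtain ⟨Z, hZ, hZc⟩ := exists_mart c h
  have h1 := AS_tree hZ hk hα hθ.le hreg (j * K) c hc hB
  have h2 := Fl_pow hφ0 (fun c hc => Fl_le_phi hd hτ0 hτ1 hθ hK hc) j c hc
  have h3 : ((j * K : ℕ) + α) * Z c ≤ ((j * K : ℕ) + α) * (8 * (vr c / nrm c)) := by gcongr
  have h4 : k * Fl τ θ (j * K) c ≤ k * (1 - 1 / (4 * 9 ^ d)) ^ j := by gcongr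
  push_cast at h1 h3
  linarith

end PT

end

section

open Finset
open scoped Classical BigOperators

set_option linter.all false

namespace PT

variable {ι : Type} [Fintype ι] [DecidableEq ι]

def Bd (d k : ℕ) (a : ℝ) : Prop := ∀ (ι : Type) [Fintype ι] [DecidableEq ι] (c : Finset ι → ℝ) (B : Finset ι),
  Deg d c → Supp B c → #B ≤ k → AS c ≤ a * √k * (vr c / nrm c)

lemma Bd.mono {d k : ℕ} {a b : ℝ} (h : Bd d k a) (hab : a ≤ b) : Bd d k b := by
  intro ι _ _ c B h1 h2 h3
  have := h ι c B h1 h2 h3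
  have h4 := R_nonneg c
  refine this.trans ?_
  gcongr

lemma exists_blocks (B : Finset ι) {M s : ℕ} (hM : #B ≤ M * s) (hs : 0 < s) :
    ∃ Bl : ℕ → Finset ι, (∀ l ∈ range M, ∀ l' ∈ range M, l ≠ l' → Disjoint (Bl l) (Bl l')) ∧
      (∀ l, #(Bl l) ≤ s) ∧ ∀ g : ι → ℝ, ∑ i ∈ B, g i = ∑ l ∈ range M, ∑ i ∈ Bl l, g i := by
  let idx : ι → ℕ := fun i => if h : i ∈ B then (B.equivFin ⟨i, h⟩ : ℕ) else 0
  have hinj : ∀ i ∈ B, ∀ j ∈ B, idx i = idx j → i = j := by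
    intro i hi j hj h
    simp only [idx, hi, hj, dif_pos] at h
    have := B.equivFin.injective (Fin.ext h)
    simpa using this
  have hlt : ∀ i ∈ B, idx i < #B := by
    intro i hi
    simp only [idx, hi, dif_pos]
    exact (B.equivFin ⟨i, hi⟩).2
  refine ⟨fun l => B.filter (fun i => idx i / s = l), ?_, ?_, ?_⟩
  · intro l _ l' _ hll
    rw [Finset.disjoint_left]
    intro i h1 h2
    simp only [mem_filter] at h1 h2
    exact hll (h1.2.symm.trans h2.2)
  · intro l
    have : #((B.filter (fun i => idx i / s = l)).image (fun i => idx i % s)) ≤ #(range s) := by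
      apply card_le_card
      intro r hr
      simp only [mem_image] at hr
      obtain ⟨i, _, rfl⟩ := hr
      exact mem_range.2 (Nat.mod_lt _ hs)
    rw [card_range, card_image_of_injOn] at this
    · exact this
    · intro i hi j hj h
      simp only [coe_filter, Set.mem_setOf_eq] at hi hj
      apply hinj i hi.1 j hj.1
      have h1 := Nat.div_add_mod (idx i) s
      have h2 := Nat.div_add_mod (idx j) s
      simp only at h
      rw [hi.2] at h1; rw [hj.2] at h2
      omega
  · intro g
    symm
    apply sum_fiberwise_of_maps_to
    intro i hi
    rw [mem_range, Nat.div_lt_iff_lt_mul hs]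
    exact (hlt i hi).trans_le hM

lemma reg_step {d N k s : ℕ} {C a : ℝ} (ha : 0 ≤ a) {c : Finset ι → ℝ}
    (hR : ∀ (L : Type) (A : Finset L) (Bl : L → Finset ι), (∀ l ∈ A, ∀ l' ∈ A, l ≠ l' → Disjoint (Bl l) (Bl l')) → #A ≤ N ^ 2 →
      ∑ l ∈ A, 𝔼 x : ι → Bool, vr (res (Bl l) (ch x) c) / nrm (res (Bl l) (ch x) c) ≤
        C * N * (vr c / nrm c))
    (hs : 0 < s) (hk : k ≤ N ^ 2 * s) (hb : Bd d s a) {B : Finset ι} (hc : Deg d c)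
    (hB : Supp B c) (hBk : #B ≤ k) : AS c ≤ a * √s * (C * N * (vr c / nrm c)) := by
  obtain ⟨Bl, h1, h2, h3⟩ := exists_blocks B (hBk.trans hk) hs
  rw [AS_eq hB, h3]
  calc _ = ∑ l ∈ range (N ^ 2), 𝔼 x : ι → Bool, AS (res (Bl l) (ch x) c) := sum_congr rfl fun l _ => AS_block _ _
    _ ≤ ∑ l ∈ range (N ^ 2), 𝔼 x : ι → Bool, a * √s * (vr (res (Bl l) (ch x) c) / nrm (res (Bl l) (ch x) c)) := by
        apply sum_le_sum; intro l _; apply expect_le_expect; intro x _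
        exact hb ι _ (Bl l) (hc.res _ _) (Supp.res _ _ _) (h2 l)
    _ = a * √s * ∑ l ∈ range (N ^ 2), 𝔼 x : ι → Bool, vr (res (Bl l) (ch x) c) / nrm (res (Bl l) (ch x) c) := by
        rw [mul_sum]; apply sum_congr rfl; intro l _; rw [mul_expect]
    _ ≤ _ := mul_le_mul_of_nonneg_left (hR _ _ Bl h1 (by simp)) (by positivity)

lemma exists_N {k E : ℕ} (hE : 1 ≤ E) (hk : 1 ≤ k) : ∃ N : ℕ, N ^ E ≤ k ∧ k < (N + 1) ^ E := by
  have hex : ∃ M : ℕ, k < (M + 1) ^ E := ⟨k, (Nat.lt_succ_self k).trans_le (Nat.le_self_pow (by omega) _)⟩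
  refine ⟨Nat.find hex, ?_, Nat.find_spec hex⟩
  rcases Nat.eq_zero_or_pos (Nat.find hex) with h | h
  · rw [h, zero_pow (by omega)]; omega
  · have := Nat.find_min hex (m := Nat.find hex - 1) (by omega)
    rw [Nat.sub_add_cancel h] at this
    omega

/-- bounds on the number of steps -/
lemma steps {d e k N : ℕ} (hd : 1 ≤ d) (hk : 1 ≤ k) (hN : 1 ≤ N) (hNk : N ^ (4 * e) ≤ k) :
    ∃ K j : ℕ, (((k:ℝ) ^ 2)⁻¹)⁻¹ * (1 - 1 / (N:ℝ) ^ e / d) ^ K * d ≤ 1 / 2 ∧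
      (k:ℝ) * (1 - 1 / (4 * 9 ^ d)) ^ j ≤ 1 / k ∧
      (j:ℝ) * K ≤ (1 + 64 * 9 ^ d) * (1 + d * (2 * d + 16)) * √k := by
  have hk1 : (1:ℝ) ≤ k := by exact_mod_cast hk
  have hk0 : (0:ℝ) < k := by linarith
  have hd1 : (1:ℝ) ≤ d := by exact_mod_cast hd
  have hN1 : (1:ℝ) ≤ N := by exact_mod_cast hN
  set η : ℝ := 1 / (4 * 9 ^ d) with hη
  have h9 : (1:ℝ) ≤ 9 ^ d := one_le_pow₀ (by norm_num)
  have hη0 : 0 < η := by positivity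
  have hη1 : η ≤ 1 := by rw [hη, div_le_one (by positivity)]; linarith
  set P : ℝ := (N:ℝ) ^ e with hP
  have hP1 : 1 ≤ P := one_le_pow₀ hN1
  have hlk : 0 ≤ Real.log k := Real.log_nonneg hk1
  set Λ : ℝ := Real.log (2 * d * k ^ 2) with hΛ
  have hΛ0 : 0 ≤ Λ := Real.log_nonneg (by nlinarith [one_le_pow₀ hk1 (n := 2)])
  have hΛe : Λ = Real.log (2 * d) + 2 * Real.log k := by
    rw [hΛ, Real.log_mul (by positivity) (by positivity), Real.log_pow]; norm_num
  have hΛle : Λ ≤ 2 * d + 2 * Real.log k := by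
    have := Real.log_le_self (x := 2 * (d:ℝ)) (by positivity)
    linarith
  set u : ℝ := (k:ℝ) ^ (1/8 : ℝ) with hu
  have hu1 : 1 ≤ u := Real.one_le_rpow hk1 (by norm_num)
  have hu8 : u ^ 8 = k := by
    rw [hu, ← Real.rpow_natCast, ← Real.rpow_mul hk0.le]; norm_num
  have hlu : Real.log k ≤ 8 * u := by
    have := Real.log_le_rpow_div hk0.le (ε := 1/8) (by norm_num)
    rw [← hu] at this; linarith
  have hPu : P ≤ u ^ 2 := by
    apply le_of_pow_le_pow_left₀ (n := 4) (by norm_num) (by positivity)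
    rw [show (u ^ 2) ^ 4 = u ^ 8 by ring, hu8, hP, ← pow_mul, mul_comm e 4]
    exact_mod_cast hNk
  have hsq : √(k:ℝ) = u ^ 4 := by
    rw [← hu8, show u ^ 8 = (u ^ 4) ^ 2 by ring, Real.sqrt_sq (by positivity)]
  refine ⟨⌈d * P * Λ⌉₊, ⌈2 * Real.log k / η⌉₊, ?_, ?_, ?_⟩
  · have hK := Nat.le_ceil (d * P * Λ)
    set K := ⌈d * P * Λ⌉₊
    have h1 : (1 - 1 / P / d) ^ K ≤ 1 / (2 * d * k ^ 2) := by
      have hle : 1 / P / d ≤ 1 := by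
        rw [div_div, div_le_one (by positivity)]; nlinarith
      calc (1 - 1 / P / d) ^ K ≤ (Real.exp (-(1 / P / d))) ^ K :=
            pow_le_pow_left₀ (by linarith) (Real.one_sub_le_exp_neg _) _
        _ = Real.exp (-(K * (1 / P / d))) := by rw [← Real.exp_nat_mul]; congr 1; ring
        _ ≤ Real.exp (-Λ) := by
            apply Real.exp_le_exp.2
            have : Λ = d * P * Λ * (1 / P / d) := by field_simp
            have h2 : d * P * Λ * (1 / P / d) ≤ K * (1 / P / d) := by gcongr
            linarith
        _ = _ := by rw [Real.exp_neg, hΛ, Real.exp_log (by positivity), one_div]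
    calc (((k:ℝ) ^ 2)⁻¹)⁻¹ * (1 - 1 / P / d) ^ K * d ≤ (((k:ℝ) ^ 2)⁻¹)⁻¹ * (1 / (2 * d * k ^ 2)) * d := by gcongr
      _ = 1 / 2 := by field_simp
  · have hK := Nat.le_ceil (2 * Real.log k / η)
    set K := ⌈2 * Real.log k / η⌉₊
    have h1 : (1 - η) ^ K ≤ 1 / k ^ 2 := by
      calc (1 - η) ^ K ≤ (Real.exp (-η)) ^ K :=
            pow_le_pow_left₀ (by linarith) (Real.one_sub_le_exp_neg _) _
        _ = Real.exp (-(K * η)) := by rw [← Real.exp_nat_mul]; congr 1; ring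
        _ ≤ Real.exp (-(2 * Real.log k)) := by
            apply Real.exp_le_exp.2
            rw [div_le_iff₀ hη0] at hK
            linarith
        _ = _ := by
            rw [Real.exp_neg, one_div, show 2 * Real.log k = Real.log (k ^ 2) by rw [Real.log_pow]; norm_num,
              Real.exp_log (by positivity)]
    calc (k:ℝ) * (1 - η) ^ K ≤ k * (1 / k ^ 2) := by gcongr
      _ = 1 / k := by field_simp
  · have hj := (Nat.ceil_lt_add_one (a := 2 * Real.log k / η) (by positivity)).le
    have hK := (Nat.ceil_lt_add_one (a := d * P * Λ) (by positivity)).le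
    have hj2 : (⌈2 * Real.log k / η⌉₊ : ℝ) ≤ (1 + 64 * 9 ^ d) * u := by
      have : 2 * Real.log k / η = 8 * 9 ^ d * Real.log k := by rw [hη]; field_simp; ring
      rw [this] at hj ⊢
      have : 8 * 9 ^ d * Real.log k ≤ 8 * 9 ^ d * (8 * u) := by gcongr
      linarith
    have hK2 : (⌈d * P * Λ⌉₊ : ℝ) ≤ (1 + d * (2 * d + 16)) * u ^ 3 := by
      have h1 : Λ ≤ (2 * d + 16) * u := by nlinarith
      have h2 : d * P * Λ ≤ d * u ^ 2 * ((2 * d + 16) * u) := by gcongr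
      have h3 : 1 ≤ u ^ 3 := one_le_pow₀ hu1
      nlinarith
    calc (⌈2 * Real.log k / η⌉₊ : ℝ) * ⌈d * P * Λ⌉₊ ≤ ((1 + 64 * 9 ^ d) * u) * ((1 + d * (2 * d + 16)) * u ^ 3) := by
          gcongr
      _ = _ := by rw [hsq]; ring

end PT

end

section

open Finset
open scoped Classical BigOperators

set_option linter.all false

namespace PT

lemma fin_step {U C Q a k sk R A J φ : ℝ} (hU : 0 ≤ U) (hC : 0 ≤ C) (hQ : 0 ≤ Q) (ha : 0 ≤ a)
    (hsk : sk * sk = k) (hsk4 : 4 ≤ sk) (hR : 0 ≤ R) (hA : R ≤ 1 / 2 → A ≤ k * (U * R ^ 2)) (hk0 : 0 < k)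
    (hJ : J ≤ Q * sk) (hφ : φ ≤ 1 / k)
    (ht : A ≤ 8 * (J + 2 * a * C * sk) * R + 4 * k * (k ^ 2)⁻¹ + φ) :
    A ≤ (8 * (Q + 2 * C) + 5 + U) * (a + 1) * sk * R := by
  by_cases hsm : R * sk ≤ 1
  · have h2 : R ≤ 1 / 2 := by nlinarith
    calc A ≤ k * (U * R ^ 2) := hA h2
      _ = U * sk * R * (R * sk) := by rw [← hsk]; ring
      _ ≤ U * sk * R * 1 := by gcongr
      _ ≤ _ := by
          rw [mul_one]
          gcongr
          have : 0 ≤ 8 * (Q + 2 * C) + 5 := by positivity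
          nlinarith [mul_nonneg ha this, mul_nonneg ha hU]
  · push Not at hsm
    have e1 : 4 * (k:ℝ) * ((k:ℝ) ^ 2)⁻¹ = 4 * (1 / k) := by field_simp
    have e2 : 1 / (k:ℝ) ≤ 1 := by rw [div_le_one hk0]; nlinarith
    rw [e1] at ht
    have h6 : 8 * (J + 2 * a * C * sk) * R ≤ 8 * (Q * sk + 2 * a * C * sk) * R := by gcongr
    calc A ≤ 8 * (Q * sk + 2 * a * C * sk) * R + 5 * sk * R := by nlinarith
      _ = (8 * (Q + 2 * a * C) + 5) * sk * R := by ring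
      _ ≤ _ := by
          gcongr
          nlinarith [mul_nonneg ha hU, mul_nonneg ha hQ, mul_nonneg ha hC]

lemma main_step (d : ℕ) (hd : 1 ≤ d) : ∃ (E k0 : ℕ) (C1 : ℝ), 2 ≤ E ∧ 1 ≤ k0 ∧ 0 < C1 ∧ ∀ k : ℕ, k0 ≤ k →
    ∃ s : ℕ, 1 ≤ s ∧ s < k ∧ 1 + Real.log s ≤ (1 - 1 / (E:ℝ)) * (1 + Real.log k) ∧
      ∀ a : ℝ, 0 ≤ a → Bd d s a → Bd d k (C1 * (a + 1)) := by
  obtain ⟨e, he, C, hC, hreg⟩ := regular d hd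
  set Q : ℝ := (1 + 64 * 9 ^ d) * (1 + d * (2 * d + 16)) with hQ
  have hQ0 : 0 < Q := by positivity
  refine ⟨4 * e, (2 * d + 5) ^ (4 * e) + ⌈Real.exp (3 * (4 * e) + 1)⌉₊, 8 * (Q + 2 * C) + 5 + 8 * 9 ^ d, by omega, ?_, by positivity, ?_⟩
  · have : 1 ≤ (2 * d + 5) ^ (4 * e) := Nat.one_le_pow _ _ (by omega)
    omega
  intro k hk
  have hk5 : (2 * d + 5) ^ (4 * e) ≤ k := by omega
  have hkexp : Real.exp (3 * (4 * e) + 1) ≤ k := by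
    refine (Nat.le_ceil _).trans ?_
    exact_mod_cast (by omega : ⌈Real.exp (3 * (4 * e) + 1)⌉₊ ≤ k)
  have hk4 : 16 ≤ k := by
    calc 16 ≤ (2 * d + 5) ^ 4 := by
          calc 16 = 2 ^ 4 := by norm_num
            _ ≤ _ := Nat.pow_le_pow_left (by omega) _
      _ ≤ (2 * d + 5) ^ (4 * e) := Nat.pow_le_pow_right (by omega) (by omega)
      _ ≤ k := hk5
  obtain ⟨N, hN1, hN2⟩ := exists_N (k := k) (E := 4 * e) (by omega) (by omega)
  have hN : 2 * d + 5 ≤ N := by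
    have := lt_of_pow_lt_pow_left₀ _ (by omega) (hk5.trans_lt hN2)
    omega
  have hNk : N ^ 2 ≤ k := le_trans (Nat.pow_le_pow_right (by omega) (by omega)) hN1
  have hNp : 0 < N ^ 2 := pow_pos (by omega) 2
  have hs1 : k ≤ N ^ 2 * (k / N ^ 2 + 1) := by
    have := Nat.lt_mul_div_succ k hNp
    omega
  have hs2 : N ^ 2 * (k / N ^ 2 + 1) ≤ 2 * k := by
    have := Nat.mul_div_le k (N ^ 2)
    nlinarith
  obtain ⟨s, hs⟩ : ∃ s, s = k / N ^ 2 + 1 := ⟨_, rfl⟩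
  rw [← hs] at hs1 hs2
  have hs1' : 1 ≤ s := by rw [hs]; exact Nat.le_add_left 1 _
  clear hs
  have hkR : (16:ℝ) ≤ k := by exact_mod_cast hk4
  have hk0 : (0:ℝ) < k := by linarith
  have hNR : (7:ℝ) ≤ N := by exact_mod_cast (by omega : 7 ≤ N)
  have hsR : (N:ℝ) ^ 2 * s ≤ 2 * k := by exact_mod_cast hs2
  have hs0 : (1:ℝ) ≤ s := by exact_mod_cast hs1'
  have heR : (1:ℝ) ≤ e := by exact_mod_cast he
  refine ⟨s, hs1', ?_, ?_, ?_⟩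
  · have : 49 ≤ N ^ 2 := by nlinarith
    nlinarith
  · have h1 : 2 * Real.log N + Real.log s ≤ Real.log 2 + Real.log k := by
      have := Real.log_le_log (by positivity) hsR
      rw [Real.log_mul (by positivity) (by positivity), Real.log_mul (by norm_num) (by positivity), Real.log_pow] at this
      exact_mod_cast this
    have h2 : Real.log k ≤ (4 * e) * Real.log (N + 1) := by
      have h : (k:ℝ) ≤ ((N:ℝ) + 1) ^ (4 * e) := by exact_mod_cast hN2.le
      have := Real.log_le_log hk0 h
      rw [Real.log_pow] at this
      exact_mod_cast this
    have h3 : Real.log (N + 1) ≤ Real.log 2 + Real.log N := by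
      rw [← Real.log_mul (by norm_num) (by positivity)]
      exact Real.log_le_log (by positivity) (by linarith)
    have h4 : 3 * (4 * e) + 1 ≤ Real.log k := by
      rw [← Real.log_exp (3 * (4 * (e:ℝ)) + 1)]
      exact Real.log_le_log (Real.exp_pos _) hkexp
    have h5 : Real.log 2 ≤ 1 := by have := Real.log_two_lt_d9; linarith
    push_cast
    set E : ℝ := 4 * e with hE
    have hE0 : 0 < E := by positivity
    have h6 : Real.log k / E ≤ Real.log 2 + Real.log N := by
      rw [div_le_iff₀ hE0]; nlinarith
    have h7 : 3 + 1 / E ≤ Real.log k / E := by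
      rw [← sub_nonneg]
      have : Real.log k / E - (3 + 1 / E) = (Real.log k - (3 * E + 1)) / E := by field_simp
      rw [this]; apply div_nonneg <;> linarith
    have h8 : (1 - 1 / E) * (1 + Real.log k) = 1 - 1 / E + Real.log k - Real.log k / E := by ring
    rw [h8]; linarith
  · intro a ha hb ι _ _ c B hc hB hBk
    have hBR : (#B : ℝ) ≤ k := by exact_mod_cast hBk
    obtain ⟨K, j, hK, hj, hjK⟩ := steps (e := e) hd (by omega : 1 ≤ k) (by omega : 1 ≤ N) hN1
    have hR0 := R_nonneg c
    have hsqk : √(k:ℝ) * √(k:ℝ) = k := Real.mul_self_sqrt hk0.le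
    have hsk4 : 4 ≤ √(k:ℝ) := by
      apply Real.le_sqrt_of_sq_le; linarith
    have hNe1 : (1:ℝ) ≤ (N:ℝ) ^ e := one_le_pow₀ (by linarith)
    have hsN : √(s:ℝ) * N ≤ 2 * √(k:ℝ) := by
      apply le_of_sq_le_sq _ (by positivity)
      rw [mul_pow, mul_pow, Real.sq_sqrt (by positivity), Real.sq_sqrt hk0.le]
      linarith
    have htree := tree_bound (τ := 1 / (N:ℝ) ^ e) (θ := ((k:ℝ) ^ 2)⁻¹) (α := 2 * a * C * √k) hd hBR (by positivity)
      (by positivity) (by positivity) (by rw [div_le_one (by positivity)]; exact hNe1) (by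
        intro c' hc' hB' hi
        have h1 := reg_step ha (hreg ι c' hc' N (by omega) (by omega) hi) hs1' hs1 hb hc' hB' hBk
        refine h1.trans ?_
        have hR' := R_nonneg c'
        calc a * √s * (C * N * (vr c' / nrm c')) = a * C * (√s * N) * (vr c' / nrm c') := by ring
          _ ≤ a * C * (2 * √k) * (vr c' / nrm c') := by gcongr
          _ = _ := by ring) (j := j) hK c hc hB
    have hfin := fin_step (by positivity : (0:ℝ) ≤ 8 * 9 ^ d) hC.le hQ0.le ha hsqk hsk4 hR0
      (fun h2 => (AS_le_card hB (fun i => Sn_le4 hc i h2)).trans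
        (mul_le_mul_of_nonneg_right hBR (by positivity))) hk0 hjK hj htree
    exact hfin

theorem main_rec (d : ℕ) (hd : 1 ≤ d) : ∃ (Γ : ℝ) (β : ℕ), 0 < Γ ∧ ∀ k : ℕ, 1 ≤ k →
    Bd d k (Γ * (1 + Real.log k) ^ β) := by
  obtain ⟨E, k0, C1, hE, hk0, hC1, hstep⟩ := main_step d hd
  have hE0 : (2:ℝ) ≤ E := by exact_mod_cast hE
  have hr0 : 0 ≤ 1 - 1 / (E:ℝ) := by
    have : 1 / (E:ℝ) ≤ 1 := by rw [div_le_one (by linarith)]; linarith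
    linarith
  have hr1 : 1 - 1 / (E:ℝ) < 1 := by
    have : 0 < 1 / (E:ℝ) := by positivity
    linarith
  obtain ⟨β, hβ⟩ := exists_pow_lt_of_lt_one (show 0 < 1 / (2 * C1) by positivity) hr1
  refine ⟨2 * C1 + 4 * k0, β, by positivity, ?_⟩
  set Γ : ℝ := 2 * C1 + 4 * k0 with hΓ
  have hΓ0 : 0 < Γ := by positivity
  intro k
  induction k using Nat.strong_induction_on with
  | _ k ih =>
    intro hk
    have hlk : 0 ≤ Real.log k := Real.log_nonneg (by exact_mod_cast hk)
    have hpw : 1 ≤ (1 + Real.log k) ^ β := one_le_pow₀ (by linarith)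
    by_cases hkk : k0 ≤ k
    · obtain ⟨s, hs1, hsk, hls, hb⟩ := hstep k hkk
      have hls0 : 0 ≤ Real.log s := Real.log_nonneg (by exact_mod_cast hs1)
      refine (hb _ (by positivity) (ih s hsk hs1)).mono ?_
      have h1 : (1 + Real.log s) ^ β ≤ 1 / (2 * C1) * (1 + Real.log k) ^ β := by
        calc _ ≤ ((1 - 1 / (E:ℝ)) * (1 + Real.log k)) ^ β := pow_le_pow_left₀ (by linarith) hls _
          _ = (1 - 1 / (E:ℝ)) ^ β * (1 + Real.log k) ^ β := mul_pow _ _ _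
          _ ≤ _ := by gcongr
      have h2 : C1 * (Γ * (1 + Real.log s) ^ β) ≤ C1 * (Γ * (1 / (2 * C1) * (1 + Real.log k) ^ β)) := by gcongr
      have h3 : C1 * (Γ * (1 / (2 * C1) * (1 + Real.log k) ^ β)) = Γ / 2 * (1 + Real.log k) ^ β := by field_simp
      have h4 : C1 ≤ Γ / 2 := by rw [hΓ]; have : (0:ℝ) ≤ k0 := by positivity
                                 linarith
      nlinarith
    · push Not at hkk
      intro ι _ _ c B hc hB hBk
      have hR0 := R_nonneg c
      have h1 := AS_le_card hB (fun i => Sn_le i c)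
      have hBR : (#B : ℝ) ≤ k0 := by exact_mod_cast (hBk.trans hkk.le)
      have hsk : 1 ≤ √(k:ℝ) := Real.one_le_sqrt.2 (by exact_mod_cast hk)
      calc AS c ≤ #B * (4 * (vr c / nrm c)) := h1
        _ ≤ k0 * (4 * (vr c / nrm c)) := by gcongr
        _ = (4 * k0) * 1 * 1 * (vr c / nrm c) := by ring
        _ ≤ Γ * (1 + Real.log k) ^ β * √k * (vr c / nrm c) := by
            gcongr
            rw [hΓ]; linarith

theorem AS_bound (d : ℕ) (hd : 1 ≤ d) : ∃ (Γ : ℝ) (β : ℕ), 0 < Γ ∧ ∀ k : ℕ, 1 ≤ k →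
    ∀ c : Finset (Fin k) → ℝ, Deg d c → AS c ≤ Γ * (1 + Real.log k) ^ β * √k := by
  obtain ⟨Γ, β, hΓ, h⟩ := main_rec d hd
  refine ⟨Γ, β, hΓ, fun k hk c hc => ?_⟩
  have h1 := h k hk (Fin k) c univ hc (fun T hT => absurd (subset_univ T) hT) (by simp)
  have hlk : 0 ≤ Real.log k := Real.log_nonneg (by exact_mod_cast hk)
  refine h1.trans (mul_le_of_le_one_right (by positivity) (R_le_one c))

end PT

end

section

open Finset
open scoped Classical BigOperators

set_option linter.all false

namespace PT

lemma ptf_coef {n d : ℕ} (p : MvPolynomial (Fin n) ℝ) (hp : ∀ m ∈ p.support, ∀ i, m i ≤ 1) (hd : p.totalDegree ≤ d) :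
    ∃ c : Finset (Fin n) → ℝ, Deg d c ∧ ∀ x, pev p x = ev c (ch x) := by
  refine ⟨fun T => ∑ m ∈ p.support, if m.support = T then p.coeff m else 0, ?_, ?_⟩
  · intro T hT
    apply sum_eq_zero
    intro m hm
    rw [if_neg]
    rintro rfl
    have h1 := (MvPolynomial.le_totalDegree hm).trans hd
    have h2 : #m.support ≤ m.sum fun _ e => e := by
      rw [Finsupp.sum, card_eq_sum_ones]
      apply sum_le_sum
      intro i hi
      have := Finsupp.mem_support_iff.1 hi
      omega
    omega
  · intro x
    unfold pev ev
    rw [MvPolynomial.eval_eq']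
    simp only [sum_mul]
    rw [sum_comm]
    apply sum_congr rfl
    intro m hm
    simp only [ite_mul, zero_mul]
    rw [sum_ite_eq, if_pos (mem_univ _)]
    congr 1
    rw [← prod_subset (subset_univ m.support)]
    · apply prod_congr rfl
      intro i hi
      have h1 := hp m hm i
      have h2 := Finsupp.mem_support_iff.1 hi
      rw [show m i = 1 by omega, pow_one]; rfl
    · intro i _ hi
      rw [Finsupp.notMem_support_iff.1 hi, pow_zero]

lemma chi_beq (a b : Bool) : chi (a == b) = chi a * chi b := by
  cases a <;> cases b <;> simp [chi]

lemma chi_self_mul (a : Bool) : chi a * chi a = 1 := by cases a <;> simp [chi]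

def Pp {n m : ℕ} (x : Fin n → Bool) (ψ : Fin n → Option (Fin m)) (y : Fin m → Bool) : Fin n → Bool :=
  fun i => x i == (ψ i).elim true y

lemma odd_set {n m : ℕ} (ψ : Fin n → Option (Fin m)) (T : Finset (Fin n)) :
    ∃ S : Finset (Fin m), #S ≤ #T ∧ ∀ y : Fin m → Bool, ∏ i ∈ T, chi ((ψ i).elim true y) = ∏ j ∈ S, chi (y j) := by
  induction T using Finset.induction_on with
  | empty => exact ⟨∅, by simp, by simp⟩
  | insert a T ha ih =>
    obtain ⟨S, hS, h⟩ := ih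
    rw [card_insert_of_notMem ha]
    rcases hψ : ψ a with _ | j
    · refine ⟨S, by omega, fun y => ?_⟩
      rw [prod_insert ha, h, hψ]; simp [chi]
    · by_cases hj : j ∈ S
      · refine ⟨S.erase j, by have := card_erase_le (s := S) (a := j); omega, fun y => ?_⟩
        rw [prod_insert ha, h, hψ, ← mul_prod_erase S _ hj, ← mul_assoc]
        simp [chi_self_mul]
      · refine ⟨insert j S, by rw [card_insert_of_notMem hj]; omega, fun y => ?_⟩
        rw [prod_insert ha, h, hψ, prod_insert hj]; simp

lemma pull_coef {n m d : ℕ} {c : Finset (Fin n) → ℝ} (hc : Deg d c) (x : Fin n → Bool) (ψ : Fin n → Option (Fin m)) :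
    ∃ c' : Finset (Fin m) → ℝ, Deg d c' ∧ ∀ y, ev c' (ch y) = ev c (ch (Pp x ψ y)) := by
  choose S hS h using odd_set ψ
  refine ⟨fun U => ∑ T, if S T = U then c T * ∏ i ∈ T, chi (x i) else 0, ?_, ?_⟩
  · intro U hU
    apply sum_eq_zero
    intro T _
    split_ifs with h1
    · rw [hc T (by rw [← h1] at hU; exact hU.trans_le (hS T)), zero_mul]
    · rfl
  · intro y
    unfold ev
    simp only [sum_mul]
    rw [sum_comm]
    apply sum_congr rfl
    intro T _
    simp only [ite_mul, zero_mul]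
    rw [sum_ite_eq, if_pos (mem_univ _)]
    have h1 : ∀ i, ch (Pp x ψ y) i = chi (x i) * chi ((ψ i).elim true y) := fun i => chi_beq _ _
    simp only [h1, prod_mul_distrib]
    rw [h T y, mul_assoc]; rfl

lemma push_weights {n : ℕ} {O : Type} [Fintype O] (w : O → ℝ) (φ : O → Bool) (v : Bool → ℝ)
    (hv : ∀ b, ∑ o, (if φ o = b then w o else 0) = v b) (G : (Fin n → Bool) → ℝ) :
    ∑ ψ : Fin n → O, (∏ i, w (ψ i)) * G (fun i => φ (ψ i)) = ∑ z : Fin n → Bool, (∏ i, v (z i)) * G z := by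
  have h1 : ∀ z : Fin n → Bool, ∏ i, v (z i) = ∑ ψ : Fin n → O, if (fun i => φ (ψ i)) = z then ∏ i, w (ψ i) else 0 := by
    intro z
    calc ∏ i, v (z i) = ∏ i, ∑ o, (if φ o = z i then w o else 0) := by simp only [hv]
      _ = ∑ ψ : Fin n → O, ∏ i, (if φ (ψ i) = z i then w (ψ i) else 0) := by
          rw [prod_univ_sum, Fintype.piFinset_univ]
      _ = _ := by
          apply sum_congr rfl
          intro ψ _
          split_ifs with h
          · apply prod_congr rfl; intro i _; rw [if_pos (congrFun h i)]
          · have : ∃ i, φ (ψ i) ≠ z i := by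
              by_contra hcon; push Not at hcon; exact h (funext hcon)
            obtain ⟨i, hi⟩ := this
            exact prod_eq_zero (mem_univ i) (if_neg hi)
  simp only [h1, sum_mul]
  rw [sum_comm]
  apply sum_congr rfl
  intro ψ _
  simp only [ite_mul, zero_mul]
  rw [sum_ite_eq, if_pos (mem_univ _)]

lemma expect_Pp {n m : ℕ} (ψ : Fin n → Option (Fin m)) (y : Fin m → Bool) (F : (Fin n → Bool) → ℝ) :
    𝔼 x : Fin n → Bool, F (Pp x ψ y) = 𝔼 x : Fin n → Bool, F x := by
  have hinv : Function.Involutive (fun x : Fin n → Bool => Pp x ψ y) := by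
    intro x; funext i; simp only [Pp]
    cases x i <;> cases (ψ i).elim true y <;> rfl
  exact Fintype.expect_equiv hinv.toPerm _ _ (fun x => rfl)

noncomputable def ind {n : ℕ} (c : Finset (Fin n) → ℝ) (x z : Fin n → Bool) : ℝ :=
  if ev c (ch x) * ev c (ch (fun i => (x i != z i))) < 0 then 1 else 0

lemma Pp_flp {n m : ℕ} (x : Fin n → Bool) (ψ : Fin n → Option (Fin m)) (y : Fin m → Bool) (j : Fin m) :
    (fun i => (Pp x ψ y i != decide (ψ i = some j))) = Pp x ψ (flp j y) := by
  funext i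
  simp only [Pp, flp]
  rcases h : ψ i with _ | l
  · simp
  · by_cases hl : l = j
    · subst hl; simp; cases x i <;> cases y l <;> rfl
    · simp [hl, Function.update_of_ne hl]

/-- noise sensitivity through average sensitivity -/
lemma NS_AS {n m d : ℕ} {c : Finset (Fin n) → ℝ} (hc : Deg d c) {δ M : ℝ} (hδ : 0 ≤ δ) (hm : (m:ℝ) * δ ≤ 1)
    (hM : ∀ c' : Finset (Fin m) → ℝ, Deg d c' → AS c' ≤ M) :
    m * (𝔼 x : Fin n → Bool, ∑ z : Fin n → Bool, (∏ i, if z i then δ else 1 - δ) * ind c x z) ≤ M := by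
  let w : Option (Fin m) → ℝ := fun o => o.elim (1 - m * δ) (fun _ => δ)
  have hw0 : ∀ o, 0 ≤ w o := by rintro (_ | j) <;> simp only [w, Option.elim] <;> linarith
  have hw1 : ∑ o, w o = 1 := by
    rw [Fintype.sum_option]; simp [w]
  choose c' hc' hev using fun x (ψ : Fin n → Option (Fin m)) => pull_coef hc x ψ
  have key : ∀ j : Fin m, 𝔼 x : Fin n → Bool, ∑ z : Fin n → Bool, (∏ i, if z i then δ else 1 - δ) * ind c x z
      = ∑ ψ : Fin n → Option (Fin m), (∏ i, w (ψ i)) * 𝔼 x : Fin n → Bool, Sn j (c' x ψ) := by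
    intro j
    have hv : ∀ b : Bool, ∑ o : Option (Fin m), (if decide (o = some j) = b then w o else 0) = if b then δ else 1 - δ := by
      have htrue : ∑ o : Option (Fin m), (if decide (o = some j) = true then w o else 0) = δ := by
        simp [w]
      intro b
      cases b
      · have : ∑ o : Option (Fin m), (if decide (o = some j) = true then w o else 0) +
          ∑ o : Option (Fin m), (if decide (o = some j) = false then w o else 0) = ∑ o, w o := by
          rw [← sum_add_distrib]
          apply sum_congr rfl; intro o _
          by_cases h : o = some j <;> simp [h]
        rw [htrue, hw1] at this
        simp only [Bool.false_eq_true, if_false]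
        linarith
      · simpa using htrue
    calc _ = 𝔼 x : Fin n → Bool, ∑ ψ : Fin n → Option (Fin m), (∏ i, w (ψ i)) * ind c x (fun i => decide (ψ i = some j)) := by
          apply expect_congr rfl; intro x _
          exact (push_weights w (fun o => decide (o = some j)) (fun b => if b then δ else 1 - δ) hv (ind c x)).symm
      _ = ∑ ψ : Fin n → Option (Fin m), (∏ i, w (ψ i)) * 𝔼 x : Fin n → Bool, ind c x (fun i => decide (ψ i = some j)) := by
          rw [expect_sum_comm]; apply sum_congr rfl; intro ψ _; rw [mul_expect]
      _ = _ := by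
          apply sum_congr rfl; intro ψ _; congr 1
          calc _ = 𝔼 y : Fin m → Bool, 𝔼 x : Fin n → Bool, ind c (Pp x ψ y) (fun i => decide (ψ i = some j)) := by
                rw [expect_congr rfl (fun y _ => expect_Pp ψ y (fun x => ind c x (fun i => decide (ψ i = some j)))),
                  expect_const univ_nonempty]
            _ = 𝔼 x : Fin n → Bool, 𝔼 y : Fin m → Bool, ind c (Pp x ψ y) (fun i => decide (ψ i = some j)) := expect_comm _ _ _
            _ = _ := by
                apply expect_congr rfl; intro x _
                unfold Sn
                apply expect_congr rfl; intro y _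
                rw [hev, hev, ind, Pp_flp]
  have h2 : (m:ℝ) * (𝔼 x : Fin n → Bool, ∑ z : Fin n → Bool, (∏ i, if z i then δ else 1 - δ) * ind c x z)
      = ∑ ψ : Fin n → Option (Fin m), (∏ i, w (ψ i)) * 𝔼 x : Fin n → Bool, AS (c' x ψ) := by
    calc _ = ∑ j : Fin m, (𝔼 x : Fin n → Bool, ∑ z : Fin n → Bool, (∏ i, if z i then δ else 1 - δ) * ind c x z) := by
          rw [sum_const, card_univ, Fintype.card_fin, nsmul_eq_mul]
      _ = ∑ j : Fin m, ∑ ψ : Fin n → Option (Fin m), (∏ i, w (ψ i)) * 𝔼 x : Fin n → Bool, Sn j (c' x ψ) :=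
          sum_congr rfl fun j _ => key j
      _ = _ := by
          rw [sum_comm]; apply sum_congr rfl; intro ψ _
          rw [← mul_sum, ← expect_sum_comm]; rfl
  rw [h2]
  calc _ ≤ ∑ ψ : Fin n → Option (Fin m), (∏ i, w (ψ i)) * M := by
        apply sum_le_sum; intro ψ _
        apply mul_le_mul_of_nonneg_left _ (prod_nonneg fun i _ => hw0 _)
        exact expect_le univ_nonempty fun x _ => hM _ (hc' x ψ)
    _ = (∏ i : Fin n, ∑ o, w o) * M := by
        rw [prod_univ_sum, Fintype.piFinset_univ, sum_mul]
    _ = M := by simp [hw1]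

lemma NS_small {n : ℕ} {δ : ℝ} (f : (Fin n → Bool) → ℝ) (h0 : 0 ≤ δ) (h1 : δ ≤ 1) : NS δ f ≤ n * δ := by
  have hx : ∀ x : Fin n → Bool, ∑ z : Fin n → Bool,
    (∏ i, if z i then δ else 1 - δ) * (if f (fun i => (x i != z i)) ≠ f x then 1 else 0) ≤ n * δ := by
    intro x
    have hnn : ∀ z : Fin n → Bool, 0 ≤ ∏ i, (if z i then δ else 1 - δ) := fun z =>
      prod_nonneg fun i _ => by split_ifs <;> linarith
    have hsum : ∑ z : Fin n → Bool, ∏ i, (if z i then δ else 1 - δ) = 1 := by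
      have := prod_univ_sum (ι := Fin n) (fun _ => (univ : Finset Bool)) (fun _ b => if b then δ else 1 - δ)
      rw [Fintype.piFinset_univ] at this
      rw [← this]; simp
    have hB := one_add_mul_le_pow (a := -δ) (by linarith) n
    calc _ ≤ ∑ z : Fin n → Bool, ((∏ i, if z i then δ else 1 - δ) - if z = (fun _ => false) then (1 - δ) ^ n else 0) := by
          apply sum_le_sum; intro z _
          by_cases hz : z = fun _ => false
          · subst hz; simp
          · rw [if_neg hz, sub_zero]
            apply mul_le_of_le_one_right (hnn z)
            split_ifs <;> norm_num
      _ = 1 - (1 - δ) ^ n := by rw [sum_sub_distrib, hsum]; simp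
      _ ≤ _ := by
          rw [← sub_eq_add_neg] at hB; linarith
  unfold NS
  rw [div_le_iff₀ (by positivity)]
  calc _ ≤ ∑ x : Fin n → Bool, (n:ℝ) * δ := sum_le_sum fun x _ => hx x
    _ = _ := by rw [sum_const, card_univ]; simp [mul_comm]

lemma NS_eq {n : ℕ} {δ : ℝ} (f : (Fin n → Bool) → ℝ) (c : Finset (Fin n) → ℝ)
    (hf : ∀ x, ev c (ch x) ≠ 0 ∧ f x = Real.sign (ev c (ch x))) :
    NS δ f = 𝔼 x : Fin n → Bool, ∑ z : Fin n → Bool, (∏ i, if z i then δ else 1 - δ) * ind c x z := by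
  rw [Fintype.expect_eq_sum_div_card]
  unfold NS
  have hcard : (Fintype.card (Fin n → Bool) : ℝ) = 2 ^ n := by simp
  rw [hcard]
  congr 1
  apply sum_congr rfl; intro x _
  apply sum_congr rfl; intro z _
  congr 1
  unfold ind
  obtain ⟨h1, h2⟩ := hf x
  obtain ⟨h3, h4⟩ := hf (fun i => (x i != z i))
  rw [h2, h4]
  rcases lt_or_gt_of_ne h1 with a | a <;> rcases lt_or_gt_of_ne h3 with b | b
  · rw [Real.sign_of_neg a, Real.sign_of_neg b, if_neg (by simp), if_neg (by nlinarith)]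
  · rw [Real.sign_of_neg a, Real.sign_of_pos b, if_pos (by norm_num), if_pos (mul_neg_of_neg_of_pos a b)]
  · rw [Real.sign_of_pos a, Real.sign_of_neg b, if_pos (by norm_num), if_pos (mul_neg_of_pos_of_neg a b)]
  · rw [Real.sign_of_pos a, Real.sign_of_pos b, if_neg (by simp), if_neg (by nlinarith)]

theorem final (d : ℕ) (hd : 1 ≤ d) :
    ∃ C : ℝ, 0 < C ∧ ∀ n : ℕ, 1 ≤ n → ∀ f : (Fin n → Bool) → ℝ, IsPTF d f →
      ∀ δ : ℝ, 0 < δ → δ < 1 / 2 →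
        NS δ f ≤ C * Real.sqrt (-Real.log (1 - 2 * δ)) * Real.log (Real.exp 1 * n) ^ C := by
  obtain ⟨Γ, β, hΓ, hAS⟩ := AS_bound d hd
  refine ⟨Γ * 2 ^ β + β + 1, by positivity, ?_⟩
  intro n hn f hf δ h0 h1
  set C : ℝ := Γ * 2 ^ β + β + 1 with hC
  have hΓβ : 0 < Γ * 2 ^ β := by positivity
  have hβ0 : (0:ℝ) ≤ β := by positivity
  have hn1 : (1:ℝ) ≤ n := by exact_mod_cast hn
  set L : ℝ := Real.log (Real.exp 1 * n) with hL
  have hLe : L = 1 + Real.log n := by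
    rw [hL, Real.log_mul (Real.exp_pos 1).ne' (by positivity), Real.log_exp]
  have hln : 0 ≤ Real.log n := Real.log_nonneg hn1
  have hL1 : 1 ≤ L := by linarith
  have ht : 2 * δ ≤ -Real.log (1 - 2 * δ) := by
    have := Real.log_le_sub_one_of_pos (show 0 < 1 - 2 * δ by linarith)
    linarith
  set t : ℝ := -Real.log (1 - 2 * δ) with htd
  have hLC : L ^ β ≤ L ^ C := by
    rw [← Real.rpow_natCast]
    exact Real.rpow_le_rpow_of_exponent_le hL1 (by linarith)
  have hLC1 : 1 ≤ L ^ C := Real.one_le_rpow hL1 (by linarith)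
  by_cases hs : δ * n ^ 2 ≤ 1
  · have h2 := NS_small f h0.le (by linarith)
    have h3 : n * δ ≤ √δ := by
      apply Real.le_sqrt_of_sq_le
      nlinarith
    have h4 : √δ ≤ √t := Real.sqrt_le_sqrt (by linarith)
    calc NS δ f ≤ √t := by linarith
      _ = 1 * √t * 1 := by ring
      _ ≤ C * √t * L ^ C := by gcongr; linarith
  · push Not at hs
    obtain ⟨p, hp1, hp2, hp3⟩ := hf
    obtain ⟨c, hc, hpc⟩ := ptf_coef p hp1 hp2
    have hNS := NS_eq (δ := δ) f c (fun x => by rw [← hpc]; exact hp3 x)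
    set m := ⌊1 / δ⌋₊ with hm
    have hm1 : (m:ℝ) ≤ 1 / δ := Nat.floor_le (by positivity)
    have hm2 : 1 / δ < m + 1 := Nat.lt_floor_add_one _
    have hd2 : 2 < 1 / δ := by rw [lt_div_iff₀ h0]; linarith
    have hm3 : (1:ℝ) < m := by linarith
    have hm4 : 1 ≤ m := by exact_mod_cast hm3.le
    have hmδ : (m:ℝ) * δ ≤ 1 := by rwa [le_div_iff₀ h0] at hm1
    have hmt : 1 ≤ m * t := by
      have : 1 < ((m:ℝ) + 1) * δ := by rwa [div_lt_iff₀ h0] at hm2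
      nlinarith
    have hmn : (m:ℝ) ≤ n ^ 2 := hm1.trans (by rw [div_le_iff₀ h0]; linarith)
    have hlm : 1 + Real.log m ≤ 2 * L := by
      have := Real.log_le_log (by linarith) hmn
      rw [Real.log_pow] at this
      push_cast at this
      rw [hLe]; linarith
    have hlm0 : 0 ≤ Real.log m := Real.log_nonneg hm3.le
    have hmain := NS_AS hc h0.le hmδ (fun c' hc' => hAS m hm4 c' hc')
    rw [← hNS] at hmain
    have hsm : 0 < √(m:ℝ) := Real.sqrt_pos.2 (by linarith)
    have hsm2 : √(m:ℝ) * √(m:ℝ) = m := Real.mul_self_sqrt (by linarith)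
    have hst : 1 ≤ √(m:ℝ) * √t := by
      rw [← Real.sqrt_mul (by linarith)]; exact Real.one_le_sqrt.2 hmt
    have h5 : Γ * (1 + Real.log m) ^ β ≤ C * L ^ C := by
      calc Γ * (1 + Real.log m) ^ β ≤ Γ * (2 * L) ^ β := by gcongr
        _ = Γ * 2 ^ β * L ^ β := by rw [mul_pow]; ring
        _ ≤ C * L ^ C := by gcongr; linarith
    have hX : 0 ≤ C * L ^ C := by positivity
    have h6 : (m:ℝ) * NS δ f ≤ m * (C * √t * L ^ C) := by
      calc (m:ℝ) * NS δ f ≤ Γ * (1 + Real.log m) ^ β * √m := hmain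
        _ ≤ C * L ^ C * √m := by gcongr
        _ = C * L ^ C * √m * 1 := by ring
        _ ≤ C * L ^ C * √m * (√m * √t) := by gcongr
        _ = C * L ^ C * (√m * √m) * √t := by ring
        _ = _ := by rw [hsm2]; ring
    exact le_of_mul_le_mul_left h6 (by linarith)

end PT

end

/-- Noise sensitivity bound for degree-`d` PTFs. -/
theorem ns_ptf_polylog (d : ℕ) (hd : 1 ≤ d) :
    ∃ C : ℝ, 0 < C ∧ ∀ n : ℕ, 1 ≤ n → ∀ f : (Fin n → Bool) → ℝ, IsPTF d f →
      ∀ δ : ℝ, 0 < δ → δ < 1 / 2 →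
        NS δ f ≤ C * Real.sqrt (-Real.log (1 - 2 * δ)) * Real.log (Real.exp 1 * n) ^ C := by
  exact PT.final d hd
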